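/- The total number of prime dissections of order exactly 10, summed over all side lengths n (this sum is finite, since every prime dissection of order 10 has n ≤ 13), is 384. -/

import Mathlib

/-- The closed square with lower-left corner `(q.1, q.2.1)` and side `q.2.2`,
as a subset of the plane. -/
def closedSq (q : ℕ × ℕ × ℕ) : Set (ℝ × ℝ) :=
  Set.Icc (q.1 : ℝ) (q.1 + q.2.2) ×ˢ Set.Icc (q.2.1 : ℝ) (q.2.1 + q.2.2)

/-- The interior (open square) of the placed square `q`. -/
def openSq (q : ℕ × ℕ × ℕ) : Set (ℝ × ℝ) :=
  Set.Ioo (q.1 : ℝ) (q.1 + q.2.2) ×ˢ Set.Ioo (q.2.1 : ℝ) (q.2.1 + q.2.2)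

/-- `D` is a dissection of the `n × n` square: a finite family of axis-aligned
squares with positive integer side lengths and integer lower-left corners, whose
interiors are pairwise disjoint and whose union is `[0,n] × [0,n]`.  Its order is
`D.card`. -/
def IsDissection (n : ℕ) (D : Finset (ℕ × ℕ × ℕ)) : Prop :=
  (∀ q ∈ D, 0 < q.2.2) ∧
  (⋃ q ∈ D, closedSq q) = Set.Icc (0 : ℝ) (n : ℝ) ×ˢ Set.Icc (0 : ℝ) (n : ℝ) ∧
  (∀ q ∈ D, ∀ q' ∈ D, q ≠ q' → openSq q ∩ openSq q' = ∅)

/-- A dissection is prime if the gcd of the side lengths of its squares is 1. -/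
def IsPrimeDissection (n : ℕ) (D : Finset (ℕ × ℕ × ℕ)) : Prop :=
  IsDissection n D ∧ D.gcd (fun q => q.2.2) = 1

set_option maxRecDepth 100000
set_option linter.all false
set_option exponentiation.threshold 20000

namespace PD

inductive LL | nil | cons (h x : Nat) (t : LL)
inductive RL | nil | dn (h x : Nat) (t : RL) | up (h x : Nat) (t : RL)
inductive SL | nil | cons (x y z : Nat) (t : SL)

def c64 : Nat := nat_lit 64
def cW : Nat := nat_lit 432
def cN : Nat := nat_lit 496
def cB : Nat := Nat.pow (nat_lit 2) (nat_lit 48)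
def cQ : Nat := Nat.pow (nat_lit 2) (nat_lit 432)
def cRM : Nat := Nat.sub cQ (nat_lit 1)
def cBM : Nat := Nat.sub cB (nat_lit 1)
def oo : Nat := Nat.pow (nat_lit 2) (nat_lit 47)
def ones1 : Nat := Nat.div cRM cBM
def all1 : Nat := Nat.div (Nat.sub (Nat.pow cQ (nat_lit 19)) (nat_lit 1)) cRM
def hb1 : Nat := Nat.mul ones1 oo
def off : Nat := Nat.mul all1 hb1
def offR : Nat := Nat.mul all1 oo
def offL : Nat := Nat.mul offR hb1
def offS : Nat := Nat.mul oo hb1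
def colM : Nat := Nat.mul all1 cBM
def bet1 : Nat := Nat.mul ones1 (Nat.pow (nat_lit 2) (nat_lit 18))
def bet : Nat := Nat.mul all1 bet1
def top1 : Nat := Nat.mul ones1 (Nat.sub cB (Nat.pow (nat_lit 2) (nat_lit 19)))
def top : Nat := Nat.mul all1 top1
def cP : Nat := Nat.sub (Nat.pow (nat_lit 2) (nat_lit 61)) (nat_lit 1)
def ptab : Nat := nat_lit 16674060850173551887048909695723571013115685656904386439411018644025926135840768

noncomputable def frc (n : Nat) (k : Nat → Bool) : Bool := Nat.rec (k Nat.zero) (fun m _ => k (Nat.succ m)) n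
noncomputable def ift (b : Bool) (t f : Bool) : Bool := Bool.rec f t b
noncomputable def iz (n : Nat) (t f : Bool) : Bool := Nat.rec t (fun _ _ => f) n
noncomputable def an (a b : Bool) : Bool := Bool.rec false b a
def hs (S : Nat) : Nat := Nat.add (Nat.shiftLeft S c64) (Nat.mod S cP)
def un (S : Nat) : Nat := Nat.shiftRight S c64
def row (S a : Nat) : Nat := Nat.land (Nat.shiftRight S a) cRM
def df (S a b : Nat) : Nat := Nat.sub (Nat.add (row S a) hb1) (row S b)
def f4 (S p q r s : Nat) : Nat := Nat.sub (Nat.add (Nat.add (row S p) (row S q)) hb1) (Nat.add (row S r) (row S s))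
def pm (l : Nat) : Nat := Nat.land (Nat.sub l ones1) hb1
def ng (l : Nat) : Nat := Nat.sub (Nat.add hb1 hb1) l
def sng (P : Nat) : Nat := Nat.land P (Nat.sub P (nat_lit 1))
def dig (l sh : Nat) : Nat := Nat.land (Nat.shiftRight l sh) cBM
def colx (S sh : Nat) : Nat := Nat.land (Nat.shiftRight S sh) colM
def sub0 (S c X l : Nat) : Nat :=
  Nat.sub (Nat.add (Nat.add (Nat.mul c S) (Nat.mul X hb1)) (Nat.add (Nat.mul offR l) off))
    (Nat.add (Nat.add (Nat.mul c off) (Nat.mul X l)) offL)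
def sub1 (S c X l : Nat) : Nat :=
  Nat.sub (Nat.add (Nat.add (Nat.mul c S) (Nat.mul X hb1)) (Nat.add (Nat.mul oo l) hb1))
    (Nat.add (Nat.add (Nat.mul c hb1) (Nat.mul X l)) offS)
noncomputable def rng (S : Nat) (k : Nat → Bool) : Bool :=
  ift (Nat.beq (Nat.land (Nat.add S bet) top) off) (frc (hs S) k) false
noncomputable def psh (P : Nat) (k : Nat → Bool) : Bool :=
  frc (Nat.land (Nat.shiftRight ptab (Nat.mul (nat_lit 16) (Nat.mod (Nat.sub P (sng P)) (nat_lit 23)))) (nat_lit 65535)) k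
noncomputable def zsub (S l sh c : Nat) (k : Nat → Bool) : Bool :=
  ift (Nat.ble c oo) false (rng (sub0 (un S) (Nat.sub c oo) (colx (un S) sh) l) k)
noncomputable def zpiv (S l P : Nat) (k : Nat → Bool) : Bool :=
  psh P fun sh => zsub S l sh (dig l sh) k
noncomputable def zero2 (S l P Pn : Nat) (k : Nat → Bool) : Bool :=
  iz P true (iz Pn true (iz (sng P) (zpiv S l P k) (iz (sng Pn) (zpiv S (ng l) Pn k) (zpiv S l P k))))
noncomputable def zeroL (S l : Nat) (k : Nat → Bool) : Bool :=
  ift (Nat.beq l hb1) (k S) (zero2 S l (pm l) (pm (ng l)) k)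
noncomputable def psub (S l sh : Nat) (k : Nat → Bool) : Bool :=
  ift (Nat.beq (dig l sh) (Nat.succ oo))
   (rng (sub0 (un S) (nat_lit 1) (colx (un S) sh) (Nat.sub l (Nat.shiftLeft (nat_lit 1) sh))) k) (k S)
noncomputable def pos2 (S l P : Nat) (k : Nat → Bool) : Bool :=
  iz P true (iz (sng P) (ift (Nat.beq (Nat.land l hb1) hb1) (k S) (psh P fun sh => psub S l sh k)) (k S))
noncomputable def posB (f : Bool) (S l : Nat) (k : Nat → Bool) : Bool :=
  Bool.rec (iz (pm l) true (k S)) (pos2 S l (pm l) k) f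
noncomputable def addr (S l a : Nat) (k : Nat → Bool) : Bool :=
  ift (Nat.beq (Nat.land (Nat.add l bet1) top1) hb1)
   (frc (hs (un (Nat.sub (Nat.add S (Nat.shiftLeft l a)) (Nat.shiftLeft hb1 a)))) k) false
noncomputable def cmpS (f : Bool) (S p q : Nat) (cl ce cg : Bool) (kl ke kg : Nat → Bool) : Bool :=
  an (ift cl (posB f S (df S q p) kl) true)
    (an (ift ce (zeroL S (df S q p) ke) true) (ift cg (posB f S (df S p q) kg) true))

def Go := Nat → Nat → Nat → SL → LL → Nat → Nat → Nat → Nat → RL → Bool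
noncomputable def norm (R : RL) (g : LL → Nat → Nat → Nat → Nat → RL → Bool) : LL → Nat → Nat → Bool :=
  RL.rec (motive := fun _ => LL → Nat → Nat → Bool) (fun _ _ _ => true)
    (fun h' x' _ ih L h x => ih (LL.cons h x L) h' x')
    (fun h' x' t _ L h x => g L h x h' x' t) R
noncomputable def nR (R : RL) (b : Bool) : Bool := RL.rec false (fun _ _ _ _ => b) (fun _ _ _ _ => b) R
noncomputable def nL (R : LL) (b : Bool) : Bool := LL.rec false (fun _ _ _ _ => b) R
def p1 (a : Nat) : Nat := Nat.sub a (nat_lit 1)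
def g1 (a : Nat) : Bool := Nat.ble (nat_lit 1) a

noncomputable def gF (g : Go) (a b : Nat) (sq : SL) (L : LL) (h x hr xr : Nat) (R : RL) (S : Nat) : Bool := g S a b sq L h x hr xr R
noncomputable def nF (g : Go) (a b : Nat) (sq : SL) (L : LL) (h x : Nat) (R : RL) (S : Nat) : Bool := norm R (g S a b sq) L h x
noncomputable def stepAl (f : Bool) (g : Go) (T a b : Nat) (sq : SL) (L : LL) (x hr xr : Nat) (R : RL) (S : Nat) : Bool :=
  cmpS f S T hr (g1 b) (nR R true) (nR R (Nat.ble (nat_lit 2) a))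
    (gF g (p1 a) (p1 b) sq L T x hr xr R) (nF g (p1 a) b sq L T x R) (nF g (p1 (p1 a)) b sq L T x (RL.dn hr xr R))
noncomputable def stepAe (f : Bool) (g : Go) (T a b : Nat) (sq : SL) (hl xl : Nat) (L' : LL) (hr xr : Nat) (R : RL) (S : Nat) : Bool :=
  cmpS f S T hr (nL L' (g1 b)) (nR R true) (nR R (g1 a))
    (gF g a (p1 b) sq L' hl xl hr xr R) (nF g a b sq L' hl xl R) (nF g (p1 a) b sq L' hl xl (RL.dn hr xr R))
noncomputable def stepAg (f : Bool) (g : Go) (T a b : Nat) (sq : SL) (hl xl : Nat) (L' : LL) (x hr xr : Nat) (R : RL) (S : Nat) : Bool :=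
  cmpS f S T hr (Nat.ble (nat_lit 2) b) true (nR R (g1 a))
    (gF g a (p1 (p1 b)) sq L' hl xl T x (RL.up hr xr R)) (gF g a (p1 b) sq L' hl xl T x R) (gF g (p1 a) (p1 b) sq L' hl xl T x (RL.dn hr xr R))
noncomputable def stepA1 (f : Bool) (g : Go) (T a b : Nat) (sq : SL) (hl xl : Nat) (L' : LL) (x hr xr : Nat) (R : RL) (S : Nat) : Bool :=
  cmpS f S T hl (g1 a) true (nL L' (g1 b))
    (stepAl f g T a b sq (LL.cons hl xl L') x hr xr R) (stepAe f g T a b sq hl xl L' hr xr R) (stepAg f g T a b sq hl xl L' x hr xr R)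
noncomputable def stepB3 (f : Bool) (g : Go) (T E a b : Nat) (sq : SL) (hl xl : Nat) (L' : LL) (h x hr xr : Nat) (R : RL) (S : Nat) : Bool :=
  cmpS f S T hl (g1 a) true (nL L' (g1 b))
    (gF g (p1 a) b sq (LL.cons T x (LL.cons hl xl L')) h E hr xr R)
    (gF g a b sq (LL.cons hl xl L') h E hr xr R)
    (gF g a (p1 b) sq L' hl xl T x (RL.dn h E (RL.up hr xr R)))
noncomputable def stepB2 (f : Bool) (xr E : Nat) (k : Nat → Bool) (S : Nat) : Bool := posB f S (df S xr E) k
noncomputable def stepB1 (f : Bool) (x xr E e : Nat) (k : Nat → Bool) (S : Nat) : Bool := addr S (Nat.add (row S x) e) E (stepB2 f xr E k)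
noncomputable def stepB (f : Bool) (g : Go) (T E e S a b : Nat) (sq : SL) (hl xl : Nat) (L' : LL) (h x hr xr : Nat) (R : RL) : Bool :=
  ift (g1 a) (ift (g1 b) (addr S (Nat.add (row S h) e) T (stepB1 f x xr E e (stepB3 f g T E (p1 a) (p1 b) sq hl xl L' h x hr xr R))) true) true
noncomputable def stepC (f : Bool) (g : Go) (T E e S a b : Nat) (sq : SL) (hl xl : Nat) (L' : LL) (h x hr xr : Nat) (R : RL) : Bool :=
    an (addr S (Nat.sub (Nat.add (row S h) (row S xr)) (row S x)) T (stepA1 f g T a b sq hl xl L' x hr xr R))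
      (stepB f g T E e S a b sq hl xl L' h x hr xr R)
noncomputable def step (f : Bool) (g : Go) (T E e : Nat) : Go := fun S a b sq L h x hr xr R =>
  LL.rec true (fun hl xl L' _ => stepC f g T E e S a b (SL.cons x h T sq) hl xl L' h x hr xr R) L

noncomputable def gcdS (X : Nat) (sq : SL) : Nat :=
  SL.rec Nat.zero (fun _ y z _ ih => Nat.gcd (Nat.sub (dig X z) (dig X y)) ih) sq
noncomputable def allp (X : Nat) (sq : SL) : Bool :=
  SL.rec true (fun _ y z _ ih => ift (Nat.ble (dig X z) (dig X y)) false ih) sq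
noncomputable def codeS (X g : Nat) (sq : SL) : Nat :=
  SL.rec Nat.zero (fun x y z _ ih =>
   Nat.add (Nat.shiftLeft (nat_lit 1) (Nat.add (Nat.mul (nat_lit 100) (Nat.div (Nat.sub (dig X x) oo) g))
    (Nat.add (Nat.mul (nat_lit 10) (Nat.div (Nat.sub (dig X y) oo) g)) (Nat.div (Nat.sub (dig X z) (dig X y)) g)))) ih) sq
def tbl : List Nat := [
  1101202011111021222121031131, 1102011301311021121222031131, 1101201301011111211311022222,
  1101201301012211311222031131, 2201301211311021121222031131, 1101201301011111212022231331,
  1101201301012212031131231331, 2201301212021121031231131331, 1101202011111021122031321331,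
  1101202011111221022321231331, 1101202012221031131321231331, 2202021121221321031131231331,
  1102011301311021122031321331, 2201301211311021122031321331, 1102011301311022221321231331,
  2201301211311022221321231331, 1101201301401011114021031041, 1103011021403031131231334043,
  1103011021403033334061161261, 1101201301403013311043321334, 3301403311321031131231334043,
  3301403311321033334061161261, 1104011021031041141241341441, 1101201301401014411421431441,
  4401411421431041141241341441, 1101201304013041143051061443, 3304031131231041143051061443,
  1101201304013341043443351361, 3304031131231043341443351361, 3304033341443351061161261361,
  1101202011111404222022444044, 1101202012404222031131444044, 2202404021121222031131444044,
  1101202011111404024444062262, 2202404024444061161262071171, 4404041141242051151444262062,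
  4404041141242052444262071171, 4404042242444061161262071171, 1102011301404311444022222044,
  2201301404211311444022222044, 1102011301404311444024062262, 2201301404211311444024062262,
  2201301404212022444231331044, 2202404021122031321444331044, 2202404022221321231444331044,
  4404041142051341444351062262, 4404042241341444251351062262, 4404042241341444252062271371,
  2202404024444061162071361371, 4404042242444061162071361371, 2202404024444062261361271371,
  4404042242444062261361271371, 1102011302502021121225032052, 1102011302502022225041141052,
  1102011302502022225042061161, 1101201302012211032502225052, 2201302211502021121225032052,
  2201302211502022225041141052, 2201302211502022225042061161, 1101202012401502411225032052,
  2202401502411021121225032052, 2202401502411022225041141052, 2202401502411022225042061161,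
  1101203012503031132041335053, 2203021121503031132041335053, 1101203012503033335061162071,
  2203021121503033335061162071, 1101203012503231032335241053, 2203021121503032231335241053,
  2203022503231335041141241053, 2203022503231335043071171271, 1101203012503033335062261271,
  2203021121503033335062261271, 1102011301401503312023335053, 3301401503312031132041335053,
  3301401503312033335061162071, 2201301401503211312023335053, 3301401503312032231335241053,
  3301401503312033335062261271, 1102011302503023321421335053, 3302503321421031132041335053,
  3302503321421033335061162071, 2201302211503023321421335053, 3302503321421032231335241053,
  3302503321421033335062261271, 2202401503411023321421335053, 1102011302504023322341445054,
  3302504322031132041341445054, 2201302211504023322341445054, 3302504322032231341241445054,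
  2202401504411023322341445054, 1101203012504232032431054445, 2203021121504032232431054445,
  2203022504232041141431054445, 1101203012504034431072272445, 2203021121504034431072272445,
  3301401504312032232431054445, 3301401504312034431072272445, 3302504321421032232431054445,
  3302504321421034431072272445, 1101205012032051152061352552, 2205021121032051152061352552,
  2205022041141051152061352552, 1101205012251032352261052552, 2205021121032251052352261552,
  2205022041141052251352261552, 2205022042251352061161261552, 1101205012252032052451552461,
  2205021121032252052451552461, 2205022041141052252451552461, 2205022042252061161451552461,
  1102011305023051151253062553, 3305031132041051151253062553, 1102011305023052253071171553,
  3305031132041052253071171553, 2201305211023051151253062553, 2201305211023052253071171553,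
  1101201305013042241062253553, 3305031131231042241062253553, 3305032231241051151253062553,
  3305032231241052253071171553, 1102011305023351053451553362, 3305031132041351053451553362,
  3305033351451553061162071362, 2201305211023351053451553362, 3305032231241053351451553362,
  3305033351451553062261362271, 1102011305023352053553371471, 3305031132041352053553371471,
  3305033352061162071553371471, 2201305211023352053553371471, 3305032231241053352553371471,
  3305033352062261553271371471, 3305033351451553062262461471, 4405041142051341352063554372,
  4405043341352554071172081372, 4405042241341251352063554372, 4405043341352554072271372281,
  2202405024451554061161263072, 2202405024451554062263081181, 4405041141242052451554263072,
  4405042242451554061161263072, 4405042242451554062263081181, 2202405024451063361554461372,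
  4405042242451554063361461372, 2202405024451554063362381481, 4405042242451554063362381481,
  4405043341352554072272471481, 1103011021401501601413034443, 4401501601413041143051061443,
  3301401501601311413321443034, 4401501601413043341443351361, 1102011302501601512025532552,
  2201302211501601512025532552, 5501601512051152061352532552, 5501601512052251352261532552,
  2202401501601411512025532552, 5501601512052252451532461552, 1103011021402602421523035553,
  3301402311602321421523035553, 1101203012501602511035523553, 2203021121501602511035523553,
  5501602511523051151253062553, 5501602511052253071171523553, 3301401501602312511035523553,
  3302501602511321421523035553, 5501602511523053351451553362, 5501602511523053352553371471,
  1101202012402601611225032052, 2202402601611021121225032052, 2202402601611022225041141052,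
  2202402601611022225042061161, 1102011302502025521621532552, 2201302211502025521621532552,
  5502521621532051152061352552, 5502521621532052251352261552, 2202401502411025521621532552,
  5502521621532052252451552461, 1101201303013601611621334043, 3303601611621031131231334043,
  3303601611621033334061161261, 2202402601611025521621532552, 1101204011111022602622044444,
  1101204012031131602622044444, 2204021121031131602622044444, 4401501602411511622422044444,
  4401501602412044622431531444, 4402602421521622431531044444, 1103011021403034431531631443,
  4403431531631041143051061443, 3301403311321034431531631443, 4403431531631043341443351361,
  3303601611621034431531631443, 1101203012503035531632541553, 2203021121503035531632541553,
  5503531632541051151253062553, 5503531052253071171632541553, 3301401503312531035632541553,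
  3302503321421035531632541553, 5503531632541053351451553362, 5503531632541053352553371471,
  1102011302502025522541641552, 2201302211502025522541641552, 5502522541641051152061352552,
  5502522541641052251352261552, 2202401502411025522541641552, 5502522541641052252451552461,
  2202402601611025522541641552, 1103011021403034433461561661, 4403433041143051061461561661,
  3301403311321034433461561661, 4403433043341351361461561661, 1102011302502025522542561661,
  2201302211502025522542561661, 5502522542051152061352561661, 5502522542052251352261561661,
  2202401502411025522542561661, 5502522542052252451461561661, 2202402601611025522542561661,
  3303601611621034433461561661, 1101205012252032052452651661, 2205021121032252052452651661,
  2205022041141052252452651661, 2205022042252061161452651661, 5501601512532052252452651661,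
  5502521621532052252452651661, 1101201304013343043641651661, 3304031131231043343641651661,
  3304033343061161261641651661, 5502522541641052252452651661, 4401501601413043343641651661,
  4403431531631043343641651661, 5503533051153061071451462662, 5503533053351451361462371662,
  1101203012503035533561662571, 2203021121503035533561662571, 5503533051151253062561662571,
  5503533052253071171561662571, 3301401503312533035561662571, 3302503321421035533561662571,
  5503533053351451362561662571, 5503533053352561662371471571, 4401501602411511424044462662,
  4402602424044461561662471571, 4404041141244051151062642662, 4404041141244052071171642662,
  4404042244061161071171642662, 4404044441541642451551662462, 4404044441541642452662471571,
  4404044442642461561662471571, 1102011303023601701612335053, 3303601701612031132041335053,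
  3303601701612033335061162071, 2201303211023601701612335053, 3303601701612032231335241053,
  3303601701612033335062261271, 3303601701612035531632541553, 3303601701612035533561662571,
  5501601701513541642053353662, 4401502411702422623045541554, 2204022601702611045541623554,
  4402601702611422623045541554, 5502702524054451561461663472, 5502702524054451462663481581,
  1101203012502701711523035553, 2203021121502701711523035553, 5502701711523051151253062553,
  5502701711523052253071171553, 3301401502312701711523035553, 3302502701711321421523035553,
  5502701711523053351451553362, 5502701711523053352553371471, 4401502411701711422622044444,
  2204022601701611711622044444, 4402601701611711422622044444, 4401502411701711424044462662,
  4402601701611711424044462662, 1102011303023602621721335053, 3303602621721031132041335053,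
  3303033602621721335061162071, 2201303211023602621721335053, 3303032231241602621721335053,
  3303033602621721335062261271, 3303602621721035531632541553, 3303602621721035533561662571,
  2202403023321053701711721335, 1102011304023702722341445054, 3304031132041702722341445054,
  2201304211023702722341445054, 3304032231702722241341445054, 5503531631731541642053353662,
  2204022601701612631731044444, 4402601701612422044631731444, 4402602421522431721731044444,
  2204022602621721631731044444, 4402602422621721631731044444, 4401501603412431532045732554,
  4402603421521431532045732554, 2204022603631045541732641554, 4402603422631732045541641554,
  3303602622035531541641741553, 1101203012503035532731741553, 2203021121503035532731741553,
  5503532731741051151253062553, 5503532052253071171731741553, 3301401503312532035731741553,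
  3302503321421035532731741553, 5503532731741053351451553362, 5503532731741053352553371471,
  3303601701612035532731741553, 3303602621721035532731741553, 5504542054451742461561663472,
  5504542054451742462663481581, 5504541641742052254072651663, 5504541641742054452651472663,
  1102011305023353053651751662, 3305031132041353053651751662, 3305033353061162071651751662,
  2201305211023353053651751662, 3305032231241053353651751662, 3305033353062261271651751662,
  5501602511523053353651751662, 5503531632541053353651751662, 5502701711523053353651751662,
  4404044441542451741751462662, 4404042244062641741651751662, 4404044442641741651751462662,
  5503532731741053353651751662, 3303602622035531543571671771, 1102011305023353053652671771,
  3305031132041353053652671771, 3305033353061162071652671771, 2201305211023353053652671771,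
  3305032231241053353652671771, 3305033353062261271652671771, 5501602511523053353652671771,
  5503531632541053353652671771, 5502701711523053353652671771, 4404042244062641741652671771,
  4404044442641741652462671771, 5503532731741053353652671771, 1101203012503035533562761771,
  2203021121503035533562761771, 5503533051151253062562761771, 5503533052253071171562761771,
  3301401503312533035562761771, 3302503321421035533562761771, 5503533053351451362562761771,
  5503533053352562371471761771, 4402602424044461562471761771, 4404044442642461562471761771,
  4402602424044462661761671771, 4404042244062642661761671771, 4404044442642462661761671771,
  3303601701612035533562761771, 3303602621721035533562761771, 3305033351453062262751761771,
  4401501603412431534045572772, 4402603421521431534045572772, 5504541643054452471572481772,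
  5504541643052254072671772681, 5504541643054452671472772681, 4405041142051341354063752772,
  4405043341354071172081752772, 4405042241341251354063752772, 4405043341354072271281752772,
  4403701801712431532045732554, 4403701801712431534045572772, 2204022602801811623045541554,
  4402602801811422623045541554, 4403702721821431532045732554, 4403702721821431534045572772,
  4403702722431532045741841554, 5504542054451741841752463772, 2204022603632045541831841554,
  4402603422632045541831841554, 5504541642052254072841851663, 5504541642054452841851663472,
  5502702524054451463761861772, 5504542054451742463761861772, 5502702524054451463762781881,
  5504542054451742463762781881, 5504541643052254072672871881, 5504541643054452672472871881]
noncomputable def keyC (n : Nat) : Nat → Nat :=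
  Nat.rec (motive := fun _ => Nat → Nat) (fun _ => nat_lit 0)
    (fun _ ih c => Nat.add (Nat.shiftLeft (nat_lit 1) (Nat.mod c (nat_lit 1000))) (ih (Nat.div c (nat_lit 1000)))) n
noncomputable def isT (k : Nat) : Bool := List.rec false (fun t _ ih => ift (Nat.beq k (keyC (nat_lit 10) t)) true ih) tbl
noncomputable def leaf2 (sq : SL) (S X sh : Nat) : Bool :=
  ift (Nat.beq (Nat.add (un S) (Nat.shiftLeft offR sh)) (Nat.add off (Nat.shiftLeft (un X) sh)))
   (ift (allp X sq) (frc (gcdS X sq) fun g =>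
      an (Nat.ble (Nat.div (Nat.sub (dig X cN) oo) g) (nat_lit 9)) (frc (codeS X g sq) isT)) true) false
noncomputable def leaf (sq : SL) (S : Nat) : Bool :=
  psh (pm (row S cN)) fun sh => frc (Nat.shiftLeft (colx (un S) sh) c64) fun X => leaf2 sq S X sh

noncomputable def zchk (l : Nat) (k : Bool) : Bool :=
  ift (Nat.beq l hb1) k (iz (pm l) true (iz (pm (ng l)) true k))
noncomputable def chk2 (l m P : Nat) (k : Bool) : Bool :=
  iz P k (psh P fun sh => ift (Nat.ble (dig l sh) oo) false (zchk (sub1 m (Nat.sub (dig l sh) oo) (dig m sh) l) k))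
noncomputable def fz4 (sq : SL) (p q r s S : Nat) : Bool := zeroL S (f4 S p q r s) (leaf sq)
noncomputable def close3 (S e1 e2 p q r s : Nat) (sq : SL) : Bool :=
  zchk e1 (zchk e2 (chk2 e1 e2 (pm e1) (zeroL S e1 (fz4 sq p q r s))))
noncomputable def close2 (p q r s p' q' r' s' : Nat) (sq : SL) (S : Nat) : Bool :=
  close3 S (f4 S p q r s) (f4 S p' q' r' s') p' q' r' s' sq
noncomputable def close4 (u v p q r s p' q' r' s' : Nat) (sq : SL) (S : Nat) : Bool :=
  zchk (df S u v) (zchk (f4 S p q r s) (zchk (f4 S p' q' r' s') (zeroL S (df S u v) (close2 p q r s p' q' r' s' sq))))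
noncomputable def finS (T S : Nat) (sq : SL) (h x xr : Nat) : Bool :=
  an (zchk (Nat.sub (Nat.add (f4 S cN x h xr) (row S x)) (row S xr))
           (addr S (Nat.sub (Nat.add (row S h) (row S xr)) (row S x)) T (fz4 (SL.cons x T cN (SL.cons x h T sq)) cN x T xr)))
     (zchk (Nat.sub (Nat.add (f4 S cN x h xr) (row S cN)) (row S h))
           (addr S (Nat.sub (Nat.add (row S x) (row S cN)) (row S h)) T (fz4 (SL.cons T h cN (SL.cons x h cN sq)) cN T h xr)))
noncomputable def finD (S : Nat) (sq : SL) (h x hr xr h3 x3 : Nat) (R : RL) : Bool :=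
  RL.rec true (fun _ _ _ _ => true) (fun _ x4 _ _ => close4 cN hr cN x h xr cN x3 h3 x4 (SL.cons x3 h3 cN (SL.cons x h cN sq)) S) R
noncomputable def finU (S : Nat) (sq : SL) (h x hr xr x3 : Nat) : Bool :=
  an (close2 hr x h xr cN x hr x3 (SL.cons x hr cN (SL.cons x h hr sq)) S)
     (close2 cN x h xr cN xr hr x3 (SL.cons xr hr cN (SL.cons x h cN sq)) S)
noncomputable def finN (S : Nat) (sq : SL) (hl xl h x xr : Nat) : Bool :=
  an (close2 hl x h xr cN xl hl xr (SL.cons xl hl cN (SL.cons x h hl sq)) S)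
     (close2 cN x h xr cN xl hl x (SL.cons xl hl cN (SL.cons x h cN sq)) S)
noncomputable def fin2a (T S : Nat) (sq : SL) (h x hr xr : Nat) (R : RL) : Bool :=
  RL.rec (finS T S sq h x xr) (fun h3 x3 R3 _ => finD S sq h x hr xr h3 x3 R3) (fun _ x3 _ _ => finU S sq h x hr xr x3) R
noncomputable def fin2b (S : Nat) (sq : SL) (hl xl h x hr xr : Nat) (R : RL) : Bool :=
  RL.rec (finN S sq hl xl h x xr) (fun _ _ _ _ => true)
    (fun _ x4 _ _ => close4 hl hr hl x h xr cN xl hl x4 (SL.cons xl hl cN (SL.cons x h hl sq)) S) R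
noncomputable def fin2 (T : Nat) : Go := fun S _ _ sq L h x hr xr R =>
  LL.rec true (fun hl xl L' _ => LL.rec (fin2a T S sq h x hr xr R) (fun _ _ _ _ => fin2b S sq hl xl h x hr xr R) L') L
noncomputable def G0 : Go := fin2 (nat_lit 7840)
noncomputable def G1 : Go := step false G0 (nat_lit 6976) (nat_lit 7408) (Nat.pow (nat_lit 2) (nat_lit 0))
noncomputable def G2 : Go := step true G1 (nat_lit 6112) (nat_lit 6544) (Nat.pow (nat_lit 2) (nat_lit 48))
noncomputable def G3 : Go := step true G2 (nat_lit 5248) (nat_lit 5680) (Nat.pow (nat_lit 2) (nat_lit 96))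
noncomputable def G4 : Go := step true G3 (nat_lit 4384) (nat_lit 4816) (Nat.pow (nat_lit 2) (nat_lit 144))
noncomputable def selF (i : Nat) (g : Go) : Go := fun S a b sq L h x hr xr R =>
  ift (Nat.beq (Nat.mod S (nat_lit 12)) i) (g S a b sq L h x hr xr R) true
noncomputable def G5 (i : Nat) : Go := step true (selF i G4) (nat_lit 3520) (nat_lit 3952) (Nat.pow (nat_lit 2) (nat_lit 192))
noncomputable def G6 (i : Nat) : Go := step true (G5 i) (nat_lit 2656) (nat_lit 3088) (Nat.pow (nat_lit 2) (nat_lit 240))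
noncomputable def G7 (i : Nat) : Go := step true (G6 i) (nat_lit 1792) (nat_lit 2224) (Nat.pow (nat_lit 2) (nat_lit 288))
noncomputable def G8 (i : Nat) : Go := step true (G7 i) (nat_lit 928) (nat_lit 1360) (Nat.pow (nat_lit 2) (nat_lit 336))
noncomputable def run (i : Nat) : Bool :=
  frc (hs (Nat.add off (Nat.shiftLeft (nat_lit 1) (nat_lit 816)))) fun S =>
  G8 i S (nat_lit 9) (nat_lit 9) SL.nil (LL.cons cN c64 LL.nil) c64 c64 cN cN RL.nil
end PD

namespace PD
open Finset

def dg (U k : ℕ) : ℕ := U / cB ^ k % cB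
theorem cB_eq : cB = 2 ^ 48 := rfl
theorem oo_eq : oo = 2 ^ 47 := rfl
theorem cB_pos : 0 < cB := by rw [cB_eq]; norm_num
theorem cB_oo : (cB : ℤ) = 2 * oo := by rw [cB_eq, oo_eq]; norm_num
theorem oo_val : (oo : ℤ) = 2 ^ 47 := by rw [oo_eq]; norm_num

theorem sum_dg (U n : ℕ) : U % cB ^ n = ∑ k ∈ range n, dg U k * cB ^ k := by
  induction n with
  | zero => simp [Nat.mod_one]
  | succ n ih => rw [sum_range_succ, ← ih, Nat.mod_pow_succ, dg, mul_comm (cB ^ n)]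

theorem dg_succ (U k : ℕ) : dg U (k + 1) = dg (U / cB) k := by
  unfold dg; rw [pow_succ', ← Nat.div_div_eq_div_mul]

theorem dg_sum (n : ℕ) : ∀ v : ℕ → ℕ, (∀ k < n, v k < cB) →
    (∑ k ∈ range n, v k * cB ^ k) < cB ^ n ∧
    ∀ k < n, dg (∑ k ∈ range n, v k * cB ^ k) k = v k := by
  induction n with
  | zero => intro v hv; simp
  | succ n ih =>
    intro v hv
    obtain ⟨h1, h2⟩ := ih (fun k => v (k + 1)) (fun k hk => hv (k + 1) (by omega))
    have e : ∑ k ∈ range (n + 1), v k * cB ^ k = v 0 + cB * ∑ k ∈ range n, v (k + 1) * cB ^ k := by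
      rw [sum_range_succ', mul_sum, add_comm]; simp only [pow_zero, mul_one]
      congr 1; apply sum_congr rfl; intro i _; ring
    have h0 := hv 0 (by omega)
    rw [e]
    refine ⟨?_, ?_⟩
    · rw [pow_succ']
      calc _ < cB + cB * ∑ k ∈ range n, v (k + 1) * cB ^ k := by omega
        _ = cB * ((∑ k ∈ range n, v (k + 1) * cB ^ k) + 1) := by ring
        _ ≤ _ := Nat.mul_le_mul_left _ h1
    · intro k hk
      cases k with
      | zero => simp [dg, Nat.mod_eq_of_lt h0]
      | succ k =>
        rw [dg_succ, Nat.add_mul_div_left _ _ cB_pos, Nat.div_eq_of_lt h0, zero_add]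
        exact h2 k (by omega)

theorem dgZ (X n : ℕ) (g : ℕ → ℤ) (h : (X : ℤ) = ∑ k ∈ range n, g k * (cB : ℤ) ^ k)
    (h0 : ∀ k < n, 0 ≤ g k ∧ g k < cB) : X < cB ^ n ∧ ∀ k < n, (dg X k : ℤ) = g k := by
  have e : X = ∑ k ∈ range n, (g k).toNat * cB ^ k := by
    zify; rw [h]; apply sum_congr rfl; intro k hk
    rw [Int.toNat_of_nonneg (h0 k (mem_range.1 hk)).1]
  have := dg_sum n (fun k => (g k).toNat) (fun k hk => by have := h0 k hk; omega)
  rw [e]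
  refine ⟨this.1, fun k hk => ?_⟩
  rw [this.2 k hk]; have := h0 k hk; omega

theorem sum2 {M : Type*} [AddCommMonoid M] (f : ℕ → M) (R : ℕ) :
    ∑ k ∈ range (9 * R), f k = ∑ r ∈ range R, ∑ j ∈ range 9, f (9 * r + j) := by
  induction R with
  | zero => simp
  | succ R ih => rw [sum_range_succ, ← ih, Nat.mul_succ, sum_range_add]

def rp (g : ℕ → ℤ) : ℤ := ∑ j ∈ range 9, (oo + g j) * (cB : ℤ) ^ j
def rq (g : ℕ → ℤ) : ℤ := ∑ j ∈ range 9, g j * (cB : ℤ) ^ j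
def co (S r j : ℕ) : ℤ := (dg (un S) (9 * r + j) : ℤ) - oo

theorem sum_dg2 (U : ℕ) (h : U < cB ^ 171) : (U : ℤ) =
    ∑ r ∈ range 19, (∑ j ∈ range 9, (dg U (9 * r + j) : ℤ) * (cB : ℤ) ^ j) * ((cB : ℤ) ^ 9) ^ r := by
  have := sum_dg U 171
  rw [Nat.mod_eq_of_lt h] at this
  conv_lhs => rw [this]
  push_cast
  rw [show 171 = 9 * 19 from rfl, sum2]
  apply sum_congr rfl; intro r _; rw [sum_mul]; apply sum_congr rfl; intro j _; ring

theorem un_sum {S : ℕ} (h : un S < cB ^ 171) :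
    (un S : ℤ) = ∑ r ∈ range 19, rp (co S r) * ((cB : ℤ) ^ 9) ^ r := by
  rw [sum_dg2 _ h]
  apply sum_congr rfl; intro r _; congr 1
  apply sum_congr rfl; intro j _; simp [co]

theorem co_of_sum (U : ℕ) (g : ℕ → ℕ → ℤ)
    (hU : (U : ℤ) = ∑ r ∈ range 19, rp (g r) * ((cB : ℤ) ^ 9) ^ r)
    (hg : ∀ r < 19, ∀ j < 9, |g r j| < oo) :
    U < cB ^ 171 ∧ ∀ r < 19, ∀ j < 9, (dg U (9 * r + j) : ℤ) = oo + g r j := by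
  have := dgZ U 171 (fun k => oo + g (k / 9) (k % 9)) (by
    rw [hU, show 171 = 9 * 19 from rfl, sum2]
    apply sum_congr rfl; intro r _; rw [rp, sum_mul]; apply sum_congr rfl; intro j hj
    have hj := mem_range.1 hj
    rw [show (9 * r + j) / 9 = r by omega, show (9 * r + j) % 9 = j by omega]; ring) (by
    intro k hk
    have := abs_lt.1 (hg (k / 9) (by omega) (k % 9) (by omega))
    rw [cB_oo]; constructor <;> omega)
  refine ⟨this.1, fun r hr j hj => ?_⟩
  rw [this.2 (9 * r + j) (by omega)]
  rw [show (9 * r + j) / 9 = r by omega, show (9 * r + j) % 9 = j by omega]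

/-- `l` packs the linear form with coefficients `g`. -/
def Fm (l : ℕ) (g : ℕ → ℤ) (b : ℤ) : Prop := (l : ℤ) = rp g ∧ ∀ j < 9, |g j| ≤ b

theorem rp_eq (g : ℕ → ℤ) : rp g = rp 0 + rq g := by
  simp only [rp, rq, ← sum_add_distrib]; apply sum_congr rfl; intro j _; simp; ring

theorem rq_add (g g' : ℕ → ℤ) : rq (fun j => g j + g' j) = rq g + rq g' := by
  simp only [rq, ← sum_add_distrib]; apply sum_congr rfl; intro j _; ring
theorem rq_sub (g g' : ℕ → ℤ) : rq (fun j => g j - g' j) = rq g - rq g' := by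
  simp only [rq, ← sum_sub_distrib]; apply sum_congr rfl; intro j _; ring
theorem rq_mul (c : ℤ) (g : ℕ → ℤ) : rq (fun j => c * g j) = c * rq g := by
  simp only [rq, mul_sum]; apply sum_congr rfl; intro j _; ring

theorem rp_nonneg (g : ℕ → ℤ) (h : ∀ j < 9, |g j| ≤ oo) : 0 ≤ rp g := by
  apply sum_nonneg; intro j hj
  have := abs_le.1 (h j (mem_range.1 hj))
  have : (0 : ℤ) ≤ oo + g j := by omega
  positivity

theorem hb1_eq : (hb1 : ℤ) = rp 0 := by
  have : hb1 = ∑ j ∈ range 9, oo * cB ^ j := by decide +kernel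
  rw [this]; simp [rp]
theorem ones1_eq : (ones1 : ℤ) = rq 1 := by
  have : ones1 = ∑ j ∈ range 9, cB ^ j := by decide +kernel
  rw [this]; simp [rq]
theorem all1_eq : (all1 : ℤ) = ∑ r ∈ range 19, ((cB : ℤ) ^ 9) ^ r := by
  have : all1 = ∑ j ∈ range 19, (cB ^ 9) ^ j := by decide +kernel
  rw [this]; simp
theorem off_eq : (off : ℤ) = all1 * hb1 := by
  exact Nat.cast_mul all1 hb1
theorem offR_eq : (offR : ℤ) = all1 * oo := by
  exact Nat.cast_mul all1 oo
theorem offL_eq : (offL : ℤ) = offR * hb1 := by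
  exact Nat.cast_mul offR hb1
theorem offS_eq : (offS : ℤ) = oo * hb1 := by
  exact Nat.cast_mul oo hb1

theorem subZ {a b : ℕ} {z : ℤ} (h : (a : ℤ) - b = z) (hz : 0 ≤ z) : ((Nat.sub a b : ℕ) : ℤ) = z := by
  show ((a - b : ℕ) : ℤ) = z; omega

theorem dg_and (a b k : ℕ) : dg (a &&& b) k = dg a k &&& dg b k := by
  simp only [dg, cB_eq, ← pow_mul, ← Nat.shiftRight_eq_div_pow, Nat.shiftRight_and_distrib, Nat.and_mod_two_pow]

theorem dg_shift (U j k : ℕ) : dg (U >>> (48 * j)) k = dg U (j + k) := by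
  simp only [dg, cB_eq, ← pow_mul, ← Nat.shiftRight_eq_div_pow, ← Nat.shiftRight_add]
  rw [Nat.mul_add]

theorem and_cBM (a : ℕ) : a &&& cBM = a % cB := by
  show a &&& (2 ^ 48 - 1) = a % 2 ^ 48
  exact Nat.and_two_pow_sub_one_eq_mod _ _

theorem dig_eq (l j : ℕ) : dig l (48 * j) = dg l j := by
  show (l >>> (48 * j)) &&& cBM = _
  rw [and_cBM, dg, cB_eq, ← pow_mul, Nat.shiftRight_eq_div_pow]

theorem Fm.dg {l : ℕ} {g : ℕ → ℤ} {b : ℤ} (h : Fm l g b) (hb : b < oo) {j : ℕ} (hj : j < 9) :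
    (PD.dg l j : ℤ) = oo + g j ∧ l < cB ^ 9 := by
  have := dgZ l 9 (fun j => oo + g j) h.1 (by
    intro k hk
    have := abs_le.1 (h.2 k hk)
    rw [cB_oo]; constructor <;> omega)
  exact ⟨this.2 j hj, this.1⟩

theorem un_hs (X : ℕ) : un (hs X) = X := by
  show ((X <<< 64) + X % cP) >>> 64 = X
  rw [Nat.shiftLeft_eq, Nat.shiftRight_eq_div_pow, mul_comm, Nat.mul_add_div (by norm_num)]
  have : X % cP < 2 ^ 64 := lt_trans (Nat.mod_lt _ (by decide)) (by decide)
  rw [Nat.div_eq_of_lt this, add_zero]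

end PD

namespace PD
open Finset

theorem frc_eq (n : ℕ) (k : ℕ → Bool) : frc n k = k n := by cases n <;> rfl
theorem ift_eq (b t f : Bool) : ift b t f = if b = true then t else f := by cases b <;> rfl
theorem iz_eq (n : ℕ) (t f : Bool) : iz n t f = if n = 0 then t else f := by cases n <;> simp [iz]
theorem an_eq (a b : Bool) : an a b = (a && b) := by cases a <;> rfl
theorem beq_iff (a b : ℕ) : Nat.beq a b = true ↔ a = b := by simp
theorem ble_iff (a b : ℕ) : Nat.ble a b = true ↔ a ≤ b := by simp

structure WF (S ρ κ : ℕ) : Prop where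
  lt : un S < cB ^ 171
  bd : ∀ r < 19, ∀ j < 9, |co S r j| ≤ 2 ^ 18
  zr : ∀ r < 19, ρ ≤ r → ∀ j < 9, co S r j = 0
  zc : ∀ r < 19, ∀ j < 9, j < κ → co S r j = 0

theorem row_fm {S ρ κ r : ℕ} (h : WF S ρ κ) (hr : r < 19) : Fm (row S (64 + 432 * r)) (co S r) (2 ^ 18) := by
  refine ⟨?_, h.bd r hr⟩
  have e : row S (64 + 432 * r) = (un S >>> (48 * (9 * r))) % cB ^ 9 := by
    show (S >>> (64 + 432 * r)) &&& (2 ^ 432 - 1) = ((S >>> 64) >>> (48 * (9 * r))) % cB ^ 9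
    rw [Nat.and_two_pow_sub_one_eq_mod, ← Nat.shiftRight_add, cB_eq, ← pow_mul,
      show 64 + 432 * r = 64 + 48 * (9 * r) by ring]
  rw [e, sum_dg, rp]
  push_cast
  apply sum_congr rfl; intro j _
  rw [dg_shift, co]; ring

/-- Linear value of a coefficient vector. -/
def ev (g v : ℕ → ℤ) : ℤ := ∑ j ∈ range 9, g j * v j
theorem ev_add (g g' v : ℕ → ℤ) : ev (fun j => g j + g' j) v = ev g v + ev g' v := by
  simp only [ev, ← sum_add_distrib]; apply sum_congr rfl; intro j _; ring
theorem ev_sub (g g' v : ℕ → ℤ) : ev (fun j => g j - g' j) v = ev g v - ev g' v := by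
  simp only [ev, ← sum_sub_distrib]; apply sum_congr rfl; intro j _; ring
theorem ev_mul (c : ℤ) (g v : ℕ → ℤ) : ev (fun j => c * g j) v = c * ev g v := by
  simp only [ev, mul_sum]; apply sum_congr rfl; intro j _; ring

theorem fm_hb1 : Fm hb1 0 0 := ⟨hb1_eq, by simp⟩

theorem fm_gen {N : ℕ} {g : ℕ → ℤ} {b : ℤ} (hb : ∀ j < 9, |g j| ≤ b) (h : (N : ℤ) = rp 0 + rq g) : Fm N g b :=
  ⟨by rw [h, rp_eq g], hb⟩

theorem Fm.rq {l : ℕ} {g : ℕ → ℤ} {b : ℤ} (h : Fm l g b) : (l : ℤ) = hb1 + PD.rq g := by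
  rw [h.1, rp_eq, hb1_eq]

theorem fm_sub_gen {a b : ℕ} {g : ℕ → ℤ} {c : ℤ} (hc : ∀ j < 9, |g j| ≤ c) (hco : c ≤ oo)
    (h : (a : ℤ) - b = hb1 + rq g) : Fm (Nat.sub a b) g c := by
  rw [hb1_eq, ← rp_eq] at h
  exact ⟨subZ h (rp_nonneg g fun j hj => (hc j hj).trans hco), hc⟩

theorem fm_sub {l l' : ℕ} {g g' : ℕ → ℤ} {b b' : ℤ} (h : Fm l g b) (h' : Fm l' g' b') (hb : b + b' ≤ oo) :
    Fm (Nat.sub (Nat.add l hb1) l') (fun j => g j - g' j) (b + b') := by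
  refine fm_sub_gen (fun j hj => (abs_sub _ _).trans (add_le_add (h.2 j hj) (h'.2 j hj))) hb ?_
  show ((l + hb1 : ℕ) : ℤ) - l' = _
  push_cast; rw [h.rq, h'.rq, rq_sub]; ring

theorem fm_add3 {l1 l2 l3 : ℕ} {g1 g2 g3 : ℕ → ℤ} {b1 b2 b3 : ℤ} (h1 : Fm l1 g1 b1) (h2 : Fm l2 g2 b2)
    (h3 : Fm l3 g3 b3) (hb : b1 + b2 + b3 ≤ oo) :
    Fm (Nat.sub (Nat.add l1 l2) l3) (fun j => g1 j + g2 j - g3 j) (b1 + b2 + b3) := by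
  refine fm_sub_gen (fun j hj => (abs_sub _ _).trans (add_le_add ((abs_add_le _ _).trans (add_le_add (h1.2 j hj) (h2.2 j hj))) (h3.2 j hj))) hb ?_
  show ((l1 + l2 : ℕ) : ℤ) - l3 = _
  push_cast; rw [h1.rq, h2.rq, h3.rq, rq_sub (fun j => g1 j + g2 j), rq_add]; ring

theorem fm_f4 {l1 l2 l3 l4 : ℕ} {g1 g2 g3 g4 : ℕ → ℤ} {b : ℤ} (h1 : Fm l1 g1 b) (h2 : Fm l2 g2 b)
    (h3 : Fm l3 g3 b) (h4 : Fm l4 g4 b) (hb : 4 * b ≤ oo) :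
    Fm (Nat.sub (Nat.add (Nat.add l1 l2) hb1) (Nat.add l3 l4)) (fun j => (g1 j + g2 j) - (g3 j + g4 j)) (4 * b) := by
  refine fm_sub_gen (fun j hj => ?_) hb ?_
  · have := abs_le.1 (h1.2 j hj); have := abs_le.1 (h2.2 j hj)
    have := abs_le.1 (h3.2 j hj); have := abs_le.1 (h4.2 j hj)
    rw [abs_le]; constructor <;> linarith
  show ((l1 + l2 + hb1 : ℕ) : ℤ) - ((l3 + l4 : ℕ) : ℤ) = _
  push_cast
  rw [h1.rq, h2.rq, h3.rq, h4.rq, rq_sub (fun j => g1 j + g2 j) (fun j => g3 j + g4 j), rq_add, rq_add]; ring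

theorem fm_ng {l : ℕ} {g : ℕ → ℤ} {b : ℤ} (h : Fm l g b) (hb : b ≤ oo) : Fm (ng l) (fun j => - g j) b := by
  refine fm_sub_gen (fun j hj => by rw [abs_neg]; exact h.2 j hj) hb ?_
  show ((hb1 + hb1 : ℕ) : ℤ) - l = _
  push_cast; rw [h.rq]
  have : rq (fun j => - g j) = - rq g := by simp [rq]
  rw [this]; ring

theorem rq_single (m : ℕ) (hm : m < 9) (c : ℤ) : rq (fun j => if j = m then c else 0) = c * (cB : ℤ) ^ m := by
  simp only [rq, ite_mul, zero_mul, sum_ite_eq', mem_range, hm, if_true]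

theorem fm_e {l m : ℕ} {g : ℕ → ℤ} {b : ℤ} (h : Fm l g b) (hm : m < 9) :
    Fm (Nat.add l (Nat.pow 2 (48 * m))) (fun j => g j + if j = m then 1 else 0) (b + 1) := by
  refine ⟨?_, ?_⟩
  · rw [rp_eq, rq_add, rq_single m hm]
    show ((l + 2 ^ (48 * m) : ℕ) : ℤ) = _
    push_cast; rw [h.rq, hb1_eq, cB_eq]; push_cast; rw [pow_mul]; ring
  · intro j hj
    refine (abs_add_le _ _).trans (add_le_add (h.2 j hj) ?_)
    split_ifs <;> simp

theorem fm_pt {l m : ℕ} {g : ℕ → ℤ} {b : ℤ} (h : Fm l g b) (hm : m < 9) (hb : b + 1 ≤ oo) :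
    Fm (Nat.sub l (Nat.shiftLeft 1 (48 * m))) (fun j => g j - if j = m then 1 else 0) (b + 1) := by
  refine fm_sub_gen ?_ hb ?_
  · intro j hj
    refine (abs_sub _ _).trans (add_le_add (h.2 j hj) ?_)
    split_ifs <;> simp
  · rw [rq_sub, rq_single m hm, h.rq]
    show _ - ((1 <<< (48 * m) : ℕ) : ℤ) = _
    rw [Nat.shiftLeft_eq, cB_eq]; push_cast; rw [pow_mul]; ring

theorem and_oo_zero {x : ℕ} (hx : x < cB) (h : x &&& oo = 0) : x < oo := by
  by_contra hc
  rw [oo_eq] at *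
  rw [Nat.and_two_pow, Nat.testBit_of_two_pow_le_and_two_pow_add_one_gt (by omega) (by rw [cB_eq] at hx; exact hx)] at h
  simp at h

theorem pm_zero {l : ℕ} {g : ℕ → ℤ} {b : ℤ} (h : Fm l g b) (hb : b + 1 < oo) (hp : pm l = 0) :
    ∀ j < 9, g j ≤ 0 := by
  intro j hj
  have h1 : Fm (Nat.sub l ones1) (fun j => g j - (1 : ℕ → ℤ) j) (b + 1) := by
    refine fm_sub_gen ?_ hb.le ?_
    · intro j hj; exact (abs_sub _ _).trans (add_le_add (h.2 j hj) (by simp))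
    · rw [rq_sub, h.rq, ones1_eq]; ring
  have hd : dg (pm l) j = dg (Nat.sub l ones1) j &&& dg hb1 j := dg_and _ _ _
  have e2 : dg hb1 j = oo := by
    have := (fm_hb1.dg (by rw [oo_val]; norm_num) hj).1
    simpa using this
  rw [hp, e2] at hd
  have := (h1.dg hb hj).1
  have h3 := and_oo_zero (x := dg (Nat.sub l ones1) j) (Nat.mod_lt _ cB_pos) (by rw [← hd]; simp [dg])
  simp only [Pi.one_apply] at this
  omega

/-- Column extraction. -/
theorem colM_dg : ∀ k < 171, dg colM k = if k % 9 = 0 then cBM else 0 := by decide +kernel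
theorem colM_lt : colM < cB ^ 171 := by decide +kernel

theorem colx_sum {U j : ℕ} (hj : j < 9) (hU : U < cB ^ 171) : (colx U (48 * j) : ℤ) =
    ∑ r ∈ range 19, (dg U (9 * r + j) : ℤ) * ((cB : ℤ) ^ 9) ^ r := by
  have e : colx U (48 * j) = (U >>> (48 * j)) &&& colM := rfl
  rw [sum_dg2 (colx U (48 * j)) (by rw [e]; exact lt_of_le_of_lt Nat.and_le_right colM_lt)]
  apply sum_congr rfl; intro r hr; congr 1
  have hr := mem_range.1 hr
  rw [sum_eq_single 0]
  · rw [e, dg_and, colM_dg _ (by omega), if_pos (by omega), dg_shift, and_cBM, dg, dg]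
    simp [add_comm]
  · intro i hi h0
    have hi := mem_range.1 hi
    rw [e, dg_and, colM_dg _ (by omega), if_neg (by omega)]; simp
  · simp

theorem sub0_sum {S c l j : ℕ} {g : ℕ → ℤ} {b : ℤ} (hU : un S < cB ^ 171) (hl : Fm l g b) (hj : j < 9)
    (hbd : ∀ r < 19, ∀ i < 9, |c * co S r i - co S r j * g i| ≤ oo) :
    (sub0 (un S) c (colx (un S) (48 * j)) l : ℤ) =
      ∑ r ∈ range 19, rp (fun i => c * co S r i - co S r j * g i) * ((cB : ℤ) ^ 9) ^ r := by
  refine subZ ?_ ?_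
  · show ((c * un S + colx (un S) (48 * j) * hb1 + (offR * l + off) : ℕ) : ℤ)
      - ((c * off + colx (un S) (48 * j) * l + offL : ℕ) : ℤ) = _
    have key : ∀ r, rp (fun i => c * co S r i - co S r j * g i)
        = c * rp (co S r) + (dg (un S) (9 * r + j) : ℤ) * hb1 + oo * l + hb1 - c * hb1
          - (dg (un S) (9 * r + j) : ℤ) * l - oo * hb1 := by
      intro r
      rw [rp_eq, rq_sub (fun i => c * co S r i), rq_mul, rq_mul, rp_eq (co S r), hl.rq, ← hb1_eq, co]; ring
    push_cast
    rw [offL_eq, off_eq, offR_eq, un_sum hU, colx_sum hj hU, all1_eq]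
    simp only [key, mul_sum, sum_mul, ← sum_add_distrib, ← sum_sub_distrib]
    apply sum_congr rfl; intro r _; ring
  · apply sum_nonneg; intro r hr
    have := rp_nonneg _ (hbd r (mem_range.1 hr))
    positivity

theorem and_top {y : ℕ} (hy : y < cB) (h : y &&& (cB - 2 ^ 19) = oo) : oo ≤ y ∧ y < oo + 2 ^ 19 := by
  have h1 := congrArg (· >>> 19) h
  simp only [Nat.shiftRight_and_distrib] at h1
  rw [cB_eq] at *
  have e : (2 ^ 48 - 2 ^ 19) >>> 19 = 2 ^ 29 - 1 := by decide
  rw [e, Nat.and_two_pow_sub_one_eq_mod, Nat.shiftRight_eq_div_pow, oo_eq, Nat.shiftRight_eq_div_pow] at h1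
  rw [oo_eq]
  omega

theorem top_dg : ∀ k < 171, dg top k = cB - 2 ^ 19 := by decide +kernel
theorem off_dg : ∀ k < 171, dg off k = oo := by decide +kernel
theorem top1_dg : ∀ k < 9, dg top1 k = cB - 2 ^ 19 := by decide +kernel
theorem hb1_dg : ∀ k < 9, dg hb1 k = oo := by decide +kernel
theorem bet_eq : (bet : ℤ) = ∑ r ∈ range 19, rq (fun _ => 2 ^ 18) * ((cB : ℤ) ^ 9) ^ r := by
  have : bet = ∑ r ∈ range 19, (∑ j ∈ range 9, 2 ^ 18 * cB ^ j) * (cB ^ 9) ^ r := by decide +kernel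
  rw [this]; push_cast; rfl
theorem bet1_eq : (bet1 : ℤ) = rq (fun _ => 2 ^ 18) := by
  have : bet1 = ∑ j ∈ range 9, 2 ^ 18 * cB ^ j := by decide +kernel
  rw [this]; push_cast; rfl

theorem rng_ok {U : ℕ} {g : ℕ → ℕ → ℤ} (hU : (U : ℤ) = ∑ r ∈ range 19, rp (g r) * ((cB : ℤ) ^ 9) ^ r)
    (hg : ∀ r < 19, ∀ j < 9, |g r j| ≤ 2 ^ 45)
    (h : Nat.beq (Nat.land (Nat.add U bet) top) off = true) : ∀ r < 19, ∀ j < 9, |g r j| ≤ 2 ^ 18 := by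
  intro r hr j hj
  rw [beq_iff] at h
  have hs : ((U + bet : ℕ) : ℤ) = ∑ r ∈ range 19, rp (fun j => g r j + 2 ^ 18) * ((cB : ℤ) ^ 9) ^ r := by
    rw [Nat.cast_add, hU, bet_eq, ← sum_add_distrib]
    apply sum_congr rfl; intro r _; rw [rp_eq, rp_eq (fun j => g r j + 2 ^ 18), rq_add]; ring
  have := (co_of_sum _ (fun r j => g r j + 2 ^ 18) hs (by
    intro r hr j hj; have := abs_le.1 (hg r hr j hj); rw [oo_val, abs_lt]; constructor <;> linarith)).2 r hr j hj
  have h2 : dg ((U + bet) &&& top) (9 * r + j) = dg off (9 * r + j) := congrArg (fun x => dg x _) h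
  rw [dg_and, top_dg _ (by omega), off_dg _ (by omega)] at h2
  have h3 := and_top (y := dg (U + bet) (9 * r + j)) (Nat.mod_lt _ cB_pos) h2
  generalize dg (U + bet) (9 * r + j) = y at *
  rw [abs_le]; omega

theorem rng1_ok {l : ℕ} {g : ℕ → ℤ} {b : ℤ} (hl : Fm l g b) (hb : b ≤ 2 ^ 45)
    (h : Nat.beq (Nat.land (Nat.add l bet1) top1) hb1 = true) : ∀ j < 9, |g j| ≤ 2 ^ 18 := by
  intro j hj
  rw [beq_iff] at h
  have hs : Fm (l + bet1) (fun j => g j + 2 ^ 18) (2 ^ 46) := by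
    refine fm_gen ?_ ?_
    · intro j hj; have := abs_le.1 (hl.2 j hj); rw [abs_le]; constructor <;> linarith
    · push_cast; rw [hl.rq, bet1_eq, rq_add, hb1_eq]; ring
  have := (hs.dg (by rw [oo_val]; norm_num) hj).1
  have h2 : dg ((l + bet1) &&& top1) j = dg hb1 j := congrArg (fun x => dg x _) h
  rw [dg_and, top1_dg _ hj, hb1_dg _ hj] at h2
  have h3 := and_top (y := dg (l + bet1) j) (Nat.mod_lt _ cB_pos) h2
  generalize dg (l + bet1) j = y at *
  rw [abs_le]; omega

theorem psh_ex (P : ℕ) : ∃ j < 9, ∀ k, psh P k = k (48 * j) := by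
  have key : ∀ i < 23, ∃ j < 9, Nat.land (Nat.shiftRight ptab (Nat.mul 16 i)) 65535 = 48 * j := by decide +kernel
  obtain ⟨j, hj, h⟩ := key (Nat.mod (Nat.sub P (sng P)) 23) (Nat.mod_lt _ (by norm_num))
  refine ⟨j, hj, fun k => ?_⟩
  unfold psh; rw [frc_eq]
  exact congrArg k h
end PD

namespace PD
open Finset

structure Sem (S ρ κ : ℕ) (V : ℕ → ℕ) (v : ℕ → ℤ) (d : ℤ) : Prop where
  wf : WF S ρ κ
  vp : ∀ j, 0 < v j
  dp : 0 < d
  val : ∀ r < ρ, r < 19 → ev (co S r) v = d * V (64 + 432 * r)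

def Sm (S ρ κ : ℕ) (V : ℕ → ℕ) : Prop := ∃ v d, Sem S ρ κ V v d

def Rp (κ : ℕ) (v : ℕ → ℤ) (d : ℤ) (l : ℕ) (t b : ℤ) : Prop :=
  ∃ g, Fm l g b ∧ (∀ j < 9, j < κ → g j = 0) ∧ ev g v = d * t

/-- Register addresses of index below `ρ`. -/
def Rg (ρ a : ℕ) : Prop := ∃ r < ρ, r < 19 ∧ a = 64 + 432 * r

theorem Rg.mono {ρ ρ' a : ℕ} (h : Rg ρ a) (hr : ρ ≤ ρ') : Rg ρ' a := by
  obtain ⟨r, h1, h2, h3⟩ := h; exact ⟨r, by omega, h2, h3⟩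

section
variable {S ρ κ : ℕ} {V : ℕ → ℕ} {v : ℕ → ℤ} {d : ℤ}

theorem row_rp (h : Sem S ρ κ V v d) {a : ℕ} (ha : Rg ρ a) : Rp κ v d (row S a) (V a) (2 ^ 18) := by
  obtain ⟨r, hr, hr', rfl⟩ := ha
  exact ⟨co S r, row_fm h.wf hr', fun j hj hk => h.wf.zc r hr' j hj hk, h.val r hr hr'⟩

theorem rp_sub {l l' : ℕ} {t t' b b' : ℤ} (h : Rp κ v d l t b) (h' : Rp κ v d l' t' b') (hb : b + b' ≤ 2 ^ 45) :
    Rp κ v d (Nat.sub (Nat.add l hb1) l') (t - t') (b + b') := by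
  obtain ⟨g, h1, h2, h3⟩ := h; obtain ⟨g', h1', h2', h3'⟩ := h'
  refine ⟨_, fm_sub h1 h1' (by rw [oo_val]; linarith), fun j hj hk => by rw [h2 j hj hk, h2' j hj hk]; rfl, ?_⟩
  rw [ev_sub, h3, h3']; ring

theorem rp_add3 {l1 l2 l3 : ℕ} {t1 t2 t3 b1 b2 b3 : ℤ} (h1 : Rp κ v d l1 t1 b1) (h2 : Rp κ v d l2 t2 b2)
    (h3 : Rp κ v d l3 t3 b3) (hb : b1 + b2 + b3 ≤ 2 ^ 45) :
    Rp κ v d (Nat.sub (Nat.add l1 l2) l3) (t1 + t2 - t3) (b1 + b2 + b3) := by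
  obtain ⟨g1, a1, c1, e1⟩ := h1; obtain ⟨g2, a2, c2, e2⟩ := h2; obtain ⟨g3, a3, c3, e3⟩ := h3
  refine ⟨_, fm_add3 a1 a2 a3 (by rw [oo_val]; linarith), fun j hj hk => by rw [c1 j hj hk, c2 j hj hk, c3 j hj hk]; rfl, ?_⟩
  rw [ev_sub (fun j => g1 j + g2 j), ev_add, e1, e2, e3]; ring

theorem rp_ng {l : ℕ} {t b : ℤ} (h : Rp κ v d l t b) (hb : b ≤ 2 ^ 45) : Rp κ v d (ng l) (-t) b := by
  obtain ⟨g, h1, h2, h3⟩ := h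
  refine ⟨_, fm_ng h1 (by rw [oo_val]; linarith), fun j hj hk => by rw [h2 j hj hk]; rfl, ?_⟩
  have : ev (fun j => - g j) v = - ev g v := by simp [ev]
  rw [this, h3]; ring

theorem df_rp (h : Sem S ρ κ V v d) {p q : ℕ} (hp : Rg ρ p) (hq : Rg ρ q) :
    Rp κ v d (df S p q) ((V p : ℤ) - V q) (2 ^ 19) := by
  have := rp_sub (row_rp h hp) (row_rp h hq) (by norm_num)
  norm_num at this ⊢; exact this

theorem f4_rp (h : Sem S ρ κ V v d) {p q r s : ℕ} (hp : Rg ρ p) (hq : Rg ρ q) (hr : Rg ρ r) (hs : Rg ρ s) :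
    Rp κ v d (f4 S p q r s) ((V p : ℤ) + V q - (V r + V s)) (2 ^ 20) := by
  obtain ⟨g1, a1, c1, e1⟩ := row_rp h hp; obtain ⟨g2, a2, c2, e2⟩ := row_rp h hq
  obtain ⟨g3, a3, c3, e3⟩ := row_rp h hr; obtain ⟨g4, a4, c4, e4⟩ := row_rp h hs
  have := fm_f4 a1 a2 a3 a4 (by rw [oo_val]; norm_num)
  refine ⟨_, by norm_num at this ⊢; exact this, fun j hj hk => by rw [c1 j hj hk, c2 j hj hk, c3 j hj hk, c4 j hj hk]; rfl, ?_⟩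
  rw [ev_sub (fun j => g1 j + g2 j) (fun j => g3 j + g4 j), ev_add, ev_add, e1, e2, e3, e4]; ring

theorem ev_nonpos {g : ℕ → ℤ} (hv : ∀ j, 0 < v j) (hg : ∀ j < 9, g j ≤ 0) : ev g v ≤ 0 :=
  sum_nonpos fun j hj => mul_nonpos_of_nonpos_of_nonneg (hg j (mem_range.1 hj)) (hv j).le

theorem ev_nonpos_eq {g : ℕ → ℤ} (hv : ∀ j, 0 < v j) (hg : ∀ j < 9, g j ≤ 0) (h0 : ev g v = 0) : ∀ j < 9, g j = 0 := by
  intro j hj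
  have := (sum_eq_zero_iff_of_nonpos (fun j hj => mul_nonpos_of_nonpos_of_nonneg (hg j (mem_range.1 hj)) (hv j).le)).1 h0 j (mem_range.2 hj)
  rcases mul_eq_zero.1 this with h | h
  · exact h
  · have := hv j; omega

theorem rp_congr {g g' : ℕ → ℤ} (h : ∀ j < 9, g j = g' j) : rp g = rp g' := by
  unfold rp; apply sum_congr rfl; intro j hj; rw [h j (mem_range.1 hj)]

theorem fm_zero {l : ℕ} {g : ℕ → ℤ} {b : ℤ} (h : Fm l g b) (h0 : ∀ j < 9, g j = 0) : l = hb1 := by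
  have : (l : ℤ) = hb1 := by rw [h.1, hb1_eq]; exact rp_congr h0
  exact_mod_cast this

/-- positivity mask zero is impossible for a positive form -/
theorem pm_pos (hv : ∀ j, 0 < v j) (hd : 0 < d) {l : ℕ} {t b : ℤ} (h : Rp κ v d l t b) (hb : b ≤ 2 ^ 45) (ht : 0 < t) :
    pm l ≠ 0 := by
  intro hp
  obtain ⟨g, h1, h2, h3⟩ := h
  have := ev_nonpos hv (pm_zero h1 (by rw [oo_val]; linarith) hp)
  rw [h3] at this
  have := mul_pos hd ht
  omega

theorem pm_ne (hv : ∀ j, 0 < v j) {l : ℕ} {b : ℤ} (h : Rp κ v d l 0 b) (hb : b ≤ 2 ^ 45) (hl : l ≠ hb1) :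
    pm l ≠ 0 := by
  intro hp
  obtain ⟨g, h1, h2, h3⟩ := h
  exact hl (fm_zero h1 (ev_nonpos_eq hv (pm_zero h1 (by rw [oo_val]; linarith) hp) (by rw [h3]; ring)))

theorem ng_ne {l : ℕ} {t b : ℤ} (h : Rp κ v d l t b) (hb : b ≤ 2 ^ 45) (hl : l ≠ hb1) : ng l ≠ hb1 := by
  intro hp
  obtain ⟨g, h1, h2, h3⟩ := h
  have h4 := fm_ng h1 (b := b) (by rw [oo_val]; linarith)
  apply hl
  apply fm_zero h1
  intro j hj
  have h5 := (h4.dg (by rw [oo_val]; linarith) hj).1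
  have h6 := (fm_hb1.dg (by rw [oo_val]; norm_num) hj).1
  rw [hp, h6] at h5
  simp at h5; exact h5

theorem zchk_ok (hv : ∀ j, 0 < v j) {l : ℕ} {b : ℤ} (h : Rp κ v d l 0 b) (hb : b ≤ 2 ^ 45) {k : Bool}
    (hk : zchk l k = true) : k = true := by
  unfold zchk at hk
  simp only [ift_eq, iz_eq, beq_iff] at hk
  by_cases hl : l = hb1
  · simpa [hl] using hk
  · rw [if_neg hl, if_neg (pm_ne hv h hb hl), if_neg (pm_ne hv (by simpa using rp_ng h hb) hb (ng_ne h hb hl))] at hk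
    exact hk

/-- Generic substitution step. -/
theorem sub_sem (h : Sem S ρ κ V v d) {c l j : ℕ} {g : ℕ → ℤ} {b : ℤ} (hl : Fm l g b) (hj : j < 9)
    (hb : b ≤ 2 ^ 21) (hc : c ≤ 2 ^ 21) (hz : ∀ j < 9, j < κ → g j = 0) {k₀ : Bool}
    {v' : ℕ → ℤ} {d' : ℤ} (hv' : ∀ j, 0 < v' j) (hd' : 0 < d')
    (hval : ∀ r < ρ, r < 19 → ev (fun i => c * co S r i - co S r j * g i) v' = d' * V (64 + 432 * r)) :
    ∃ S', Sm S' ρ κ V ∧ ∀ k : ℕ → Bool, rng (sub0 (un S) c (colx (un S) (48 * j)) l) k = true → k S' = true := by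
  have hbd : ∀ r < 19, ∀ i < 9, |c * co S r i - co S r j * g i| ≤ 2 ^ 45 := by
    intro r hr i hi
    have e1 : |(c : ℤ) * co S r i| ≤ 2 ^ 21 * 2 ^ 18 := by
      rw [abs_mul]
      exact mul_le_mul (by rw [Nat.abs_cast]; exact_mod_cast hc) (h.wf.bd r hr i hi) (abs_nonneg _) (by norm_num)
    have e2 : |co S r j * g i| ≤ 2 ^ 18 * 2 ^ 21 := by
      rw [abs_mul]
      exact mul_le_mul (h.wf.bd r hr j hj) ((hl.2 i hi).trans hb) (abs_nonneg _) (by norm_num)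
    have := abs_sub (c * co S r i) (co S r j * g i)
    linarith
  have hU := sub0_sum (c := c) h.wf.lt hl hj (fun r hr i hi => (hbd r hr i hi).trans (by rw [oo_val]; norm_num))
  generalize sub0 (un S) c (colx (un S) (48 * j)) l = U at *
  by_cases hr : Nat.beq (Nat.land (Nat.add U bet) top) off = true
  · have h1 := rng_ok hU hbd hr
    have h2 := co_of_sum U _ hU (fun r hr i hi => lt_of_le_of_lt (hbd r hr i hi) (by rw [oo_val]; norm_num))
    have h3 : ∀ r < 19, ∀ i < 9, co (hs U) r i = c * co S r i - co S r j * g i := by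
      intro r hr i hi
      rw [co, un_hs, h2.2 r hr i hi]; ring
    refine ⟨hs U, ⟨v', d', ⟨by rw [un_hs]; exact h2.1, ?_, ?_, ?_⟩, hv', hd', ?_⟩, ?_⟩
    · intro r hr i hi; rw [h3 r hr i hi]; exact h1 r hr i hi
    · intro r hr hρ i hi; rw [h3 r hr i hi, h.wf.zr r hr hρ i hi, h.wf.zr r hr hρ j hj]; ring
    · intro r hr i hi hk; rw [h3 r hr i hi, h.wf.zc r hr i hi hk, hz i hi hk]; ring
    · intro r hr hr'
      rw [← hval r hr hr']
      apply sum_congr rfl; intro i hi; rw [h3 r hr' i (mem_range.1 hi)]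
    · intro k hk; unfold rng at hk; rw [hr, ift_eq, if_pos rfl, frc_eq] at hk; exact hk
  · refine ⟨S, ⟨v, d, h⟩, fun k hk => ?_⟩
    unfold rng at hk; rw [ift_eq, if_neg hr] at hk; exact absurd hk (by simp)

theorem zpiv_ok (h : Sem S ρ κ V v d) {l P : ℕ} {b : ℤ} (hl : Rp κ v d l 0 b) (hb : b ≤ 2 ^ 20) :
    ∃ S', Sm S' ρ κ V ∧ ∀ k : ℕ → Bool, zpiv S l P k = true → k S' = true := by
  obtain ⟨j, hj, hp⟩ := psh_ex P
  obtain ⟨g, h1, h2, h3⟩ := hl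
  have hd := (h1.dg (by rw [oo_val]; linarith) hj).1
  rw [← dig_eq] at hd
  have hgj := abs_le.1 (h1.2 j hj)
  by_cases hc : dig l (48 * j) ≤ oo
  · refine ⟨S, ⟨v, d, h⟩, fun k hk => ?_⟩
    unfold zpiv at hk
    rw [hp] at hk
    unfold zsub at hk
    rw [ift_eq, if_pos ((ble_iff _ _).2 hc)] at hk; exact absurd hk (by simp)
  · have hcc : ((Nat.sub (dig l (48 * j)) oo : ℕ) : ℤ) = g j := subZ (by rw [hd]; ring) (by omega)
    obtain ⟨S', hS', hk'⟩ := sub_sem h (c := Nat.sub (dig l (48 * j)) oo) (k₀ := true) h1 hj (by linarith)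
      (by zify; rw [hcc]; linarith) h2 (v' := v) (d' := g j * d) h.vp (mul_pos (by omega) h.dp) (by
        intro r hr hr'
        rw [ev_sub (fun i => _ * co S r i), ev_mul, ev_mul, h3, h.val r hr hr', hcc]; ring)
    refine ⟨S', hS', fun k hk => hk' k ?_⟩
    unfold zpiv at hk
    rw [hp] at hk
    unfold zsub at hk
    rw [ift_eq, if_neg (by rw [ble_iff]; exact hc)] at hk; exact hk

theorem zeroL_ok (h : Sem S ρ κ V v d) {l : ℕ} {b : ℤ} (hl : Rp κ v d l 0 b) (hb : b ≤ 2 ^ 20) :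
    ∃ S', Sm S' ρ κ V ∧ ∀ k : ℕ → Bool, zeroL S l k = true → k S' = true := by
  have hb' : b ≤ 2 ^ 45 := by linarith
  have hn : Rp κ v d (ng l) 0 b := by simpa using rp_ng hl hb'
  unfold zeroL zero2
  simp only [ift_eq, iz_eq, beq_iff]
  by_cases e : l = hb1
  · simp only [e, if_true]; exact ⟨S, ⟨v, d, h⟩, fun k hk => hk⟩
  simp only [e, if_false, pm_ne h.vp hl hb' e, pm_ne h.vp hn hb' (ng_ne hl hb' e)]
  split_ifs
  · exact zpiv_ok h hl hb
  · exact zpiv_ok h hn hb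
  · exact zpiv_ok h hl hb

theorem psub_ok (h : Sem S ρ κ V v d) {l j : ℕ} {t b : ℤ} (hj : j < 9) (hl : Rp κ v d l t b) (hb : b ≤ 2 ^ 20) (ht : 0 < t) :
    ∃ S', Sm S' ρ κ V ∧ ∀ k : ℕ → Bool, psub S l (48 * j) k = true → k S' = true := by
  unfold psub
  simp only [ift_eq, beq_iff]
  by_cases e : dig l (48 * j) = Nat.succ oo
  swap
  · simp only [e, if_false]; exact ⟨S, ⟨v, d, h⟩, fun k hk => hk⟩
  simp only [e, if_true]
  obtain ⟨g, h1, h2, h3⟩ := hl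
  have hd := (h1.dg (by rw [oo_val]; linarith) hj).1
  rw [← dig_eq, e] at hd
  have hgj : g j = 1 := by push_cast at hd; omega
  have hjk : ¬ j < κ := fun hk => by rw [h2 j hj hk] at hgj; omega
  have hev : 0 < ev g v := by rw [h3]; exact mul_pos h.dp ht
  refine sub_sem h (c := 1) (k₀ := true) (fm_pt h1 hj (by rw [oo_val]; linarith)) hj (by linarith) (by norm_num) ?_
    (v' := fun i => if i = j then ev g v else v i) (d' := d) ?_ h.dp ?_
  · intro i hi hk
    rw [h2 i hi hk, if_neg (by rintro rfl; exact hjk hk)]; rfl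
  · intro i; split_ifs
    · exact hev
    · exact h.vp i
  · intro r hr hr'
    rw [← h.val r hr hr']
    have hm := mem_range.2 hj
    have e1 : ∀ f : ℕ → ℤ, ∑ i ∈ range 9, f i = f j + ∑ i ∈ (range 9).erase j, f i := fun f => (add_sum_erase _ f hm).symm
    have e2 : ev g v = v j + ∑ i ∈ (range 9).erase j, g i * v i := by
      rw [ev, e1, hgj, one_mul]
    have e4 : ev (co S r) v = co S r j * v j + ∑ i ∈ (range 9).erase j, co S r i * v i := e1 _
    have e3 : ∑ i ∈ (range 9).erase j, ((((1 : ℕ) : ℤ) * co S r i - co S r j * (g i - if i = j then 1 else 0)) * (if i = j then ev g v else v i))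
        = ∑ i ∈ (range 9).erase j, co S r i * v i - co S r j * ∑ i ∈ (range 9).erase j, g i * v i := by
      rw [mul_sum, ← sum_sub_distrib]
      apply sum_congr rfl; intro i hi
      have := (mem_erase.1 hi).1
      simp only [this, if_false]; push_cast; ring
    refine (e1 _).trans ?_
    rw [e3, e4]
    simp only [if_true, e2, hgj]; push_cast; ring

theorem posB_ok (h : Sem S ρ κ V v d) {l : ℕ} {t b : ℤ} (hl : Rp κ v d l t b) (hb : b ≤ 2 ^ 20) (ht : 0 < t) (f : Bool) :
    ∃ S', Sm S' ρ κ V ∧ ∀ k : ℕ → Bool, posB f S l k = true → k S' = true := by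
  have hp := pm_pos h.vp h.dp hl (by linarith) ht
  have triv : ∃ S', Sm S' ρ κ V ∧ ∀ k : ℕ → Bool, k S = true → k S' = true := ⟨S, ⟨v, d, h⟩, fun k hk => hk⟩
  cases f
  · show ∃ S', Sm S' ρ κ V ∧ ∀ k : ℕ → Bool, iz (pm l) true (k S) = true → k S' = true
    simp only [iz_eq, hp, if_false]; exact triv
  · show ∃ S', Sm S' ρ κ V ∧ ∀ k : ℕ → Bool, pos2 S l (pm l) k = true → k S' = true
    unfold pos2
    obtain ⟨j, hj, hpj⟩ := psh_ex (pm l)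
    simp only [iz_eq, ift_eq, hp, if_false, hpj]
    split_ifs
    · exact triv
    · exact psub_ok h hj hl hb ht
    · exact triv

theorem addr_ok (h : Sem S ρ κ V v d) {l a : ℕ} {t : ℕ} {b : ℤ} (hl : Rp κ v d l t b) (hb : b ≤ 2 ^ 45)
    (hρ : ρ < 19) (ha : a = 64 + 432 * ρ) {k₀ : ℕ → Bool} (hk₀ : addr S l a k₀ = true) :
    ∃ S', Sem S' (ρ + 1) κ (Function.update V a t) v d ∧ ∀ k : ℕ → Bool, addr S l a k = true → k S' = true := by
  subst ha
  obtain ⟨g, h1, h2, h3⟩ := hl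
  have hr : Nat.beq (Nat.land (Nat.add l bet1) top1) hb1 = true := by
    by_contra hk
    unfold addr at hk₀; rw [ift_eq, if_neg hk] at hk₀; simp at hk₀
  have hbd := rng1_ok h1 hb hr
  set U := un (Nat.sub (Nat.add S (Nat.shiftLeft l (64 + 432 * ρ))) (Nat.shiftLeft hb1 (64 + 432 * ρ))) with hUdef
  let G : ℕ → ℕ → ℤ := fun r j => if r = ρ then g j else co S r j
  have hU : (U : ℤ) = ∑ r ∈ range 19, rp (G r) * ((cB : ℤ) ^ 9) ^ r := by
    have e1 : ∑ r ∈ range 19, rp (G r) * ((cB : ℤ) ^ 9) ^ r = un S + (l - hb1) * ((cB : ℤ) ^ 9) ^ ρ := by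
      rw [un_sum h.wf.lt, ← add_sum_erase _ _ (mem_range.2 hρ), ← add_sum_erase _ (fun r => rp (co S r) * ((cB : ℤ) ^ 9) ^ r) (mem_range.2 hρ)]
      have e2 : ∑ r ∈ (range 19).erase ρ, rp (G r) * ((cB : ℤ) ^ 9) ^ r = ∑ r ∈ (range 19).erase ρ, rp (co S r) * ((cB : ℤ) ^ 9) ^ r := by
        apply sum_congr rfl; intro r hr
        have := (mem_erase.1 hr).1
        simp [G, this]
      have e3 : rp (G ρ) = l := by rw [h1.1]; apply rp_congr; intro j _; simp [G]
      have e4 : rp (co S ρ) = hb1 := by rw [hb1_eq]; apply rp_congr; intro j hj; rw [h.wf.zr ρ hρ le_rfl j hj]; rfl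
      rw [e2, e3, e4]; ring
    rw [e1]
    have e5 : 0 ≤ (un S : ℤ) + (l - hb1) * ((cB : ℤ) ^ 9) ^ ρ := by
      rw [← e1]; apply sum_nonneg; intro r hr
      have hr := mem_range.1 hr
      have : 0 ≤ rp (G r) := by
        apply rp_nonneg; intro j hj; simp only [G]; split_ifs
        · exact (hbd j hj).trans (by rw [oo_val]; norm_num)
        · exact (h.wf.bd r hr j hj).trans (by rw [oo_val]; norm_num)
      positivity
    have e6 : 2 ^ (64 + 432 * ρ) = 2 ^ 64 * (cB ^ 9) ^ ρ := by rw [cB_eq, ← pow_mul, ← pow_mul, ← pow_add]; congr 1; ring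
    have e7 : Nat.sub (Nat.add S (Nat.shiftLeft l (64 + 432 * ρ))) (Nat.shiftLeft hb1 (64 + 432 * ρ))
        = 2 ^ 64 * (un S + l * (cB ^ 9) ^ ρ - hb1 * (cB ^ 9) ^ ρ) + S % 2 ^ 64 := by
      show (S + l <<< (64 + 432 * ρ)) - hb1 <<< (64 + 432 * ρ) = _
      rw [Nat.shiftLeft_eq, Nat.shiftLeft_eq, e6]
      have e8 : S = 2 ^ 64 * un S + S % 2 ^ 64 := by
        show S = 2 ^ 64 * (S >>> 64) + _
        rw [Nat.shiftRight_eq_div_pow]; exact (Nat.div_add_mod _ _).symm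
      have e9 : hb1 * (cB ^ 9) ^ ρ ≤ un S + l * (cB ^ 9) ^ ρ := by zify; nlinarith
      have ea : l * (2 ^ 64 * (cB ^ 9) ^ ρ) = 2 ^ 64 * (l * (cB ^ 9) ^ ρ) := by ring
      have eb : hb1 * (2 ^ 64 * (cB ^ 9) ^ ρ) = 2 ^ 64 * (hb1 * (cB ^ 9) ^ ρ) := by ring
      rw [ea, eb]
      generalize l * (cB ^ 9) ^ ρ = p at *
      generalize hb1 * (cB ^ 9) ^ ρ = q at *
      generalize un S = u at *
      omega
    have e10 : U = un S + l * (cB ^ 9) ^ ρ - hb1 * (cB ^ 9) ^ ρ := by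
      rw [hUdef, e7]
      show (_ >>> 64) = _
      rw [Nat.shiftRight_eq_div_pow, Nat.mul_add_div (by norm_num), Nat.div_eq_of_lt (Nat.mod_lt _ (by norm_num)), add_zero]
    rw [e10]
    have := subZ (a := un S + l * (cB ^ 9) ^ ρ) (b := hb1 * (cB ^ 9) ^ ρ) (z := (un S : ℤ) + (l - hb1) * ((cB : ℤ) ^ 9) ^ ρ) (by push_cast; ring) e5
    exact this
  have hG : ∀ r < 19, ∀ j < 9, |G r j| ≤ 2 ^ 18 := by
    intro r hr j hj; simp only [G]; split_ifs
    · exact hbd j hj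
    · exact h.wf.bd r hr j hj
  have h4 := co_of_sum U G hU (fun r hr j hj => lt_of_le_of_lt (hG r hr j hj) (by rw [oo_val]; norm_num))
  have h5 : ∀ r < 19, ∀ i < 9, co (hs U) r i = G r i := by
    intro r hr i hi
    rw [co, un_hs, h4.2 r hr i hi]; ring
  refine ⟨hs U, ⟨⟨by rw [un_hs]; exact h4.1, ?_, ?_, ?_⟩, h.vp, h.dp, ?_⟩, ?_⟩
  · intro r hr j hj; rw [h5 r hr j hj]; exact hG r hr j hj
  · intro r hr hρ j hj; rw [h5 r hr j hj]; simp only [G]; rw [if_neg (by omega)]; exact h.wf.zr r hr (by omega) j hj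
  · intro r hr j hj hk; rw [h5 r hr j hj]; simp only [G]; split_ifs
    · exact h2 j hj hk
    · exact h.wf.zc r hr j hj hk
  · intro r hr hr'
    have e : ev (co (hs U) r) v = ev (G r) v := by
      apply sum_congr rfl; intro j hj; rw [h5 r hr' j (mem_range.1 hj)]
    rw [e]
    by_cases hc : r = ρ
    · subst hc
      have : ev (G r) v = ev g v := by apply sum_congr rfl; intro j hj; simp [G]
      rw [this, h3]; simp
    · have : ev (G r) v = ev (co S r) v := by apply sum_congr rfl; intro j hj; simp [G, hc]
      rw [this, h.val r (by omega) hr', Function.update_of_ne (by omega)]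
  · intro k hk
    unfold addr at hk
    rw [ift_eq, if_pos hr, frc_eq] at hk; exact hk

/-- Skipping a register. -/
theorem Sm.skip (h : Sm S ρ κ V) {a : ℕ} (ha : a = 64 + 432 * ρ) : Sm S (ρ + 1) κ (Function.update V a 0) := by
  subst ha
  obtain ⟨v, d, h⟩ := h
  refine ⟨v, d, ⟨h.wf.lt, h.wf.bd, fun r hr h1 => h.wf.zr r hr (by omega), h.wf.zc⟩, h.vp, h.dp, ?_⟩
  intro r hr hr'
  by_cases hc : r = ρ
  · subst hc
    rw [Function.update_self]
    simp only [ev]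
    rw [sum_eq_zero]
    · simp
    · intro j hj; rw [h.wf.zr r hr' le_rfl j (mem_range.1 hj)]; ring
  · rw [Function.update_of_ne (by omega)]; exact h.val r (by omega) hr'

theorem Sm.weak {κ' : ℕ} (h : Sm S ρ κ V) (hk : κ' ≤ κ) : Sm S ρ κ' V := by
  obtain ⟨v, d, h⟩ := h
  exact ⟨v, d, ⟨h.wf.lt, h.wf.bd, h.wf.zr, fun r hr j hj hk => h.wf.zc r hr j hj (by omega)⟩, h.vp, h.dp, h.val⟩

/-- A fresh variable. -/
theorem Sem.fresh {m : ℕ} (h : Sem S ρ (m + 1) V v d) (hm : m < 9) {s : ℕ} (hs : 0 < s) :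
    ∃ v', Sem S ρ m V v' d ∧ v' m = d * s := by
  refine ⟨fun j => if j = m then d * s else v j, ⟨⟨h.wf.lt, h.wf.bd, h.wf.zr, fun r hr j hj hk => h.wf.zc r hr j hj (by omega)⟩, ?_, h.dp, ?_⟩, by simp⟩
  · intro j; split_ifs
    · have := h.dp; positivity
    · exact h.vp j
  · intro r hr hr'
    rw [← h.val r hr hr']
    apply sum_congr rfl; intro j hj
    show _ * (if j = m then d * (s : ℤ) else v j) = _
    split_ifs with e
    · subst e; rw [h.wf.zc r hr' j hm (by omega)]; ring
    · rfl

theorem rp_e {m : ℕ} (hm : m < 9) {l : ℕ} {t b : ℤ} {s : ℕ} (hl : Rp m v d l t b) (hv : v m = d * s) :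
    Rp m v d (Nat.add l (Nat.pow 2 (48 * m))) (t + s) (b + 1) := by
  obtain ⟨g, h1, h2, h3⟩ := hl
  refine ⟨_, fm_e h1 hm, fun j hj hk => by rw [h2 j hj hk, if_neg (by omega)]; rfl, ?_⟩
  rw [ev_add, h3]
  have : ev (fun j => if j = m then 1 else 0) v = v m := by
    simp [ev, hm]
  rw [this, hv]; ring

theorem chk2_ok (hv : ∀ j, 0 < v j) {l m P : ℕ} {b b' : ℤ} (hl : Rp κ v d l 0 b) (hb : b ≤ 2 ^ 20)
    (hm : Rp κ v d m 0 b') (hb' : b' ≤ 2 ^ 20) {k : Bool} (hk : chk2 l m P k = true) : k = true := by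
  unfold chk2 at hk
  obtain ⟨j, hj, hp⟩ := psh_ex P
  rw [iz_eq, hp, ift_eq] at hk
  by_cases e : P = 0
  · rw [if_pos e] at hk; exact hk
  rw [if_neg e] at hk
  by_cases hc : dig l (48 * j) ≤ oo
  · rw [if_pos ((ble_iff _ _).2 hc)] at hk; exact absurd hk (by simp)
  rw [if_neg (by rw [ble_iff]; exact hc)] at hk
  obtain ⟨g, h1, h2, h3⟩ := hl
  obtain ⟨g', h1', h2', h3'⟩ := hm
  have hd := (h1.dg (by rw [oo_val]; linarith) hj).1
  have hd' := (h1'.dg (by rw [oo_val]; linarith) hj).1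
  rw [← dig_eq] at hd hd'
  have hcc : ((Nat.sub (dig l (48 * j)) oo : ℕ) : ℤ) = g j := subZ (by rw [hd]; ring) (by omega)
  refine zchk_ok (κ := κ) (d := d) hv (b := 2 ^ 41) ⟨fun i => g j * g' i - g' j * g i, ?_, ?_, ?_⟩ (by norm_num) hk
  · refine fm_sub_gen ?_ (by rw [oo_val]; norm_num) ?_
    · intro i hi
      have e1 : |g j * g' i| ≤ 2 ^ 20 * 2 ^ 20 := by
        rw [abs_mul]; exact mul_le_mul ((h1.2 j hj).trans hb) ((h1'.2 i hi).trans hb') (abs_nonneg _) (by norm_num)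
      have e2 : |g' j * g i| ≤ 2 ^ 20 * 2 ^ 20 := by
        rw [abs_mul]; exact mul_le_mul ((h1'.2 j hj).trans hb') ((h1.2 i hi).trans hb) (abs_nonneg _) (by norm_num)
      have := abs_sub (g j * g' i) (g' j * g i)
      linarith
    · rw [rq_sub (fun i => g j * g' i), rq_mul, rq_mul]
      show ((Nat.sub (dig l (48 * j)) oo * m + dig m (48 * j) * hb1 + (oo * l + hb1) : ℕ) : ℤ)
        - ((Nat.sub (dig l (48 * j)) oo * hb1 + dig m (48 * j) * l + offS : ℕ) : ℤ) = _
      push_cast; rw [hcc, offS_eq, hd', h1.rq, h1'.rq]; ring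
  · intro i hi hk; show g j * g' i - g' j * g i = 0; rw [h2 i hi hk, h2' i hi hk]; ring
  · rw [ev_sub (fun i => g j * g' i), ev_mul, ev_mul, h3, h3']; ring

end
end PD

namespace PD
open Finset

def dec (V : ℕ → ℕ) : SL → List (ℕ × ℕ × ℕ)
  | SL.nil => []
  | SL.cons x y z t => (V x, V y, V z - V y) :: dec V t

def SqI (ρ : ℕ) (V : ℕ → ℕ) : SL → Prop
  | SL.nil => True
  | SL.cons x y z t => Rg ρ x ∧ Rg ρ y ∧ Rg ρ z ∧ V y < V z ∧ SqI ρ V t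

def gcdL : List (ℕ × ℕ × ℕ) → ℕ
  | [] => 0
  | q :: t => Nat.gcd q.2.2 (gcdL t)

def ky (q : ℕ × ℕ × ℕ) : ℕ := 100 * q.1 + (10 * q.2.1 + q.2.2)

theorem leaf_vals {S ρ κ : ℕ} {V : ℕ → ℕ} {v : ℕ → ℤ} {d : ℤ} (h : Sem S ρ κ V v d) {j : ℕ} (hj : j < 9)
    (he : un S + offR <<< (48 * j) = off + (colx (un S) (48 * j)) <<< (48 * j)) :
    ∀ r < ρ, r < 19 → co S r j * v j = d * V (64 + 432 * r) := by
  let G : ℕ → ℕ → ℤ := fun r i => if i = j then co S r j else 0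
  have hG : ∀ r < 19, ∀ i < 9, |G r i| < oo := by
    intro r hr i hi; simp only [G]; split_ifs
    · exact lt_of_le_of_lt (h.wf.bd r hr j hj) (by rw [oo_val]; norm_num)
    · rw [oo_val]; norm_num
  have hU : (un S : ℤ) = ∑ r ∈ range 19, rp (G r) * ((cB : ℤ) ^ 9) ^ r := by
    have he' := congrArg (fun x : ℕ => (x : ℤ)) he
    simp only [Nat.shiftLeft_eq, pow_mul, ← cB_eq] at he'
    push_cast at he'
    rw [colx_sum hj h.wf.lt, off_eq, offR_eq, all1_eq] at he'
    have e : ∀ r, rp (G r) = hb1 + (dg (un S) (9 * r + j) - oo) * (cB : ℤ) ^ j := by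
      intro r; rw [rp_eq, rq_single j hj, hb1_eq, co]
    simp only [e]
    have e2 : ∑ r ∈ range 19, (hb1 + ((dg (un S) (9 * r + j) : ℤ) - oo) * (cB : ℤ) ^ j) * ((cB : ℤ) ^ 9) ^ r
      = (∑ r ∈ range 19, ((cB : ℤ) ^ 9) ^ r) * hb1 + (∑ r ∈ range 19, (dg (un S) (9 * r + j) : ℤ) * ((cB : ℤ) ^ 9) ^ r) * (cB : ℤ) ^ j
        - (∑ r ∈ range 19, ((cB : ℤ) ^ 9) ^ r) * oo * (cB : ℤ) ^ j := by
      simp only [mul_sum, sum_mul, ← sum_add_distrib, ← sum_sub_distrib]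
      apply sum_congr rfl; intro r _; ring
    rw [e2]; linarith
  have h2 := (co_of_sum _ G hU hG).2
  intro r hr hr'
  rw [← h.val r hr hr', ev, sum_eq_single j]
  · intro i hi hne
    have := h2 r hr' i (mem_range.1 hi)
    have e : co S r i = 0 := by rw [co, this]; simp [G, hne]
    rw [e]; ring
  · intro hn; exact absurd (mem_range.2 hj) hn

theorem dig_X {S j r : ℕ} (hr : r < 19) :
    (dig (Nat.shiftLeft (colx (un S) (48 * j)) c64) (64 + 432 * r) : ℤ) = oo + co S r j := by
  have e : dig (Nat.shiftLeft (colx (un S) (48 * j)) c64) (64 + 432 * r) = dg (colx (un S) (48 * j)) (9 * r) := by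
    show (((colx (un S) (48 * j)) <<< 64) >>> (64 + 432 * r)) &&& cBM = _
    rw [Nat.shiftRight_add, Nat.shiftLeft_shiftRight, show 432 * r = 48 * (9 * r) by ring]
    exact dig_eq _ _
  have e2 : colx (un S) (48 * j) = (un S >>> (48 * j)) &&& colM := rfl
  rw [e, e2, dg_and, colM_dg _ (by omega), if_pos (by omega), dg_shift, and_cBM, co, dg, Nat.mod_mod, add_comm j]
  unfold dg; ring

section
variable {ρ : ℕ} {V : ℕ → ℕ} {X : ℕ} {w d : ℤ}

theorem allp_ok (hw : 0 < w) (hd : 0 < d) (hX : ∀ a, Rg ρ a → ((dig X a : ℤ) - oo) * w = d * V a) :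
    ∀ sq, SqI ρ V sq → allp X sq = true
  | SL.nil, _ => rfl
  | SL.cons x y z t, ⟨hx, hy, hz, hlt, ht⟩ => by
    show ift (Nat.ble (dig X z) (dig X y)) false (allp X t) = true
    rw [allp_ok hw hd hX t ht, ift_eq, if_neg]
    rw [ble_iff]
    intro hle
    have h1 := hX y hy
    have h2 := hX z hz
    have : (dig X z : ℤ) ≤ dig X y := by exact_mod_cast hle
    have h3 : (V y : ℤ) < V z := by exact_mod_cast hlt
    nlinarith

theorem gcdS_ok (hw : 0 < w) (hd : 0 < d) (hX : ∀ a, Rg ρ a → ((dig X a : ℤ) - oo) * w = d * V a) :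
    ∀ sq, SqI ρ V sq → (gcdS X sq : ℤ) * w = d * gcdL (dec V sq)
  | SL.nil, _ => by simp [gcdS, dec, gcdL]
  | SL.cons x y z t, ⟨hx, hy, hz, hlt, ht⟩ => by
    show ((Nat.gcd (Nat.sub (dig X z) (dig X y)) (gcdS X t) : ℕ) : ℤ) * w = d * ((Nat.gcd (V z - V y) (gcdL (dec V t)) : ℕ) : ℤ)
    have ih := gcdS_ok hw hd hX t ht
    have h1 := hX y hy
    have h2 := hX z hz
    have h3 : (V y : ℤ) < V z := by exact_mod_cast hlt
    have e1 : ((Nat.sub (dig X z) (dig X y) : ℕ) : ℤ) = (dig X z : ℤ) - dig X y := by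
      apply subZ rfl; by_contra hc; push Not at hc; nlinarith
    have e2 : ((V z - V y : ℕ) : ℤ) = (V z : ℤ) - V y := by omega
    have e3 : ((Nat.sub (dig X z) (dig X y) : ℕ) : ℤ) * w = d * ((V z - V y : ℕ) : ℤ) := by
      rw [e1, e2]; linarith
    generalize Nat.sub (dig X z) (dig X y) = A at *
    generalize gcdS X t = B at *
    generalize V z - V y = A' at *
    generalize gcdL (dec V t) = B' at *
    lift w to ℕ using hw.le
    lift d to ℕ using hd.le
    have e3 : A * w = d * A' := by exact_mod_cast e3
    have ih : B * w = d * B' := by exact_mod_cast ih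
    have : Nat.gcd A B * w = d * Nat.gcd A' B' := by
      rw [← Nat.gcd_mul_right, ← Nat.gcd_mul_left, e3, ih]
    exact_mod_cast this

theorem codeS_ok {g : ℕ} (hg : 0 < g) (hX : ∀ a, Rg ρ a → (dig X a : ℤ) = oo + g * V a) :
    ∀ sq, SqI ρ V sq → codeS X g sq = ((dec V sq).map (fun q => 2 ^ ky q)).sum
  | SL.nil, _ => by simp [codeS, dec]
  | SL.cons x y z t, ⟨hx, hy, hz, hlt, ht⟩ => by
    show 1 <<< (100 * ((dig X x - oo) / g) + (10 * ((dig X y - oo) / g) + (dig X z - dig X y) / g)) + codeS X g t = _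
    rw [codeS_ok hg hX t ht]
    have e1 : dig X x = oo + g * V x := by exact_mod_cast hX x hx
    have e2 : dig X y = oo + g * V y := by exact_mod_cast hX y hy
    have e3 : dig X z = oo + g * V z := by exact_mod_cast hX z hz
    rw [e1, e2, e3, Nat.add_sub_cancel_left, Nat.add_sub_cancel_left, Nat.add_sub_add_left, ← Nat.mul_sub,
      Nat.mul_div_cancel_left _ hg, Nat.mul_div_cancel_left _ hg, Nat.mul_div_cancel_left _ hg, Nat.shiftLeft_eq]
    simp [dec, ky]
end

theorem leaf_ok {S ρ κ : ℕ} {V : ℕ → ℕ} (h : Sm S ρ κ V) {sq : SL} (hsq : SqI ρ V sq)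
    (hn : Rg ρ cN) (hg : gcdL (dec V sq) = 1) (hl : leaf sq S = true) :
    V cN ≤ 9 ∧ isT ((dec V sq).map (fun q => 2 ^ ky q)).sum = true := by
  obtain ⟨v, d, h⟩ := h
  unfold leaf at hl
  obtain ⟨j, hj, hp⟩ := psh_ex (pm (row S cN))
  rw [hp, frc_eq] at hl
  unfold leaf2 at hl
  have e0 : un (Nat.shiftLeft (colx (un S) (48 * j)) c64) = colx (un S) (48 * j) := by
    show ((colx (un S) (48 * j)) <<< 64) >>> 64 = _
    rw [Nat.shiftLeft_shiftRight]
  rw [ift_eq, e0] at hl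
  split_ifs at hl with he
  rw [beq_iff] at he
  have hv := leaf_vals h hj he
  set X := Nat.shiftLeft (colx (un S) (48 * j)) c64 with hXd
  have hX : ∀ a, Rg ρ a → ((dig X a : ℤ) - oo) * v j = d * V a := by
    rintro a ⟨r, hr, hr', rfl⟩
    rw [hXd, dig_X hr', ← hv r hr hr']; ring
  rw [allp_ok (h.vp j) h.dp hX sq hsq, ift_eq, if_pos rfl, frc_eq, an_eq, frc_eq] at hl
  have hG := gcdS_ok (h.vp j) h.dp hX sq hsq
  rw [hg] at hG
  generalize gcdS X sq = g at *
  have hX' : ∀ a, Rg ρ a → (dig X a : ℤ) = oo + g * V a := by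
    intro a ha
    have h1 := hX a ha
    have : ((dig X a : ℤ) - oo) * v j = (g * V a) * v j := by rw [h1]; push_cast at hG; linear_combination (- (V a : ℤ)) * hG
    have := mul_right_cancel₀ (h.vp j).ne' this
    omega
  have hgp : 0 < g := by
    rcases Nat.eq_zero_or_pos g with h0 | h0
    · have := h.dp; rw [h0] at hG; push_cast at hG; linarith
    · exact h0
  rw [codeS_ok hgp hX' sq hsq, Bool.and_eq_true, ble_iff] at hl
  refine ⟨?_, hl.2⟩
  have e3 : dig X cN = oo + g * V cN := by exact_mod_cast hX' cN hn
  have := hl.1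
  rw [e3] at this
  change (oo + g * V cN - oo) / g ≤ 9 at this
  rwa [Nat.add_sub_cancel_left, Nat.mul_div_cancel_left _ hgp] at this
end PD

namespace PD
open Finset

def Cell (q : ℕ × ℕ × ℕ) (c y : ℕ) : Prop := q.1 ≤ c ∧ c < q.1 + q.2.2 ∧ q.2.1 ≤ y ∧ y < q.2.1 + q.2.2

structure Dis (n : ℕ) (D : Finset (ℕ × ℕ × ℕ)) : Prop where
  pos : ∀ q ∈ D, 0 < q.2.2
  ins : ∀ q ∈ D, q.1 + q.2.2 ≤ n ∧ q.2.1 + q.2.2 ≤ n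
  cov : ∀ c < n, ∀ y < n, ∃ q ∈ D, Cell q c y
  uni : ∀ q ∈ D, ∀ q' ∈ D, ∀ c y, Cell q c y → Cell q' c y → q = q'

structure Pt (n : ℕ) (D P : Finset (ℕ × ℕ × ℕ)) (H : ℕ → ℕ) : Prop where
  sub : P ⊆ D
  inn : ∀ q ∈ P, ∀ c, q.1 ≤ c → c < q.1 + q.2.2 → q.2.1 + q.2.2 ≤ H c
  out : ∀ q ∈ D, q ∉ P → ∀ c, q.1 ≤ c → c < q.1 + q.2.2 → H c ≤ q.2.1
  le : ∀ c < n, H c ≤ n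

section
variable {n : ℕ} {D P : Finset (ℕ × ℕ × ℕ)} {H : ℕ → ℕ}

/-- The square just above the skyline in column `c`. -/
theorem above (hD : Dis n D) (hP : Pt n D P H) {c : ℕ} (hc : c < n) (hH : H c < n) :
    ∃ q ∈ D, q ∉ P ∧ q.1 ≤ c ∧ c < q.1 + q.2.2 ∧ q.2.1 = H c := by
  obtain ⟨q, hq, h1, h2, h3, h4⟩ := hD.cov c hc (H c) hH
  have hnp : q ∉ P := fun hp => by have := hP.inn q hp c h1 h2; omega
  exact ⟨q, hq, hnp, h1, h2, le_antisymm h3 (hP.out q hq hnp c h1 h2)⟩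

theorem place (hD : Dis n D) (hP : Pt n D P H) {x xr h : ℕ} (hx : x < xr) (hr : xr ≤ n) (hh : h < n)
    (hc : ∀ c, x ≤ c → c < xr → H c = h) (hl : x = 0 ∨ h < H (x - 1)) (hrr : xr = n ∨ h < H xr) :
    ∃ s, 0 < s ∧ s ≤ xr - x ∧ h + s ≤ n ∧ (x, h, s) ∈ D ∧ (x, h, s) ∉ P ∧
      Pt n D (insert (x, h, s) P) (fun c => if x ≤ c ∧ c < x + s then h + s else H c) := by
  have e0 := hc x le_rfl hx
  obtain ⟨⟨qx, qy, s⟩, hq, hnp, h1, h2, h3⟩ := above hD hP (c := x) (by omega) (by omega)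
  simp only at h1 h2 h3
  rw [e0] at h3
  subst h3
  have hxx : qx = x := by
    by_contra hne
    have := hP.out _ hq hnp (x - 1) (by simp only; omega) (by simp only; omega)
    simp only at this; omega
  subst hxx
  have hi := hD.ins _ hq
  simp only at hi
  have hs : s ≤ xr - qx := by
    by_contra hne
    have := hP.out _ hq hnp xr (by simp only; omega) (by simp only; omega)
    simp only at this; omega
  refine ⟨s, hD.pos _ hq, hs, hi.2, hq, hnp, ⟨?_, ?_, ?_, ?_⟩⟩
  · intro q hqq; rcases mem_insert.1 hqq with rfl | hqq
    · exact hq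
    · exact hP.sub hqq
  · intro q hqq c c1 c2
    rcases mem_insert.1 hqq with rfl | hqq
    · simp only at c1 c2 ⊢; rw [if_pos ⟨c1, c2⟩]
    · have := hP.inn q hqq c c1 c2
      split_ifs with hcc
      · have := hc c hcc.1 (by omega); omega
      · exact this
  · intro q hqD hqq c c1 c2
    rw [mem_insert, not_or] at hqq
    have := hP.out q hqD hqq.2 c c1 c2
    split_ifs with hcc
    · by_contra hlt
      have e1 := hc c hcc.1 (by omega)
      exact hqq.1 (hD.uni q hqD _ hq c q.2.1 ⟨c1, c2, le_rfl, by have := hD.pos q hqD; omega⟩ ⟨hcc.1, hcc.2, by simp only; omega, by simp only; omega⟩)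
    · exact this
  · intro c hcn; split_ifs
    · exact hi.2
    · exact hP.le c hcn

theorem last (hD : Dis n D) (hP : Pt n D P H) (hc : (D \ P).card = 1) :
    ∃ p y s, (p, y, s) ∈ D ∧ (p, y, s) ∉ P ∧ D = insert (p, y, s) P ∧ 0 < s ∧ y + s = n ∧ p + s ≤ n ∧
      ∀ c < n, (H c = n ∧ (c < p ∨ p + s ≤ c)) ∨ (H c = y ∧ p ≤ c ∧ c < p + s) := by
  obtain ⟨⟨p, y, s⟩, hq⟩ := card_eq_one.1 hc
  have hm : ∀ q, q ∈ D → q ∉ P → q = (p, y, s) := fun q h1 h2 => by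
    have : q ∈ D \ P := mem_sdiff.2 ⟨h1, h2⟩
    rw [hq] at this; simpa using this
  have h0 : (p, y, s) ∈ D \ P := by rw [hq]; simp
  obtain ⟨h1, h2⟩ := mem_sdiff.1 h0
  have hpos := hD.pos _ h1
  have hins := hD.ins _ h1
  simp only at hpos hins
  refine ⟨p, y, s, h1, h2, ?_, hpos, ?_, hins.1, ?_⟩
  · ext q; constructor
    · intro h; by_cases hp : q ∈ P
      · exact mem_insert_of_mem hp
      · rw [hm q h hp]; exact mem_insert_self _ _
    · intro h; rcases mem_insert.1 h with rfl | h
      · exact h1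
      · exact hP.sub h
  · obtain ⟨q, hqD, c1, c2, c3, c4⟩ := hD.cov p (by omega) (n - 1) (by omega)
    have hH := hP.out _ h1 h2 p le_rfl (by simp only; omega)
    simp only at hH
    have hqp : q ∉ P := fun hp => by have := hP.inn q hp p c1 c2; omega
    have := hm q hqD hqp
    subst this; simp only at c4; omega
  · intro c hcn
    by_cases hH : H c < n
    · obtain ⟨q, a1, a2, a3, a4, a5⟩ := above hD hP hcn hH
      have := hm q a1 a2; subst this
      simp only at a3 a4 a5; right; omega
    · left
      have := hP.le c hcn
      refine ⟨by omega, ?_⟩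
      by_contra hne
      have := hP.out _ h1 h2 c (by simp only; omega) (by simp only; omega)
      simp only at this; omega

theorem desc_card (hD : Dis n D) (hP : Pt n D P H) (l : List ℕ) (hl : l.Nodup)
    (h : ∀ p ∈ l, p < n ∧ H p < n ∧ (p = 0 ∨ H p < H (p - 1))) : l.length ≤ (D \ P).card := by
  rw [← List.toFinset_card_of_nodup hl]
  refine (card_le_card ?_).trans (card_image_le (s := D \ P) (f := fun q => q.1))
  intro p hp
  obtain ⟨h1, h2, h3⟩ := h p (List.mem_toFinset.1 hp)
  obtain ⟨q, a1, a2, a3, a4, a5⟩ := above hD hP h1 h2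
  refine mem_image.2 ⟨q, mem_sdiff.2 ⟨a1, a2⟩, ?_⟩
  by_contra hne
  have := hP.out q a1 a2 (p - 1) (by omega) (by omega)
  omega

theorem asc_card (hD : Dis n D) (hP : Pt n D P H) (l : List ℕ) (hl : l.Nodup)
    (h : ∀ p ∈ l, 0 < p ∧ p ≤ n ∧ H (p - 1) < n ∧ (p = n ∨ H (p - 1) < H p)) : l.length ≤ (D \ P).card := by
  rw [← List.toFinset_card_of_nodup hl]
  refine (card_le_card ?_).trans (card_image_le (s := D \ P) (f := fun q => q.1 + q.2.2))
  intro p hp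
  obtain ⟨h0, h1, h2, h3⟩ := h p (List.mem_toFinset.1 hp)
  obtain ⟨q, a1, a2, a3, a4, a5⟩ := above hD hP (c := p - 1) (by omega) h2
  refine mem_image.2 ⟨q, mem_sdiff.2 ⟨a1, a2⟩, ?_⟩
  by_contra hne
  have := (hD.ins q a1).1
  have := hP.out q a1 a2 p (by omega) (by omega)
  omega
end

def LI (ρ : ℕ) (V H : ℕ → ℕ) (n : ℕ) : LL → ℕ → ℕ → Prop
  | LL.nil, h, x => Rg ρ h ∧ Rg ρ x ∧ V h = n ∧ V x = 0
  | LL.cons hl xl L, h, x => Rg ρ h ∧ Rg ρ x ∧ V h < V hl ∧ V xl ≤ V x ∧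
      (∀ c, V xl ≤ c → c < V x → H c = V hl) ∧ (V xl < V x ∨ L = LL.nil) ∧ LI ρ V H n L hl xl

def RI (ρ : ℕ) (V H : ℕ → ℕ) (n : ℕ) : RL → ℕ → ℕ → Prop
  | RL.nil, h, x => Rg ρ h ∧ Rg ρ x ∧ V h = n ∧ V x ≤ n ∧ ∀ c, V x ≤ c → c < n → H c = n
  | RL.up h' x' t, h, x => Rg ρ h ∧ Rg ρ x ∧ V h < V h' ∧ V x < V x' ∧
      (∀ c, V x ≤ c → c < V x' → H c = V h) ∧ RI ρ V H n t h' x'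
  | RL.dn h' x' t, h, x => Rg ρ h ∧ Rg ρ x ∧ V h' < V h ∧ V x < V x' ∧
      (∀ c, V x ≤ c → c < V x' → H c = V h) ∧ RI ρ V H n t h' x'

def lenL : LL → ℕ
  | LL.nil => 0
  | LL.cons _ _ t => lenL t + 1
def dns : RL → ℕ
  | RL.nil => 0
  | RL.dn _ _ t => dns t + 1
  | RL.up _ _ t => dns t
def ups : RL → ℕ
  | RL.nil => 0
  | RL.dn _ _ t => ups t
  | RL.up _ _ t => ups t + 1

section
variable {ρ n : ℕ} {V H : ℕ → ℕ}

theorem LI.rh : ∀ {L h x}, LI ρ V H n L h x → Rg ρ h ∧ Rg ρ x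
  | LL.nil, _, _, h => ⟨h.1, h.2.1⟩
  | LL.cons .., _, _, h => ⟨h.1, h.2.1⟩
theorem RI.rh : ∀ {R h x}, RI ρ V H n R h x → Rg ρ h ∧ Rg ρ x
  | RL.nil, _, _, h => ⟨h.1, h.2.1⟩
  | RL.up .., _, _, h => ⟨h.1, h.2.1⟩
  | RL.dn .., _, _, h => ⟨h.1, h.2.1⟩

theorem LI.le : ∀ {L h x}, LI ρ V H n L h x → V h ≤ n
  | LL.nil, _, _, h => h.2.2.1.le
  | LL.cons .., _, _, ⟨_, _, a, _, _, _, b⟩ => (a.trans_le (LI.le b)).le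

theorem LI.ltn {L h x} (hL : LI ρ V H n L h x) (hh : V h < n) : ∃ hl xl L', L = LL.cons hl xl L' := by
  cases L with
  | nil => have := hL.2.2.1; omega
  | cons a b c => exact ⟨a, b, c, rfl⟩

theorem LI.edge {L h x} (hL : LI ρ V H n L h x) : V x = 0 ∨ V h < H (V x - 1) := by
  cases L with
  | nil => exact Or.inl hL.2.2.2
  | cons a b c =>
    obtain ⟨_, _, h1, h2, h3, h4, h5⟩ := hL
    by_cases hx : V x = 0
    · exact Or.inl hx
    · rcases h4 with h4 | rfl
      · right; rw [h3 _ (by omega) (by omega)]; exact h1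
      · have := h5.2.2.2
        right; rw [h3 _ (by omega) (by omega)]; exact h1

theorem RI.xle : ∀ {R h x}, RI ρ V H n R h x → V x ≤ n
  | RL.nil, _, _, h => h.2.2.2.1
  | RL.up .., _, _, ⟨_, _, _, a, _, b⟩ => (a.trans_le (RI.xle b)).le
  | RL.dn .., _, _, ⟨_, _, _, a, _, b⟩ => (a.trans_le (RI.xle b)).le

theorem RI.edge {R h x} (hR : RI ρ V H n R h x) : V x = n ∨ (V x < n ∧ H (V x) = V h) := by
  cases R with
  | nil =>
    obtain ⟨_, _, h1, h2, h3⟩ := hR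
    by_cases hx : V x = n
    · exact Or.inl hx
    · exact Or.inr ⟨by omega, by rw [h3 _ le_rfl (by omega), h1]⟩
  | up a b c =>
    obtain ⟨_, _, h1, h2, h3, h4⟩ := hR
    have := h4.xle
    exact Or.inr ⟨by omega, h3 _ le_rfl h2⟩
  | dn a b c =>
    obtain ⟨_, _, h1, h2, h3, h4⟩ := hR
    have := h4.xle
    exact Or.inr ⟨by omega, h3 _ le_rfl h2⟩

theorem RI.hle {R h x} (hR : RI ρ V H n R h x) (hH : ∀ c < n, H c ≤ n) : V h ≤ n := by
  cases R with
  | nil => exact hR.2.2.1.le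
  | up a b c =>
    obtain ⟨_, _, h1, h2, h3, h4⟩ := hR
    have := h4.xle
    rw [← h3 _ le_rfl h2]; exact hH _ (by omega)
  | dn a b c =>
    obtain ⟨_, _, h1, h2, h3, h4⟩ := hR
    have := h4.xle
    rw [← h3 _ le_rfl h2]; exact hH _ (by omega)

theorem LI.congr {ρ' : ℕ} {V' H' : ℕ → ℕ} (hρ : ρ ≤ ρ') (hV : ∀ a, Rg ρ a → V' a = V a) :
    ∀ {L h x}, LI ρ V H n L h x → (∀ c < V x, H' c = H c) → LI ρ' V' H' n L h x
  | LL.nil, h, x, ⟨h1, h2, h3, h4⟩, hH => ⟨h1.mono hρ, h2.mono hρ, by rw [hV h h1, h3], by rw [hV x h2, h4]⟩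
  | LL.cons hl xl L, h, x, ⟨h1, h2, h3, h4, h5, h6, h7⟩, hH => by
    obtain ⟨e1, e2⟩ := h7.rh
    refine ⟨h1.mono hρ, h2.mono hρ, ?_, ?_, ?_, ?_, LI.congr hρ hV h7 fun c hc => hH c (by omega)⟩ <;>
      simp only [hV _ h1, hV _ h2, hV _ e1, hV _ e2]
    · exact h3
    · exact h4
    · intro c c1 c2; rw [hH c c2]; exact h5 c c1 c2
    · exact h6

theorem RI.congr {ρ' : ℕ} {V' H' : ℕ → ℕ} (hρ : ρ ≤ ρ') (hV : ∀ a, Rg ρ a → V' a = V a) :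
    ∀ {R h x}, RI ρ V H n R h x → (∀ c, V x ≤ c → H' c = H c) → RI ρ' V' H' n R h x
  | RL.nil, h, x, ⟨h1, h2, h3, h4, h5⟩, hH => by
    refine ⟨h1.mono hρ, h2.mono hρ, by rw [hV h h1, h3], by rw [hV x h2]; exact h4, ?_⟩
    rw [hV x h2]; intro c c1 c2; rw [hH c c1]; exact h5 c c1 c2
  | RL.up h' x' t, h, x, ⟨h1, h2, h3, h4, h5, h6⟩, hH => by
    obtain ⟨e1, e2⟩ := h6.rh
    refine ⟨h1.mono hρ, h2.mono hρ, ?_, ?_, ?_, RI.congr hρ hV h6 fun c hc => hH c (by omega)⟩ <;>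
      simp only [hV _ h1, hV _ h2, hV _ e1, hV _ e2]
    · exact h3
    · exact h4
    · intro c c1 c2; rw [hH c c1]; exact h5 c c1 c2
  | RL.dn h' x' t, h, x, ⟨h1, h2, h3, h4, h5, h6⟩, hH => by
    obtain ⟨e1, e2⟩ := h6.rh
    refine ⟨h1.mono hρ, h2.mono hρ, ?_, ?_, ?_, RI.congr hρ hV h6 fun c hc => hH c (by omega)⟩ <;>
      simp only [hV _ h1, hV _ h2, hV _ e1, hV _ e2]
    · exact h3
    · exact h4
    · intro c c1 c2; rw [hH c c1]; exact h5 c c1 c2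

theorem RI.ext {R h x h0 x0} (hR : RI ρ V H n R h x) (g1 : Rg ρ h0) (g2 : Rg ρ x0) (he : V h0 = V h) (hx : V x0 ≤ V x)
    (hc : ∀ c, V x0 ≤ c → c < V x → H c = V h0) : RI ρ V H n R h0 x0 := by
  cases R with
  | nil =>
    obtain ⟨_, _, h1, h2, h3⟩ := hR
    refine ⟨g1, g2, by omega, by omega, fun c c1 c2 => ?_⟩
    by_cases hcx : c < V x
    · rw [hc c c1 hcx]; omega
    · exact h3 c (by omega) c2
  | up a b t =>
    obtain ⟨_, _, h1, h2, h3, h4⟩ := hR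
    refine ⟨g1, g2, by omega, by omega, fun c c1 c2 => ?_, h4⟩
    by_cases hcx : c < V x
    · rw [hc c c1 hcx]
    · rw [h3 c (by omega) c2]; omega
  | dn a b t =>
    obtain ⟨_, _, h1, h2, h3, h4⟩ := hR
    refine ⟨g1, g2, by omega, by omega, fun c c1 c2 => ?_, h4⟩
    by_cases hcx : c < V x
    · rw [hc c c1 hcx]
    · rw [h3 c (by omega) c2]; omega

/-- Descents on the left. -/
theorem LI.desc : ∀ {L h x}, LI ρ V H n L h x → (L ≠ LL.nil → V x < n ∧ H (V x) = V h) →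
    ∃ l : List ℕ, l.length = lenL L ∧ l.Nodup ∧ ∀ p ∈ l, p ≤ V x ∧ p < n ∧ H p < n ∧ (p = 0 ∨ H p < H (p - 1))
  | LL.nil, h, x, _, _ => ⟨[], rfl, by simp, by simp⟩
  | LL.cons hl xl L, h, x, hL, hx => by
    obtain ⟨x1, x2⟩ := hx (by simp)
    have hed := hL.edge
    obtain ⟨h1, h2, h3, h4, h5, h6, h7⟩ := hL
    obtain ⟨l, l1, l2, l3⟩ := LI.desc h7 (by
      intro hne
      rcases h6 with h6 | h6
      · exact ⟨by omega, h5 _ le_rfl h6⟩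
      · exact absurd h6 hne)
    have hlt : V h < n := lt_of_lt_of_le h3 h7.le
    have hnew : V x ≤ V x ∧ V x < n ∧ H (V x) < n ∧ (V x = 0 ∨ H (V x) < H (V x - 1)) :=
      ⟨le_rfl, x1, by omega, by rw [x2]; exact hed⟩
    rcases h6 with h6 | h6
    · refine ⟨V x :: l, by simp [l1, lenL], List.nodup_cons.2 ⟨fun hm => by have := (l3 _ hm).1; omega, l2⟩, ?_⟩
      intro p hp
      rcases List.mem_cons.1 hp with rfl | hp
      · exact hnew
      · obtain ⟨a, b⟩ := l3 p hp; exact ⟨by omega, b⟩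
    · subst h6
      refine ⟨[V x], by simp [lenL], by simp, ?_⟩
      intro p hp; rw [List.mem_singleton.1 hp]; exact hnew

theorem RI.desc (hH : ∀ c < n, H c ≤ n) : ∀ {R h x}, RI ρ V H n R h x →
    ∃ l : List ℕ, l.length = dns R ∧ l.Nodup ∧ ∀ p ∈ l, V x < p ∧ p < n ∧ H p < n ∧ (p = 0 ∨ H p < H (p - 1))
  | RL.nil, h, x, _ => ⟨[], rfl, by simp, by simp⟩
  | RL.up h' x' t, h, x, ⟨h1, h2, h3, h4, h5, h6⟩ => by
    obtain ⟨l, l1, l2, l3⟩ := RI.desc hH h6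
    exact ⟨l, l1, l2, fun p hp => by obtain ⟨a, b⟩ := l3 p hp; exact ⟨by omega, b⟩⟩
  | RL.dn h' x' t, h, x, hR => by
    have hle := hR.hle hH
    obtain ⟨h1, h2, h3, h4, h5, h6⟩ := hR
    obtain ⟨l, l1, l2, l3⟩ := RI.desc hH h6
    refine ⟨V x' :: l, by simp [l1, dns], List.nodup_cons.2 ⟨fun hm => by have := (l3 _ hm).1; omega, l2⟩, ?_⟩
    intro p hp
    rcases List.mem_cons.1 hp with rfl | hp
    · have e1 : V x' < n ∧ H (V x') = V h' := by
        rcases h6.edge with e | e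
        · cases t with
          | nil => have := h6.2.2.1; omega
          | up a b c => have := h6.2.2.2.1; have := h6.2.2.2.2.2.xle; omega
          | dn a b c => have := h6.2.2.2.1; have := h6.2.2.2.2.2.xle; omega
        · exact e
      refine ⟨h4, e1.1, by omega, Or.inr ?_⟩
      rw [e1.2, h5 _ (by omega) (by omega)]; exact h3
    · obtain ⟨a, b⟩ := l3 p hp; exact ⟨by omega, b⟩

theorem RI.asc (hH : ∀ c < n, H c ≤ n) : ∀ {R h x}, RI ρ V H n R h x →
    ∃ l : List ℕ, l.length = ups R ∧ l.Nodup ∧ ∀ p ∈ l, V x < p ∧ 0 < p ∧ p ≤ n ∧ H (p - 1) < n ∧ (p = n ∨ H (p - 1) < H p)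
  | RL.nil, h, x, _ => ⟨[], rfl, by simp, by simp⟩
  | RL.dn h' x' t, h, x, ⟨h1, h2, h3, h4, h5, h6⟩ => by
    obtain ⟨l, l1, l2, l3⟩ := RI.asc hH h6
    exact ⟨l, l1, l2, fun p hp => by obtain ⟨a, b⟩ := l3 p hp; exact ⟨by omega, b⟩⟩
  | RL.up h' x' t, h, x, ⟨h1, h2, h3, h4, h5, h6⟩ => by
    obtain ⟨l, l1, l2, l3⟩ := RI.asc hH h6
    refine ⟨V x' :: l, by simp [l1, ups], List.nodup_cons.2 ⟨fun hm => by have := (l3 _ hm).1; omega, l2⟩, ?_⟩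
    intro p hp
    rcases List.mem_cons.1 hp with rfl | hp
    · have e2 := h5 (V x' - 1) (by omega) (by omega)
      have e3 := h6.hle hH
      refine ⟨h4, by omega, h6.xle, by omega, ?_⟩
      rcases h6.edge with e | e
      · exact Or.inl e
      · right; omega
    · obtain ⟨a, b⟩ := l3 p hp; exact ⟨by omega, b⟩

end

theorem counts {ρ n : ℕ} {V H : ℕ → ℕ} {D P : Finset (ℕ × ℕ × ℕ)} (hD : Dis n D) (hP : Pt n D P H) {L R h x}
    (hL : LI ρ V H n L h x) (hR : RI ρ V H n R h x) :
    lenL L + dns R ≤ (D \ P).card ∧ ups R ≤ (D \ P).card := by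
  obtain ⟨l, l1, l2, l3⟩ := hL.desc (by
    intro hne
    rcases hR.edge with e | e
    · exfalso
      have hlt : V h < n := by
        cases L with
        | nil => exact absurd rfl hne
        | cons a b c => exact lt_of_lt_of_le hL.2.2.1 hL.2.2.2.2.2.2.le
      cases R with
      | nil => have := hR.2.2.1; omega
      | up a b c => have := hR.2.2.2.1; have := hR.2.2.2.2.2.xle; omega
      | dn a b c => have := hR.2.2.2.1; have := hR.2.2.2.2.2.xle; omega
    · exact e)
  obtain ⟨r, r1, r2, r3⟩ := hR.desc hP.le
  obtain ⟨u, u1, u2, u3⟩ := hR.asc hP.le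
  constructor
  · rw [← l1, ← r1, ← List.length_append]
    refine desc_card hD hP _ (List.nodup_append.2 ⟨l2, r2, fun a ha b hb hab => ?_⟩) ?_
    · have := (l3 a ha).1; have := (r3 b hb).1; omega
    · intro p hp
      rcases List.mem_append.1 hp with hp | hp
      · exact (l3 p hp).2
      · exact (r3 p hp).2
  · rw [← u1]
    exact asc_card hD hP _ u2 fun p hp => (u3 p hp).2
end PD

namespace PD
open Finset

section
variable {S ρ κ : ℕ} {V : ℕ → ℕ}

theorem cmp_lt (h : Sm S ρ κ V) {p q : ℕ} (hp : Rg ρ p) (hq : Rg ρ q) (hlt : V p < V q) {cl : Bool} (hc : cl = true) (f ce cg : Bool) :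
    ∃ S', Sm S' ρ κ V ∧ ∀ kl ke kg, cmpS f S p q cl ce cg kl ke kg = true → kl S' = true := by
  obtain ⟨v, d, h⟩ := h
  obtain ⟨S', h1, h2⟩ := posB_ok h (df_rp h hq hp) (by norm_num) (by omega) f
  refine ⟨S', h1, fun kl ke kg hk => h2 kl ?_⟩
  unfold cmpS at hk
  rw [an_eq, Bool.and_eq_true, ift_eq, if_pos hc] at hk
  exact hk.1

theorem cmp_eq (h : Sm S ρ κ V) {p q : ℕ} (hp : Rg ρ p) (hq : Rg ρ q) (hlt : V p = V q) {ce : Bool} (hc : ce = true) (f cl cg : Bool) :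
    ∃ S', Sm S' ρ κ V ∧ ∀ kl ke kg, cmpS f S p q cl ce cg kl ke kg = true → ke S' = true := by
  obtain ⟨v, d, h⟩ := h
  obtain ⟨S', h1, h2⟩ := zeroL_ok h (l := df S q p) (by have := df_rp h hq hp; rwa [hlt, sub_self] at this) (by norm_num)
  refine ⟨S', h1, fun kl ke kg hk => h2 ke ?_⟩
  unfold cmpS at hk
  rw [an_eq, an_eq, Bool.and_eq_true, Bool.and_eq_true, ift_eq, ift_eq _ (zeroL _ _ _), if_pos hc] at hk
  exact hk.2.1

theorem cmp_gt (h : Sm S ρ κ V) {p q : ℕ} (hp : Rg ρ p) (hq : Rg ρ q) (hlt : V q < V p) {cg : Bool} (hc : cg = true) (f cl ce : Bool) :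
    ∃ S', Sm S' ρ κ V ∧ ∀ kl ke kg, cmpS f S p q cl ce cg kl ke kg = true → kg S' = true := by
  obtain ⟨v, d, h⟩ := h
  obtain ⟨S', h1, h2⟩ := posB_ok h (df_rp h hp hq) (by norm_num) (by omega) f
  refine ⟨S', h1, fun kl ke kg hk => h2 kg ?_⟩
  unfold cmpS at hk
  rw [an_eq, an_eq, Bool.and_eq_true, Bool.and_eq_true, ift_eq cg, if_pos hc] at hk
  exact hk.2.2
end

theorem g1_ok {a : ℕ} (h : 1 ≤ a) : g1 a = true := (ble_iff _ _).2 h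
theorem ble2 {a : ℕ} (h : 2 ≤ a) : Nat.ble 2 a = true := (ble_iff _ _).2 h
theorem nR_ok {R : RL} (h : R ≠ RL.nil) (b : Bool) : nR R b = b := by cases R <;> first | exact absurd rfl h | rfl
theorem nL_ok {L : LL} (h : L ≠ LL.nil) (b : Bool) : nL L b = b := by cases L <;> first | exact absurd rfl h | rfl
theorem p1_eq (a : ℕ) : p1 a = a - 1 := rfl

structure Bs (ρ : ℕ) (V : ℕ → ℕ) (n : ℕ) (D : Finset (ℕ × ℕ × ℕ)) (rem : ℕ) (sq : SL) (P : Finset (ℕ × ℕ × ℕ)) (H : ℕ → ℕ) : Prop where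
  pt : Pt n D P H
  card : (D \ P).card = rem
  sqI : SqI ρ V sq
  sqP : (dec V sq).toFinset = P
  sqN : (dec V sq).Nodup
  n : V cN = n
  r : 2 ≤ ρ

def Concl (n : ℕ) (D : Finset (ℕ × ℕ × ℕ)) : Prop := n ≤ 9 ∧ isT (∑ q ∈ D, 2 ^ ky q) = true

def Snd (gs : ℕ → Go) (ρ κ rem : ℕ) : Prop :=
  ∀ S V n D P H sq L h x hr xr R a b, Dis n D → D.gcd (fun q => q.2.2) = 1 → Sm S ρ κ V → Bs ρ V n D rem sq P H →
    LI ρ V H n L h x → RI ρ V H n (RL.up hr xr R) h x → a + (lenL L + dns R) = rem → b + (ups R + 1) = rem →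
    (∀ i < 12, gs i S a b sq L h x hr xr R = true) → Concl n D

theorem norm_ok {gs : ℕ → Go} {ρ κ rem : ℕ} (hs : Snd gs ρ κ rem) {S V n D P H sq a b}
    (hD : Dis n D) (hg : D.gcd (fun q => q.2.2) = 1) (hS : Sm S ρ κ V) (hB : Bs ρ V n D rem sq P H) (R : RL) :
    ∀ L h x, R ≠ RL.nil → LI ρ V H n L h x → RI ρ V H n R h x → a + (lenL L + dns R) = rem → b + ups R = rem →
    (∀ i < 12, nF (gs i) a b sq L h x R S = true) → Concl n D := by
  induction R with
  | nil => intro L h x hne; exact absurd rfl hne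
  | up hr xr R _ =>
    intro L h x _ hL hR ha hb hk
    exact hs S V n D P H sq L h x hr xr R a b hD hg hS hB hL hR ha hb hk
  | dn hr xr R ih =>
    intro L h x _ hL hR ha hb hk
    obtain ⟨h1, h2, h3, h4, h5, h6⟩ := hR
    have := hL.le
    refine ih (LL.cons h x L) hr xr ?_ ⟨h6.rh.1, h6.rh.2, h3, h4.le, h5, Or.inl h4, hL⟩ h6 ?_ hb hk
    · rintro rfl; have := h6.2.2.1; omega
    · simp only [lenL, dns] at ha ⊢; omega

theorem SqI.congr {ρ ρ' : ℕ} {V V' : ℕ → ℕ} (hρ : ρ ≤ ρ') (hV : ∀ a, Rg ρ a → V' a = V a) :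
    ∀ {sq}, SqI ρ V sq → SqI ρ' V' sq ∧ dec V' sq = dec V sq
  | SL.nil, _ => ⟨trivial, rfl⟩
  | SL.cons x y z t, ⟨h1, h2, h3, h4, h5⟩ => by
    obtain ⟨a, b⟩ := SqI.congr hρ hV h5
    refine ⟨⟨h1.mono hρ, h2.mono hρ, h3.mono hρ, by rw [hV y h2, hV z h3]; exact h4, a⟩, ?_⟩
    simp only [dec, b, hV x h1, hV y h2, hV z h3]

theorem Rg_cN {ρ : ℕ} (h : 2 ≤ ρ) : Rg ρ cN := ⟨1, by omega, by omega, rfl⟩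

theorem Bs.add {ρ rem n : ℕ} {V : ℕ → ℕ} {D P : Finset (ℕ × ℕ × ℕ)} {H H' : ℕ → ℕ} {sq : SL} (hB : Bs ρ V n D (rem + 1) sq P H)
    {x h s : ℕ} (hx : Rg ρ x) (hh : Rg ρ h) (hD : (V x, V h, s) ∈ D) (hP : (V x, V h, s) ∉ P) (hs : 0 < s)
    (hpt : Pt n D (insert (V x, V h, s) P) H') {ρ' : ℕ} {V' : ℕ → ℕ} {T : ℕ} (hρ : ρ ≤ ρ') (hV : ∀ a, Rg ρ a → V' a = V a)
    (hT : Rg ρ' T) (hVT : V' T = V h + s) : Bs ρ' V' n D rem (SL.cons x h T sq) (insert (V x, V h, s) P) H' := by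
  obtain ⟨a, b⟩ := SqI.congr hρ hV hB.sqI
  have e : dec V' (SL.cons x h T sq) = (V x, V h, s) :: dec V sq := by
    simp only [dec, b, hV x hx, hV h hh, hVT, Nat.add_sub_cancel_left]
  refine ⟨hpt, ?_, ⟨hx.mono hρ, hh.mono hρ, hT, by rw [hVT, hV h hh]; omega, a⟩, ?_, ?_, ?_, by have := hB.r; omega⟩
  · have h1 := hB.card
    have : D \ insert (V x, V h, s) P = (D \ P).erase (V x, V h, s) := by
      ext q; simp only [mem_sdiff, mem_insert, mem_erase]; tauto
    rw [this, card_erase_of_mem (mem_sdiff.2 ⟨hD, hP⟩), h1]; rfl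
  · rw [e, List.toFinset_cons, hB.sqP]
  · rw [e, List.nodup_cons]
    refine ⟨fun hm => hP ?_, hB.sqN⟩
    rw [← hB.sqP]; exact List.mem_toFinset.2 hm
  · rw [hV cN (Rg_cN hB.r), hB.n]

section
variable {gs : ℕ → Go} {ρ κ rem : ℕ} {S n : ℕ} {V : ℕ → ℕ} {D P : Finset (ℕ × ℕ × ℕ)} {H : ℕ → ℕ} {sq : SL}

theorem A_ok (hs : Snd gs ρ κ rem) (hrem : 1 ≤ rem) (hD : Dis n D) (hg : D.gcd (fun q => q.2.2) = 1) (hS : Sm S ρ κ V)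
    (hB : Bs ρ V n D rem sq P H) {T hl xl x hr xr a b : ℕ} {L : LL} {R : RL} {f : Bool}
    (rT : Rg ρ T) (rx : Rg ρ x) (hx : V x < V xr) (hT : ∀ c, V x ≤ c → c < V xr → H c = V T)
    (hL : LI ρ V H n L hl xl) (hxl : V xl ≤ V x) (hHl : ∀ c, V xl ≤ c → c < V x → H c = V hl)
    (hor : V xl < V x ∨ L = LL.nil) (hR : RI ρ V H n R hr xr)
    (ha : a + (lenL L + 1 + dns R) = rem + 1) (hb : b + (ups R + 1) = rem + 1)
    (hk : ∀ i < 12, stepA1 f (gs i) T a b sq hl xl L x hr xr R S = true) : Concl n D := by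
  obtain ⟨rhl, rxl⟩ := hL.rh
  obtain ⟨rhr, rxr⟩ := hR.rh
  have hln := hL.le
  have hrn := hR.hle hB.pt.le
  have hTn : V T ≤ n := by
    rw [← hT _ le_rfl hx]; exact hB.pt.le _ (by have := hR.xle; omega)
  have hLn : L = LL.nil → V hl = n := by rintro rfl; exact hL.2.2.1
  have hRn : R = RL.nil → V hr = n := by rintro rfl; exact hR.2.2.1
  have cnt : ∀ {L' R' h' x'}, LI ρ V H n L' h' x' → RI ρ V H n R' h' x' → lenL L' + dns R' ≤ rem ∧ ups R' ≤ rem := by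
    intro L' R' h' x' h1 h2; have := counts hD hB.pt h1 h2; rwa [hB.card] at this
  rcases lt_trichotomy (V T) (V hl) with c1 | c1 | c1
  · -- T < hl
    have nL : LI ρ V H n (LL.cons hl xl L) T x := ⟨rT, rx, c1, hxl, hHl, hor, hL⟩
    rcases lt_trichotomy (V T) (V hr) with c2 | c2 | c2
    · have nR : RI ρ V H n (RL.up hr xr R) T x := ⟨rT, rx, c2, hx, hT, hR⟩
      have := cnt nL nR; simp only [lenL, dns, ups] at this
      obtain ⟨S1, hS1, k1⟩ := cmp_lt hS rT rhl c1 (g1_ok (a := a) (by omega)) f true (PD.nL L (g1 b))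
      obtain ⟨S2, hS2, k2⟩ := cmp_lt hS1 rT rhr c2 (g1_ok (a := b) (by omega)) f (PD.nR R true) (PD.nR R (Nat.ble (nat_lit 2) a))
      refine hs S2 V n D P H sq _ _ _ _ _ _ (p1 a) (p1 b) hD hg hS2 hB nL nR ?_ ?_ fun i hi => k2 _ _ _ (k1 _ _ _ (hk i hi))
      · simp only [lenL, p1_eq]; omega
      · simp only [p1_eq]; omega
    · have nR : RI ρ V H n R T x := hR.ext rT rx c2 hx.le hT
      have := cnt nL nR; simp only [lenL, dns, ups] at this
      have hne : R ≠ RL.nil := fun e => by have := hRn e; omega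
      obtain ⟨S1, hS1, k1⟩ := cmp_lt hS rT rhl c1 (g1_ok (a := a) (by omega)) f true (PD.nL L (g1 b))
      obtain ⟨S2, hS2, k2⟩ := cmp_eq hS1 rT rhr c2 (nR_ok hne true) f (g1 b) (PD.nR R (Nat.ble (nat_lit 2) a))
      refine norm_ok (a := p1 a) (b := b) hs hD hg hS2 hB R _ _ _ hne nL nR ?_ ?_ fun i hi => k2 _ _ _ (k1 _ _ _ (hk i hi))
      · simp only [lenL, p1_eq]; omega
      · omega
    · have nR : RI ρ V H n (RL.dn hr xr R) T x := ⟨rT, rx, c2, hx, hT, hR⟩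
      have := cnt nL nR; simp only [lenL, dns, ups] at this
      have hne : R ≠ RL.nil := fun e => by have := hRn e; omega
      obtain ⟨S1, hS1, k1⟩ := cmp_lt hS rT rhl c1 (g1_ok (a := a) (by omega)) f true (PD.nL L (g1 b))
      obtain ⟨S2, hS2, k2⟩ := cmp_gt hS1 rT rhr c2 ((nR_ok hne _).trans (ble2 (a := a) (by omega))) f (g1 b) (PD.nR R true)
      refine norm_ok (a := p1 (p1 a)) (b := b) hs hD hg hS2 hB (RL.dn hr xr R) _ _ _ (by simp) nL nR ?_ ?_ fun i hi => k2 _ _ _ (k1 _ _ _ (hk i hi))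
      · simp only [lenL, dns, p1_eq]; omega
      · simp only [ups]; omega
  · -- T = hl
    have hm : ∀ c, V xl ≤ c → c < V xr → H c = V hl := by
      intro c h1 h2
      by_cases hc : c < V x
      · exact hHl c h1 hc
      · rw [hT c (by omega) h2, c1]
    obtain ⟨S1, hS1, k1⟩ := cmp_eq hS rT rhl c1 (rfl : true = true) f (g1 a) (PD.nL L (g1 b))
    rcases lt_trichotomy (V T) (V hr) with c2 | c2 | c2
    · have nR : RI ρ V H n (RL.up hr xr R) hl xl := ⟨rhl, rxl, by omega, by omega, hm, hR⟩
      have := cnt hL nR; simp only [lenL, dns, ups] at this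
      have hne : L ≠ LL.nil := fun e => by have := hLn e; omega
      obtain ⟨S2, hS2, k2⟩ := cmp_lt hS1 rT rhr c2 ((nL_ok hne _).trans (g1_ok (a := b) (by omega))) f (PD.nR R true) (PD.nR R (g1 a))
      refine hs S2 V n D P H sq _ _ _ _ _ _ a (p1 b) hD hg hS2 hB hL nR ?_ ?_ fun i hi => k2 _ _ _ (k1 _ _ _ (hk i hi))
      · omega
      · simp only [p1_eq]; omega
    · have nR : RI ρ V H n R hl xl := hR.ext rhl rxl (by omega) (by omega) hm
      have := cnt hL nR
      have hne : R ≠ RL.nil := by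
        rintro rfl
        have e1 := hRn rfl
        have e2 : L = LL.nil := by
          cases L with
          | nil => rfl
          | cons p q t => have := hL.2.2.1; have := hL.2.2.2.2.2.2.le; omega
        subst e2
        have e3 := hL.2.2.2
        have e4 := nR.2.2.2.2
        have hc : (D \ P).Nonempty := by rw [← card_pos, hB.card]; exact hrem
        obtain ⟨q, hq⟩ := hc
        obtain ⟨q1, q2⟩ := mem_sdiff.1 hq
        have := hD.pos q q1; have := hD.ins q q1
        have := hB.pt.out q q1 q2 q.1 le_rfl (by omega)
        rw [e4 _ (by omega) (by omega)] at this
        omega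
      obtain ⟨S2, hS2, k2⟩ := cmp_eq hS1 rT rhr c2 (nR_ok hne true) f (PD.nL L (g1 b)) (PD.nR R (g1 a))
      refine norm_ok (a := a) (b := b) hs hD hg hS2 hB R _ _ _ hne hL nR ?_ ?_ fun i hi => k2 _ _ _ (k1 _ _ _ (hk i hi))
      · omega
      · omega
    · have nR : RI ρ V H n (RL.dn hr xr R) hl xl := ⟨rhl, rxl, by omega, by omega, hm, hR⟩
      have := cnt hL nR; simp only [lenL, dns, ups] at this
      have hne : R ≠ RL.nil := fun e => by have := hRn e; omega
      have c3 := (nR_ok hne _).trans (g1_ok (a := a) (by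
        have nn := counts hD hB.pt hL nR
        simp only [dns] at nn; rw [hB.card] at nn; omega))
      obtain ⟨S2, hS2, k2⟩ := cmp_gt hS1 rT rhr c2 c3 f (PD.nL L (g1 b)) (PD.nR R true)
      refine norm_ok (a := p1 a) (b := b) hs hD hg hS2 hB (RL.dn hr xr R) _ _ _ (by simp) hL nR ?_ ?_ fun i hi => k2 _ _ _ (k1 _ _ _ (hk i hi))
      · simp only [dns, p1_eq]; omega
      · simp only [ups]; omega
  · -- T > hl
    have hneL : L ≠ LL.nil := fun e => by have := hLn e; omega
    have hlt : V xl < V x := hor.resolve_right hneL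
    rcases lt_trichotomy (V T) (V hr) with c2 | c2 | c2
    · have nR : RI ρ V H n (RL.up T x (RL.up hr xr R)) hl xl := ⟨rhl, rxl, c1, hlt, hHl, rT, rx, c2, hx, hT, hR⟩
      have := cnt hL nR; simp only [lenL, dns, ups] at this
      obtain ⟨S1, hS1, k1⟩ := cmp_gt hS rT rhl c1 ((nL_ok hneL _).trans (g1_ok (a := b) (by omega))) f (g1 a) true
      obtain ⟨S2, hS2, k2⟩ := cmp_lt hS1 rT rhr c2 (ble2 (a := b) (by omega)) f true (PD.nR R (g1 a))
      refine hs S2 V n D P H sq _ _ _ _ _ _ a (p1 (p1 b)) hD hg hS2 hB hL nR ?_ ?_ fun i hi => k2 _ _ _ (k1 _ _ _ (hk i hi))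
      · simp only [dns]; omega
      · simp only [ups, p1_eq]; omega
    · have nR : RI ρ V H n (RL.up T x R) hl xl := ⟨rhl, rxl, c1, hlt, hHl, hR.ext rT rx c2 hx.le hT⟩
      have := cnt hL nR; simp only [lenL, dns, ups] at this
      obtain ⟨S1, hS1, k1⟩ := cmp_gt hS rT rhl c1 ((nL_ok hneL _).trans (g1_ok (a := b) (by omega))) f (g1 a) true
      obtain ⟨S2, hS2, k2⟩ := cmp_eq hS1 rT rhr c2 (rfl : true = true) f (Nat.ble (nat_lit 2) b) (PD.nR R (g1 a))
      refine hs S2 V n D P H sq _ _ _ _ _ _ a (p1 b) hD hg hS2 hB hL nR ?_ ?_ fun i hi => k2 _ _ _ (k1 _ _ _ (hk i hi))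
      · omega
      · simp only [p1_eq]; omega
    · have nR : RI ρ V H n (RL.up T x (RL.dn hr xr R)) hl xl := ⟨rhl, rxl, c1, hlt, hHl, rT, rx, c2, hx, hT, hR⟩
      have := cnt hL nR; simp only [lenL, dns, ups] at this
      have hne : R ≠ RL.nil := fun e => by have := hRn e; omega
      obtain ⟨S1, hS1, k1⟩ := cmp_gt hS rT rhl c1 ((nL_ok hneL _).trans (g1_ok (a := b) (by omega))) f (g1 a) true
      obtain ⟨S2, hS2, k2⟩ := cmp_gt hS1 rT rhr c2 ((nR_ok hne _).trans (g1_ok (a := a) (by omega))) f (Nat.ble (nat_lit 2) b) true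
      refine hs S2 V n D P H sq _ _ _ _ _ _ (p1 a) (p1 b) hD hg hS2 hB hL nR ?_ ?_ fun i hi => k2 _ _ _ (k1 _ _ _ (hk i hi))
      · simp only [dns, p1_eq]; omega
      · simp only [ups, p1_eq]; omega

theorem B_ok (hs : Snd gs ρ κ rem) (hD : Dis n D) (hg : D.gcd (fun q => q.2.2) = 1) (hS : Sm S ρ κ V)
    (hB : Bs ρ V n D rem sq P H) {T E hl xl h x hr xr a b : ℕ} {L : LL} {R : RL} {f : Bool}
    (rT : Rg ρ T) (rE : Rg ρ E) (rh : Rg ρ h) (rx : Rg ρ x) (hxE : V x < V E) (hEx : V E < V xr)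
    (hT : ∀ c, V x ≤ c → c < V E → H c = V T) (hE : ∀ c, V E ≤ c → c < V xr → H c = V h)
    (hhT : V h < V T) (hhr : V h < V hr) (hhl : V h < V hl)
    (hL : LI ρ V H n L hl xl) (hxl : V xl ≤ V x) (hHl : ∀ c, V xl ≤ c → c < V x → H c = V hl)
    (hor : V xl < V x ∨ L = LL.nil) (hR : RI ρ V H n R hr xr)
    (ha : a + (lenL L + 1 + dns R) = rem) (hb : b + (ups R + 1) = rem)
    (hk : ∀ i < 12, stepB3 f (gs i) T E a b sq hl xl L h x hr xr R S = true) : Concl n D := by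
  obtain ⟨rhl, rxl⟩ := hL.rh
  have hln := hL.le
  have hTn : V T ≤ n := by
    rw [← hT _ le_rfl hxE]; exact hB.pt.le _ (by have := hR.xle; omega)
  have hLn : L = LL.nil → V hl = n := by rintro rfl; exact hL.2.2.1
  have cnt : ∀ {L' R' h' x'}, LI ρ V H n L' h' x' → RI ρ V H n R' h' x' → lenL L' + dns R' ≤ rem ∧ ups R' ≤ rem := by
    intro L' R' h' x' h1 h2; have := counts hD hB.pt h1 h2; rwa [hB.card] at this
  have uR : RI ρ V H n (RL.up hr xr R) h E := ⟨rh, rE, hhr, hEx, hE, hR⟩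
  rcases lt_trichotomy (V T) (V hl) with c1 | c1 | c1
  · have nL : LI ρ V H n (LL.cons T x (LL.cons hl xl L)) h E :=
      ⟨rh, rE, hhT, hxE.le, hT, Or.inl hxE, rT, rx, c1, hxl, hHl, hor, hL⟩
    have := cnt nL uR; simp only [lenL, dns, ups] at this
    obtain ⟨S1, hS1, k1⟩ := cmp_lt hS rT rhl c1 (g1_ok (a := a) (by omega)) f true (PD.nL L (g1 b))
    refine hs S1 V n D P H sq _ _ _ _ _ _ (p1 a) b hD hg hS1 hB nL uR ?_ ?_ fun i hi => k1 _ _ _ (hk i hi)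
    · simp only [lenL, p1_eq]; omega
    · omega
  · have nL : LI ρ V H n (LL.cons hl xl L) h E := by
      refine ⟨rh, rE, hhl, by omega, fun c h1 h2 => ?_, Or.inl (by omega), hL⟩
      by_cases hc : c < V x
      · exact hHl c h1 hc
      · rw [hT c (by omega) h2, c1]
    obtain ⟨S1, hS1, k1⟩ := cmp_eq hS rT rhl c1 (rfl : true = true) f (g1 a) (PD.nL L (g1 b))
    refine hs S1 V n D P H sq _ _ _ _ _ _ a b hD hg hS1 hB nL uR ?_ ?_ fun i hi => k1 _ _ _ (hk i hi)
    · simp only [lenL]; omega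
    · omega
  · have hneL : L ≠ LL.nil := fun e => by have := hLn e; omega
    have hlt : V xl < V x := hor.resolve_right hneL
    have nR : RI ρ V H n (RL.up T x (RL.dn h E (RL.up hr xr R))) hl xl :=
      ⟨rhl, rxl, c1, hlt, hHl, rT, rx, hhT, hxE, hT, uR⟩
    have := cnt hL nR; simp only [lenL, dns, ups] at this
    obtain ⟨S1, hS1, k1⟩ := cmp_gt hS rT rhl c1 ((nL_ok hneL _).trans (g1_ok (a := b) (by omega))) f (g1 a) true
    refine hs S1 V n D P H sq _ _ _ _ _ _ a (p1 b) hD hg hS1 hB hL nR ?_ ?_ fun i hi => k1 _ _ _ (hk i hi)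
    · simp only [dns]; omega
    · simp only [ups, p1_eq]; omega
end
end PD

namespace PD
open Finset

section
variable {ρ rem n : ℕ} {V : ℕ → ℕ} {D P : Finset (ℕ × ℕ × ℕ)} {H : ℕ → ℕ}

theorem B_cnt (hD : Dis n D) (hP : Pt n D P H) (hc : (D \ P).card = rem) {T E hl xl h x hr xr : ℕ} {L : LL} {R : RL}
    (rT : Rg ρ T) (rE : Rg ρ E) (rh : Rg ρ h) (rx : Rg ρ x) (hxE : V x < V E) (hEx : V E < V xr)
    (hT : ∀ c, V x ≤ c → c < V E → H c = V T) (hE : ∀ c, V E ≤ c → c < V xr → H c = V h)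
    (hhT : V h < V T) (hhr : V h < V hr) (hhl : V h < V hl)
    (hL : LI ρ V H n L hl xl) (hxl : V xl ≤ V x) (hHl : ∀ c, V xl ≤ c → c < V x → H c = V hl)
    (hor : V xl < V x ∨ L = LL.nil) (hR : RI ρ V H n R hr xr) :
    lenL L + 1 + dns R ≤ rem ∧ ups R + 1 ≤ rem := by
  obtain ⟨rhl, rxl⟩ := hL.rh
  have hTn : V T ≤ n := by
    rw [← hT _ le_rfl hxE]; exact hP.le _ (by have := hR.xle; omega)
  have hLn : L = LL.nil → V hl = n := by rintro rfl; exact hL.2.2.1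
  have cnt : ∀ {L' R' h' x'}, LI ρ V H n L' h' x' → RI ρ V H n R' h' x' → lenL L' + dns R' ≤ rem ∧ ups R' ≤ rem := by
    intro L' R' h' x' h1 h2; have := counts hD hP h1 h2; rwa [hc] at this
  have uR : RI ρ V H n (RL.up hr xr R) h E := ⟨rh, rE, hhr, hEx, hE, hR⟩
  rcases lt_trichotomy (V T) (V hl) with c1 | c1 | c1
  · have nL : LI ρ V H n (LL.cons T x (LL.cons hl xl L)) h E :=
      ⟨rh, rE, hhT, hxE.le, hT, Or.inl hxE, rT, rx, c1, hxl, hHl, hor, hL⟩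
    have := cnt nL uR; simp only [lenL, dns, ups] at this; omega
  · have nL : LI ρ V H n (LL.cons hl xl L) h E := by
      refine ⟨rh, rE, hhl, by omega, fun c h1 h2 => ?_, Or.inl (by omega), hL⟩
      by_cases hc : c < V x
      · exact hHl c h1 hc
      · rw [hT c (by omega) h2, c1]
    have := cnt nL uR; simp only [lenL, dns, ups] at this; omega
  · have hneL : L ≠ LL.nil := fun e => by have := hLn e; omega
    have nR : RI ρ V H n (RL.up T x (RL.dn h E (RL.up hr xr R))) hl xl :=
      ⟨rhl, rxl, c1, hor.resolve_right hneL, hHl, rT, rx, hhT, hxE, hT, uR⟩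
    have := cnt hL nR; simp only [lenL, dns, ups] at this; omega
end

theorem upd_rg {ρ : ℕ} (V : ℕ → ℕ) (s t : ℕ) : ∀ a, Rg ρ a →
    Function.update (Function.update V (64 + 432 * ρ) s) (64 + 432 * (ρ + 1)) t a = V a := by
  rintro a ⟨r, h1, h2, rfl⟩
  rw [Function.update_of_ne (by omega), Function.update_of_ne (by omega)]
theorem upd_rg1 {ρ : ℕ} (V : ℕ → ℕ) (s : ℕ) : ∀ a, Rg ρ a →
    Function.update V (64 + 432 * ρ) s a = V a := by
  rintro a ⟨r, h1, h2, rfl⟩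
  rw [Function.update_of_ne (by omega)]

theorem step_ok {gs : ℕ → Go} {ρ m rem : ℕ} (f : Bool) (hs : Snd gs (ρ + 2) m rem) (hrem : 1 ≤ rem) (hρ : ρ + 2 ≤ 19) (hm : m < 9) :
    Snd (fun i => step f (gs i) (64 + 432 * ρ) (64 + 432 * (ρ + 1)) (Nat.pow 2 (48 * m))) ρ (m + 1) (rem + 1) := by
  intro S V n D P H sq L h x hr xr R a b hD hg hS hB hL hR ha hb hk
  have hedge := hL.edge
  obtain ⟨rh, rx, hhr, hx, hH, hR'⟩ := hR
  obtain ⟨rhr, rxr⟩ := hR'.rh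
  have hrn := hR'.hle hB.pt.le
  have hxn := hR'.xle
  cases L with
  | nil => have := hL.2.2.1; omega
  | cons hl xl L =>
  obtain ⟨-, -, hhl, hxl, hHl, hor, hL'⟩ := hL
  obtain ⟨rhl, rxl⟩ := hL'.rh
  obtain ⟨s, s0, sw, sn, sD, sP, spt⟩ := place hD hB.pt hx hxn (by omega) hH hedge (by
    rcases hR'.edge with e | ⟨e, e'⟩
    · exact Or.inl e
    · right; rw [e']; exact hhr)
  set T := 64 + 432 * ρ with hTd
  set E := 64 + 432 * (ρ + 1) with hEd
  have rT : Rg (ρ + 2) T := ⟨ρ, by omega, by omega, rfl⟩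
  have rE : Rg (ρ + 2) E := ⟨ρ + 1, by omega, by omega, rfl⟩
  have hk' : ∀ i < 12, stepC f (gs i) T E (Nat.pow 2 (48 * m)) S a b (SL.cons x h T sq) hl xl L h x hr xr R = true := hk
  have hTE : T ≠ E := by omega
  simp only [lenL] at ha
  by_cases c : s = V xr - V x
  · have hA : ∀ i < 12, addr S (Nat.sub (Nat.add (row S h) (row S xr)) (row S x)) T (stepA1 f (gs i) T a b (SL.cons x h T sq) hl xl L x hr xr R) = true := by
      intro i hi
      have := hk' i hi
      unfold stepC at this
      rw [an_eq, Bool.and_eq_true] at this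
      exact this.1
    obtain ⟨v, d, hS'⟩ := hS
    have hl1 := rp_add3 (row_rp hS' rh) (row_rp hS' rxr) (row_rp hS' rx) (by norm_num)
    have e : ((V h : ℤ) + V xr - V x) = ((V h + s : ℕ) : ℤ) := by push_cast; omega
    rw [e] at hl1
    obtain ⟨S', hS1, k1⟩ := addr_ok hS' hl1 (by norm_num) (by omega) hTd (hA 0 (by norm_num))
    have hS2 : Sm S' (ρ + 2) m _ := (Sm.skip ⟨v, d, hS1⟩ hEd).weak (by omega)
    set V' := Function.update (Function.update V T (V h + s)) E 0 with hV'
    have hV : ∀ a, Rg ρ a → V' a = V a := upd_rg V _ _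
    have vT : V' T = V h + s := by rw [hV', Function.update_of_ne hTE, Function.update_self]
    have hB' := hB.add rx rh sD sP s0 spt (ρ' := ρ + 2) (by omega) hV rT vT
    refine A_ok hs hrem hD hg hS2 hB' (f := f) (T := T) (hl := hl) (xl := xl) (x := x) (hr := hr) (xr := xr) (L := L) (R := R) rT (rx.mono (by omega)) ?_ ?_ ?_ ?_ ?_ ?_ ?_ ha hb fun i hi => k1 _ (hA i hi)
    · rw [hV x rx, hV xr rxr]; exact hx
    · rw [hV x rx, hV xr rxr, vT]; intro c c1 c2; rw [if_pos (by omega)]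
    · exact hL'.congr (by omega) hV fun c hc => by rw [if_neg (by omega)]
    · rw [hV x rx, hV xl rxl]; exact hxl
    · rw [hV x rx, hV xl rxl, hV hl rhl]; intro c c1 c2; rw [if_neg (by omega)]; exact hHl c c1 c2
    · rw [hV x rx, hV xl rxl]; exact hor
    · exact hR'.congr (by omega) hV fun c hc => by rw [if_neg (by omega)]
  · set V' := Function.update (Function.update V T (V h + s)) E (V x + s) with hV'
    have hV : ∀ a, Rg ρ a → V' a = V a := upd_rg V _ _
    have vT : V' T = V h + s := by rw [hV', Function.update_of_ne hTE, Function.update_self]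
    have vE : V' E = V x + s := by rw [hV', Function.update_self]
    have hB' := hB.add rx rh sD sP s0 spt (ρ' := ρ + 2) (by omega) hV rT vT
    have w1 : V' x < V' E := by rw [hV x rx, vE]; omega
    have w2 : V' E < V' xr := by rw [hV xr rxr, vE]; omega
    have w3 : ∀ c, V' x ≤ c → c < V' E → (fun c => if V x ≤ c ∧ c < V x + s then V h + s else H c) c = V' T := by
      rw [hV x rx, vE, vT]; intro c c1 c2; exact if_pos (by omega)
    have w4 : ∀ c, V' E ≤ c → c < V' xr → (fun c => if V x ≤ c ∧ c < V x + s then V h + s else H c) c = V' h := by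
      rw [hV h rh, vE, hV xr rxr]; intro c c1 c2
      simp only
      rw [if_neg (by omega)]; exact hH c (by omega) c2
    have w5 : V' h < V' T := by rw [hV h rh, vT]; omega
    have w6 : V' h < V' hr := by rw [hV h rh, hV hr rhr]; exact hhr
    have w7 : V' h < V' hl := by rw [hV h rh, hV hl rhl]; exact hhl
    have w8 := hL'.congr (ρ' := ρ + 2) (by omega) hV (H' := fun c => if V x ≤ c ∧ c < V x + s then V h + s else H c) fun c hc => by rw [if_neg (by omega)]
    have w9 : V' xl ≤ V' x := by rw [hV x rx, hV xl rxl]; exact hxl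
    have w10 : ∀ c, V' xl ≤ c → c < V' x → (fun c => if V x ≤ c ∧ c < V x + s then V h + s else H c) c = V' hl := by
      rw [hV x rx, hV xl rxl, hV hl rhl]; intro c c1 c2; simp only; rw [if_neg (by omega)]; exact hHl c c1 c2
    have w11 : V' xl < V' x ∨ L = LL.nil := by rw [hV x rx, hV xl rxl]; exact hor
    have w12 := hR'.congr (ρ' := ρ + 2) (by omega) hV (H' := fun c => if V x ≤ c ∧ c < V x + s then V h + s else H c) fun c hc => by rw [if_neg (by omega)]
    have rh' := rh.mono (ρ' := ρ + 2) (by omega)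
    have rx' := rx.mono (ρ' := ρ + 2) (by omega)
    obtain ⟨n1, n2⟩ := B_cnt hD spt hB'.card rT rE rh' rx' w1 w2 w3 w4 w5 w6 w7 w8 w9 w10 w11 w12
    have hA : ∀ i < 12, addr S (Nat.add (row S h) (Nat.pow 2 (48 * m))) T (stepB1 f x xr E (Nat.pow 2 (48 * m)) (stepB3 f (gs i) T E (p1 a) (p1 b) (SL.cons x h T sq) hl xl L h x hr xr R)) = true := by
      intro i hi
      have := hk' i hi
      unfold stepC at this
      rw [an_eq, Bool.and_eq_true] at this
      have := this.2
      unfold stepB at this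
      rw [ift_eq, if_pos (g1_ok (by omega)), ift_eq, if_pos (g1_ok (by omega))] at this
      exact this
    obtain ⟨v0, d, hS0⟩ := hS
    obtain ⟨v, hS', hv⟩ := hS0.fresh hm s0
    have hl1 := rp_e hm (row_rp hS' rh) hv
    have e : ((V h : ℤ) + s) = ((V h + s : ℕ) : ℤ) := by push_cast; rfl
    rw [e] at hl1
    obtain ⟨S1, hS1, k1⟩ := addr_ok hS' hl1 (by norm_num) (by omega) hTd (hA 0 (by norm_num))
    have hl2 := rp_e hm (row_rp hS1 (rx.mono (by omega))) hv
    have e : (((Function.update V T (V h + s)) x : ℤ) + s) = ((V x + s : ℕ) : ℤ) := by rw [upd_rg1 V _ x rx]; push_cast; rfl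
    rw [e] at hl2
    have hA1 : ∀ i < 12, addr S1 (Nat.add (row S1 x) (Nat.pow 2 (48 * m))) E (stepB2 f xr E (stepB3 f (gs i) T E (p1 a) (p1 b) (SL.cons x h T sq) hl xl L h x hr xr R)) = true :=
      fun i hi => k1 _ (hA i hi)
    obtain ⟨S2, hS2, k2⟩ := addr_ok hS1 hl2 (by norm_num) (by omega) hEd (hA1 0 (by norm_num))
    obtain ⟨S3, hS3, k3⟩ := posB_ok hS2 (df_rp hS2 (rxr.mono (by omega)) rE) (by norm_num) (by
      have := w2; rw [hV'] at this; omega) f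
    refine B_ok (a := p1 a) (b := p1 b) hs hD hg hS3 hB' (f := f) rT rE rh' rx' w1 w2 w3 w4 w5 w6 w7 w8 w9 w10 w11 w12 ?_ ?_ fun i hi => k3 _ (k2 _ (hA1 i hi))
    · rw [p1_eq]; omega
    · rw [p1_eq]; omega
end PD

namespace PD
open Finset

theorem gcdL_eq : ∀ l : List (ℕ × ℕ × ℕ), gcdL l = l.toFinset.gcd (fun q => q.2.2)
  | [] => by simp [gcdL]
  | q :: t => by rw [gcdL, gcdL_eq t, List.toFinset_cons, gcd_insert]; rfl

section
variable {S ρ κ n : ℕ} {V : ℕ → ℕ} {D P : Finset (ℕ × ℕ × ℕ)} {sq : SL}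

theorem leaf_fin (hS : Sm S ρ κ V) (hsq : SqI ρ V sq) (rn : Rg ρ cN) (hn : V cN = n) (hd : (dec V sq).toFinset = D)
    (hnd : (dec V sq).Nodup) (hg : D.gcd (fun q => q.2.2) = 1) (hl : leaf sq S = true) : Concl n D := by
  obtain ⟨h1, h2⟩ := leaf_ok hS hsq rn (by rw [gcdL_eq, hd, hg]) hl
  refine ⟨hn ▸ h1, ?_⟩
  rw [← List.sum_toFinset _ hnd, hd] at h2; exact h2

theorem leaf2_fin {x1 y1 z1 x2 y2 z2 : ℕ} (hS : ∃ S', Sm S' ρ κ V ∧ leaf (SL.cons x2 y2 z2 (SL.cons x1 y1 z1 sq)) S' = true) (hsq : SqI ρ V sq) (rn : Rg ρ cN)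
    (hn : V cN = n) (hd : (dec V sq).toFinset = P)
    (hnd : (dec V sq).Nodup) (hg : D.gcd (fun q => q.2.2) = 1)
    (r1 : Rg ρ x1) (r2 : Rg ρ y1) (r3 : Rg ρ z1) (r4 : Rg ρ x2) (r5 : Rg ρ y2) (r6 : Rg ρ z2) {p1 q1 s1 p2 q2 s2 : ℕ}
    (e1 : V x1 = p1) (e2 : V y1 = q1) (e3 : V z1 = q1 + s1) (e4 : V x2 = p2) (e5 : V y2 = q2) (e6 : V z2 = q2 + s2)
    (h1 : 0 < s1) (h2 : 0 < s2) (hP : (p1, q1, s1) ∉ P) (hP2 : (p2, q2, s2) ∉ insert (p1, q1, s1) P)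
    (hD : D = insert (p2, q2, s2) (insert (p1, q1, s1) P)) : Concl n D := by
  obtain ⟨S', hS', hl⟩ := hS
  have e : dec V (SL.cons x2 y2 z2 (SL.cons x1 y1 z1 sq)) = (p2, q2, s2) :: (p1, q1, s1) :: dec V sq := by
    simp only [dec, e1, e2, e3, e4, e5, e6, Nat.add_sub_cancel_left]
  have hq : SqI ρ V (SL.cons x2 y2 z2 (SL.cons x1 y1 z1 sq)) := ⟨r4, r5, r6, by omega, r1, r2, r3, by omega, hsq⟩
  refine leaf_fin hS' hq rn hn ?_ ?_ hg hl
  · rw [e, List.toFinset_cons, List.toFinset_cons, hd, hD]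
  · rw [e, List.nodup_cons, List.nodup_cons]
    refine ⟨fun hm => hP2 ?_, fun hm => hP ?_, hnd⟩
    · rw [← hd, ← List.toFinset_cons]; exact List.mem_toFinset.2 hm
    · rw [← hd]; exact List.mem_toFinset.2 hm

variable {p q r s p' q' r' s' u w : ℕ}

theorem fz4_ok (hS : Sm S ρ κ V) (hp : Rg ρ p) (hq : Rg ρ q) (hr : Rg ρ r) (hs : Rg ρ s) (he : V p + V q = V r + V s)
    (hk : fz4 sq p q r s S = true) : ∃ S', Sm S' ρ κ V ∧ leaf sq S' = true := by
  obtain ⟨v, d, h⟩ := hS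
  obtain ⟨S', h1, h2⟩ := zeroL_ok h (l := f4 S p q r s) (by have := f4_rp h hp hq hr hs; rwa [show (V p : ℤ) + V q - (V r + V s) = 0 by omega] at this) (by norm_num)
  exact ⟨S', h1, h2 _ hk⟩

theorem close2_ok (hS : Sm S ρ κ V) (hp : Rg ρ p) (hq : Rg ρ q) (hr : Rg ρ r) (hs : Rg ρ s) (he : V p + V q = V r + V s)
    (hp' : Rg ρ p') (hq' : Rg ρ q') (hr' : Rg ρ r') (hs' : Rg ρ s') (he' : V p' + V q' = V r' + V s')
    (hk : close2 p q r s p' q' r' s' sq S = true) : ∃ S', Sm S' ρ κ V ∧ leaf sq S' = true := by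
  obtain ⟨v, d, h⟩ := hS
  have a1 := f4_rp h hp hq hr hs
  rw [show (V p : ℤ) + V q - (V r + V s) = 0 by omega] at a1
  have a2 := f4_rp h hp' hq' hr' hs'
  rw [show (V p' : ℤ) + V q' - (V r' + V s') = 0 by omega] at a2
  unfold close2 close3 at hk
  have k1 := chk2_ok h.vp a1 (by norm_num) a2 (by norm_num) (zchk_ok h.vp a2 (by norm_num) (zchk_ok h.vp a1 (by norm_num) hk))
  obtain ⟨S', h1, h2⟩ := zeroL_ok h a1 (by norm_num)
  exact fz4_ok h1 hp' hq' hr' hs' he' (h2 _ k1)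

theorem close4_ok (hS : Sm S ρ κ V) (hu : Rg ρ u) (hw : Rg ρ w) (huw : V u = V w) (hp : Rg ρ p) (hq : Rg ρ q) (hr : Rg ρ r) (hs : Rg ρ s) (he : V p + V q = V r + V s)
    (hp' : Rg ρ p') (hq' : Rg ρ q') (hr' : Rg ρ r') (hs' : Rg ρ s') (he' : V p' + V q' = V r' + V s')
    (hk : close4 u w p q r s p' q' r' s' sq S = true) : ∃ S', Sm S' ρ κ V ∧ leaf sq S' = true := by
  obtain ⟨v, d, h⟩ := hS
  have a0 := df_rp h hu hw
  rw [show (V u : ℤ) - V w = 0 by omega] at a0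
  have a1 := f4_rp h hp hq hr hs
  rw [show (V p : ℤ) + V q - (V r + V s) = 0 by omega] at a1
  have a2 := f4_rp h hp' hq' hr' hs'
  rw [show (V p' : ℤ) + V q' - (V r' + V s') = 0 by omega] at a2
  unfold close4 at hk
  have k1 := (zchk_ok h.vp a2 (by norm_num) (zchk_ok h.vp a1 (by norm_num) (zchk_ok h.vp a0 (by norm_num) hk)))
  obtain ⟨S', h1, h2⟩ := zeroL_ok h a0 (by norm_num)
  exact close2_ok h1 hp hq hr hs he hp' hq' hr' hs' he' (h2 _ k1)
end

theorem seg {n p y s A B : ℕ} {H : ℕ → ℕ} (K : ∀ c < n, (H c = n ∧ (c < p ∨ p + s ≤ c)) ∨ (H c = y ∧ p ≤ c ∧ c < p + s))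
    (hy : y < n) (hAB : A < B) (hB : B ≤ n) (h1 : H A < n) (h2 : H (B - 1) < n) (h3 : A = 0 ∨ H (A - 1) ≠ H A) (h4 : B = n ∨ H B ≠ H A) (hs : p + s ≤ n) :
    p = A ∧ p + s = B ∧ y = H A := by
  have k1 := K A (by omega)
  have k2 := K (B - 1) (by omega)
  have k3 := K (A - 1) (by omega)
  by_cases e : B = n
  · omega
  · have k4 := K B (by omega); omega

set_option maxHeartbeats 8000000 in
theorem fin2_ok : Snd (fun _ => G0) 18 0 2 := by
  intro S V n D P H sq L h x hr xr R a b hD hg hS hB hL hR ha hb hk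
  have hedge := hL.edge
  obtain ⟨rh, rx, hhr, hx, hH, hR'⟩ := hR
  obtain ⟨rhr, rxr⟩ := hR'.rh
  have hrn := hR'.hle hB.pt.le
  have hxn := hR'.xle
  have rN := Rg_cN hB.r
  have vN := hB.n
  cases L with
  | nil => have := hL.2.2.1; omega
  | cons hl xl L =>
  obtain ⟨-, -, hhl, hxl, hHl, hor, hL'⟩ := hL
  obtain ⟨rhl, rxl⟩ := hL'.rh
  have hredge := hR'.edge
  obtain ⟨s, s0, sw, sn, sD, sP, spt⟩ := place hD hB.pt hx hxn (by omega) hH hedge (by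
    rcases hredge with e | ⟨e, e'⟩
    · exact Or.inl e
    · right; rw [e']; exact hhr)
  have sc : (D \ insert (V x, V h, s) P).card = 1 := by
    have h1 := hB.card
    have : D \ insert (V x, V h, s) P = (D \ P).erase (V x, V h, s) := by
      ext q; simp only [mem_sdiff, mem_insert, mem_erase]; tauto
    rw [this, card_erase_of_mem (mem_sdiff.2 ⟨sD, sP⟩), h1]
  obtain ⟨H1, hH1⟩ : ∃ H1 : ℕ → ℕ, H1 = fun c => if V x ≤ c ∧ c < V x + s then V h + s else H c := ⟨_, rfl⟩
  rw [← hH1] at spt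
  obtain ⟨p, y, t, tD, tP, De, t0, yt, pt, K⟩ := last hD spt sc
  have a1 : ∀ c, V x ≤ c → c < V x + s → H1 c = V h + s := fun c c1 c2 => by rw [hH1]; exact if_pos ⟨c1, c2⟩
  have a2 : ∀ c, c < V x → H1 c = H c := fun c c1 => by rw [hH1]; exact if_neg (by omega)
  have a3 : ∀ c, V x + s ≤ c → H1 c = H c := fun c c1 => by rw [hH1]; exact if_neg (by omega)
  have a4 : ∀ c, V x + s ≤ c → c < V xr → H1 c = V h := fun c c1 c2 => by rw [a3 c c1]; exact hH c (by omega) c2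
  clear hH1
  have b1 := a1 (V x) le_rfl (by omega)
  have b2 := a1 (V x + s - 1) (by omega) (by omega)
  have Kx := K (V x) (by omega)
  have Kl : V xl < V x → H1 (V x - 1) = V hl := fun e => by rw [a2 _ (by omega)]; exact hHl _ (by omega) (by omega)
  have Kr : V x + s < V xr → H1 (V xr - 1) = V h := fun e => a4 _ (by omega) (by omega)
  have Kr' := K (V xr - 1) (by omega)
  have Ke : V xr = n ∨ H1 (V xr) = V hr := by
    rcases hredge with e | ⟨e, e'⟩
    · exact Or.inl e
    · right; rw [a3 _ (by omega), e']
  have hk' : fin2 7840 S a b sq (LL.cons hl xl L) h x hr xr R = true := hk 0 (by norm_num)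
  cases L with
  | nil =>
    obtain ⟨-, -, vhl, vxl⟩ := hL'
    have hk2 : fin2a 7840 S sq h x hr xr R = true := hk'
    have El : V x = 0 ∨ H1 (V x - 1) = n := by
      by_cases e : V x = 0
      · exact Or.inl e
      · right; rw [Kl (by omega), vhl]
    cases R with
    | nil =>
      obtain ⟨-, -, vhr, -, hHr⟩ := hR'
      have hk3 : finS 7840 S sq h x xr = true := hk2
      unfold finS at hk3
      rw [an_eq, Bool.and_eq_true] at hk3
      obtain ⟨kA, kB⟩ := hk3
      obtain ⟨v, d, hS'⟩ := hS
      have w0 := f4_rp hS' rN rx rh rxr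
      by_cases c : V x + s = V xr
      · have hlt : V h + s < n := by
          by_contra hc
          have e1 := K p (by omega)
          by_cases q1 : p < V x
          · rw [a2 _ q1, hHl _ (by omega) q1] at e1; omega
          · by_cases q2 : p < V xr
            · rw [a1 _ (by omega) (by omega)] at e1; omega
            · rw [a3 _ (by omega), hHr _ (by omega) (by omega)] at e1; omega
        obtain ⟨i1, i2, i3⟩ := seg K (A := V x) (B := V xr) (by omega) hx hxn (by omega) (by rw [← c]; omega) (by omega) (by omega) pt
        have w1 := rp_add3 w0 (row_rp hS' rx) (row_rp hS' rxr) (by norm_num)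
        rw [show ((V cN : ℤ) + V x - (V h + V xr) + V x - V xr) = 0 by omega] at w1
        have kA1 := zchk_ok hS'.vp w1 (by norm_num) kA
        have w2 := rp_add3 (row_rp hS' rh) (row_rp hS' rxr) (row_rp hS' rx) (by norm_num)
        rw [show ((V h : ℤ) + V xr - V x) = ((V h + s : ℕ) : ℤ) by omega] at w2
        obtain ⟨S1, hS1, k1⟩ := addr_ok hS' w2 (by norm_num) (by omega) (rfl : 7840 = 64 + 432 * 18) kA1
        have hV := upd_rg1 (ρ := 18) V (V h + s)
        set V' := Function.update V (64 + 432 * 18) (V h + s) with hV'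
        have vT : V' 7840 = V h + s := by rw [hV']; exact Function.update_self ..
        have rT : Rg 19 7840 := ⟨18, by norm_num, by norm_num, rfl⟩
        have m19 : ∀ {a}, Rg 18 a → Rg 19 a := fun h => h.mono (by norm_num)
        obtain ⟨z1, z2⟩ := SqI.congr (ρ' := 19) (by omega) hV hB.sqI
        refine leaf2_fin (fz4_ok ⟨v, d, hS1⟩ (m19 rN) (m19 rx) rT (m19 rxr) ?_ (k1 _ kA1)) z1 (m19 rN) (by rw [hV _ rN, vN]) (by rw [z2, hB.sqP]) (by rw [z2]; exact hB.sqN) hg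
          (m19 rx) (m19 rh) rT (m19 rx) rT (m19 rN) (hV _ rx) (hV _ rh) vT ?_ ?_ ?_ s0 t0 sP tP De
        · rw [hV _ rN, hV _ rx, hV _ rxr, vT]; omega
        · rw [hV _ rx]; omega
        · rw [vT]; omega
        · rw [hV _ rN]; omega
      · have k0 := Kr (by omega)
        obtain ⟨i1, i2, i3⟩ := seg K (A := V x + s) (B := V xr) (by omega) (by omega) hxn (by rw [a4 _ le_rfl (by omega)]; omega) (by omega) (by
          right; rw [b2, a4 _ le_rfl (by omega)]; omega) (by rw [a4 _ le_rfl (by omega)]; omega) pt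
        rw [a4 _ le_rfl (by omega)] at i3
        have w1 := rp_add3 w0 (row_rp hS' rN) (row_rp hS' rh) (by norm_num)
        rw [show ((V cN : ℤ) + V x - (V h + V xr) + V cN - V h) = 0 by omega] at w1
        have kA1 := zchk_ok hS'.vp w1 (by norm_num) kB
        have w2 := rp_add3 (row_rp hS' rx) (row_rp hS' rN) (row_rp hS' rh) (by norm_num)
        rw [show ((V x : ℤ) + V cN - V h) = ((V x + s : ℕ) : ℤ) by omega] at w2
        obtain ⟨S1, hS1, k1⟩ := addr_ok hS' w2 (by norm_num) (by omega) (rfl : 7840 = 64 + 432 * 18) kA1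
        have hV := upd_rg1 (ρ := 18) V (V x + s)
        set V' := Function.update V (64 + 432 * 18) (V x + s) with hV'
        have vT : V' 7840 = V x + s := by rw [hV']; exact Function.update_self ..
        have rT : Rg 19 7840 := ⟨18, by norm_num, by norm_num, rfl⟩
        have m19 : ∀ {a}, Rg 18 a → Rg 19 a := fun h => h.mono (by norm_num)
        obtain ⟨z1, z2⟩ := SqI.congr (ρ' := 19) (by omega) hV hB.sqI
        refine leaf2_fin (fz4_ok ⟨v, d, hS1⟩ (m19 rN) rT (m19 rh) (m19 rxr) ?_ (k1 _ kA1)) z1 (m19 rN) (by rw [hV _ rN, vN]) (by rw [z2, hB.sqP]) (by rw [z2]; exact hB.sqN) hg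
          (m19 rx) (m19 rh) (m19 rN) rT (m19 rh) (m19 rN) (hV _ rx) (hV _ rh) ?_ ?_ ?_ ?_ s0 t0 sP tP De
        · rw [hV _ rN, hV _ rh, hV _ rxr, vT]; omega
        · rw [hV _ rN]; omega
        · rw [vT]; omega
        · rw [hV _ rh]; omega
        · rw [hV _ rN]; omega
    | dn h3 x3 R3 =>
      obtain ⟨-, -, v1, v2, v3, hR3⟩ := hR'
      obtain ⟨rh3, rx3⟩ := hR3.rh
      have hk3 : finD S sq h x hr xr h3 x3 R3 = true := hk2
      have ex3 := hR3.xle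
      have f0 : H1 (V xr) = V hr := by rw [a3 _ (by omega)]; exact v3 _ le_rfl v2
      have f1 : H1 (V x3 - 1) = V hr := by rw [a3 _ (by omega)]; exact v3 _ (by omega) (by omega)
      have k0 := K (V xr) (by omega)
      have k1 := K (V x3 - 1) (by omega)
      cases R3 with
      | nil => have := hR3.2.2.1; omega
      | dn h4 x4 R4 =>
        obtain ⟨-, -, v4, v5, v6, hR4⟩ := hR3
        have f2 : H1 (V x3) = V h3 := by rw [a3 _ (by omega)]; exact v6 _ le_rfl v5
        have k2 := K (V x3) (by have := hR4.xle; omega)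
        have ex4 := hR4.xle
        cases R4 with
        | nil => have := hR4.2.2.1; omega
        | dn h5 x5 R5 =>
          have := hR4.2.2.2.2.2.xle
          have f3 : H1 (V x4) = V h4 := by rw [a3 _ (by omega)]; exact hR4.2.2.2.2.1 _ le_rfl hR4.2.2.2.1
          have := hR4.2.2.2.1
          have := K (V x4) (by omega)
          omega
        | up h5 x5 R5 =>
          have := hR4.2.2.2.2.2.xle
          have f3 : H1 (V x4) = V h4 := by rw [a3 _ (by omega)]; exact hR4.2.2.2.2.1 _ le_rfl hR4.2.2.2.1
          have := hR4.2.2.2.1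
          have := K (V x4) (by omega)
          omega
      | up h4 x4 R4 =>
        have hk4 : close4 cN hr cN x h xr cN x3 h3 x4 (SL.cons x3 h3 cN (SL.cons x h cN sq)) S = true := hk3
        obtain ⟨-, -, v4, v5, v6, hR4⟩ := hR3
        obtain ⟨rh4, rx4⟩ := hR4.rh
        have ex4 := hR4.xle
        have f2 : H1 (V x3) = V h3 := by rw [a3 _ (by omega)]; exact v6 _ le_rfl v5
        have f3 : H1 (V x4 - 1) = V h3 := by rw [a3 _ (by omega)]; exact v6 _ (by omega) (by omega)
        have f4 : V x4 = n ∨ H1 (V x4) = V h4 := by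
          rcases hR4.edge with e | ⟨e, e'⟩
          · exact Or.inl e
          · right; rw [a3 _ (by omega), e']
        have k2 := K (V x3) (by omega)
        have hw : V x + s = V xr := by
          by_contra hc
          have := Kr (by omega)
          omega
        obtain ⟨i1, i2, i3⟩ := seg K (A := V x3) (B := V x4) (by omega) v5 ex4 (by omega) (by omega) (by omega) (by omega) pt
        exact leaf2_fin (close4_ok hS rN rhr (by omega) rN rx rh rxr (by omega) rN rx3 rh3 rx4 (by omega) hk4) hB.sqI rN vN hB.sqP hB.sqN hg
          rx rh rN rx3 rh3 rN rfl rfl (by omega) (by omega) (by omega) (by omega) s0 t0 sP tP De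
    | up h3 x3 R3 =>
      obtain ⟨-, -, v1, v2, v3, hR3⟩ := hR'
      obtain ⟨rh3, rx3⟩ := hR3.rh
      have hk3 : finU S sq h x hr xr x3 = true := hk2
      unfold finU at hk3
      rw [an_eq, Bool.and_eq_true] at hk3
      obtain ⟨kA, kB⟩ := hk3
      have ex3 := hR3.xle
      have hh3 := hR3.hle hB.pt.le
      have f0 : H1 (V xr) = V hr := by rw [a3 _ (by omega)]; exact v3 _ le_rfl v2
      have f1 : H1 (V x3 - 1) = V hr := by rw [a3 _ (by omega)]; exact v3 _ (by omega) (by omega)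
      have f4 : V x3 = n ∨ H1 (V x3) = V h3 := by
        rcases hR3.edge with e | ⟨e, e'⟩
        · exact Or.inl e
        · right; rw [a3 _ (by omega), e']
      have k0 := K (V xr) (by omega)
      have k1 := K (V x3 - 1) (by omega)
      have hw : V x + s = V xr := by
        by_contra hc
        have := Kr (by omega)
        omega
      have hw' : H1 (V xr - 1) = V h + s := by rw [← hw]; exact b2
      by_cases c : V h + s = n
      · obtain ⟨i1, i2, i3⟩ := seg K (A := V xr) (B := V x3) (by omega) v2 ex3 (by omega) (by omega) (by omega) (by omega) pt
        exact leaf2_fin (close2_ok hS rN rx rh rxr (by omega) rN rxr rhr rx3 (by omega) kB) hB.sqI rN vN hB.sqP hB.sqN hg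
          rx rh rN rxr rhr rN rfl rfl (by omega) (by omega) (by omega) (by omega) s0 t0 sP tP De
      · obtain ⟨i1, i2, i3⟩ := seg K (A := V x) (B := V x3) (by omega) (by omega) ex3 (by omega) (by omega) (by omega) (by omega) pt
        exact leaf2_fin (close2_ok hS rhr rx rh rxr (by omega) rN rx rhr rx3 (by omega) kA) hB.sqI rN vN hB.sqP hB.sqN hg
          rx rh rhr rx rhr rN rfl rfl (by omega) (by omega) (by omega) (by omega) s0 t0 sP tP De
  | cons hl2 xl2 L2 =>
    have hk2 : fin2b S sq hl xl h x hr xr R = true := hk'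
    have hlt : V xl < V x := hor.resolve_right (by simp)
    have le1 := hL'.edge
    obtain ⟨-, -, u1, u2, u3, u4, hL2⟩ := hL'
    have hl2n := hL2.le
    have g0 := Kl hlt
    have g1 : H1 (V xl) = V hl := by rw [a2 _ (by omega)]; exact hHl _ le_rfl hlt
    have g2 : V xl = 0 ∨ V hl < H1 (V xl - 1) := by
      rcases le1 with e | e
      · exact Or.inl e
      · right; rw [a2 _ (by omega)]; exact e
    have j0 := K (V x - 1) (by omega)
    have j1 := K (V xl) (by omega)
    have hw : V x + s = V xr := by
      by_contra hc
      have := Kr (by omega)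
      omega
    have hw' : H1 (V xr - 1) = V h + s := by rw [← hw]; exact b2
    cases R with
    | nil =>
      obtain ⟨-, -, vhr, -, -⟩ := hR'
      have hk3 : finN S sq hl xl h x xr = true := hk2
      unfold finN at hk3
      rw [an_eq, Bool.and_eq_true] at hk3
      obtain ⟨kA, kB⟩ := hk3
      by_cases c : V h + s = n
      · obtain ⟨i1, i2, i3⟩ := seg K (A := V xl) (B := V x) (by omega) hlt (by omega) (by omega) (by omega) (by omega) (by omega) pt
        exact leaf2_fin (close2_ok hS rN rx rh rxr (by omega) rN rxl rhl rx (by omega) kB) hB.sqI rN vN hB.sqP hB.sqN hg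
          rx rh rN rxl rhl rN rfl rfl (by omega) (by omega) (by omega) (by omega) s0 t0 sP tP De
      · obtain ⟨i1, i2, i3⟩ := seg K (A := V xl) (B := V xr) (by omega) (by omega) hxn (by omega) (by omega) (by omega) (by omega) pt
        exact leaf2_fin (close2_ok hS rhl rx rh rxr (by omega) rN rxl rhl rxr (by omega) kA) hB.sqI rN vN hB.sqP hB.sqN hg
          rx rh rhl rxl rhl rN rfl rfl (by omega) (by omega) (by omega) (by omega) s0 t0 sP tP De
    | dn h3 x3 R3 =>
      exfalso
      obtain ⟨-, -, v1, v2, v3, hR3⟩ := hR'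
      have ex3 := hR3.xle
      have f0 : H1 (V xr) = V hr := by rw [a3 _ (by omega)]; exact v3 _ le_rfl v2
      have k0 := K (V xr) (by omega)
      rcases hR3.edge with e | ⟨e, e'⟩
      · cases R3 with
        | nil => have := hR3.2.2.1; omega
        | dn h4 x4 R4 => have := hR3.2.2.2.1; have := hR3.2.2.2.2.2.xle; omega
        | up h4 x4 R4 => have := hR3.2.2.2.1; have := hR3.2.2.2.2.2.xle; omega
      · have f1 : H1 (V x3) = V h3 := by rw [a3 _ (by omega), e']
        have k1 := K (V x3) (by omega)
        omega
    | up h3 x3 R3 =>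
      have hk3 : close4 hl hr hl x h xr cN xl hl x3 (SL.cons xl hl cN (SL.cons x h hl sq)) S = true := hk2
      obtain ⟨-, -, v1, v2, v3, hR3⟩ := hR'
      obtain ⟨rh3, rx3⟩ := hR3.rh
      have ex3 := hR3.xle
      have hh3 := hR3.hle hB.pt.le
      have f0 : H1 (V xr) = V hr := by rw [a3 _ (by omega)]; exact v3 _ le_rfl v2
      have f1 : H1 (V x3 - 1) = V hr := by rw [a3 _ (by omega)]; exact v3 _ (by omega) (by omega)
      have f4 : V x3 = n ∨ H1 (V x3) = V h3 := by
        rcases hR3.edge with e | ⟨e, e'⟩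
        · exact Or.inl e
        · right; rw [a3 _ (by omega), e']
      have k0 := K (V xr) (by omega)
      have k1 := K (V x3 - 1) (by omega)
      obtain ⟨i1, i2, i3⟩ := seg K (A := V xl) (B := V x3) (by omega) (by omega) ex3 (by omega) (by omega) (by omega) (by omega) pt
      exact leaf2_fin (close4_ok hS rhl rhr (by omega) rhl rx rh rxr (by omega) rN rxl rhl rx3 (by omega) hk3) hB.sqI rN vN hB.sqP hB.sqN hg
        rx rh rhl rxl rhl rN rfl rfl (by omega) (by omega) (by omega) (by omega) s0 t0 sP tP De
end PD

namespace PD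
open Finset

theorem sel_ok {g : Go} {ρ κ rem : ℕ} (h : Snd (fun _ => g) ρ κ rem) : Snd (fun i => selF i g) ρ κ rem := by
  intro S V n D P H sq L h1 x hr xr R a b hD hg hS hB hL hR ha hb hk
  refine h S V n D P H sq L h1 x hr xr R a b hD hg hS hB hL hR ha hb fun _ _ => ?_
  have : ift (Nat.beq (S % 12) (S % 12)) (g S a b sq L h1 x hr xr R) true = true := hk (S % 12) (Nat.mod_lt _ (by norm_num))
  rw [ift_eq, if_pos ((beq_iff _ _).2 rfl)] at this
  exact this

theorem G8_ok : Snd G8 2 8 10 := by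
  have g1 : Snd (fun _ => G1) 16 1 3 := step_ok (gs := (fun _ => G0)) (ρ := 16) (m := 0) (rem := 2) false fin2_ok (by norm_num) (by norm_num) (by norm_num)
  have g2 : Snd (fun _ => G2) 14 2 4 := step_ok (gs := (fun _ => G1)) (ρ := 14) (m := 1) (rem := 3) true g1 (by norm_num) (by norm_num) (by norm_num)
  have g3 : Snd (fun _ => G3) 12 3 5 := step_ok (gs := (fun _ => G2)) (ρ := 12) (m := 2) (rem := 4) true g2 (by norm_num) (by norm_num) (by norm_num)
  have g4 : Snd (fun _ => G4) 10 4 6 := step_ok (gs := (fun _ => G3)) (ρ := 10) (m := 3) (rem := 5) true g3 (by norm_num) (by norm_num) (by norm_num)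
  have g5 : Snd G5 8 5 7 := step_ok (gs := (fun i => selF i G4)) (ρ := 8) (m := 4) (rem := 6) true (sel_ok g4) (by norm_num) (by norm_num) (by norm_num)
  have g6 : Snd G6 6 6 8 := step_ok (gs := G5) (ρ := 6) (m := 5) (rem := 7) true g5 (by norm_num) (by norm_num) (by norm_num)
  have g7 : Snd G7 4 7 9 := step_ok (gs := G6) (ρ := 4) (m := 6) (rem := 8) true g6 (by norm_num) (by norm_num) (by norm_num)
  exact step_ok (gs := G7) (ρ := 2) (m := 7) (rem := 9) true g7 (by norm_num) (by norm_num) (by norm_num)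

def S0 : ℕ := hs (Nat.add off (Nat.shiftLeft 1 816))

theorem S0_dg : ∀ k < 171, dg (un S0) k = if k = 17 then oo + 1 else oo := by decide +kernel
theorem S0_lt : un S0 < cB ^ 171 := by decide +kernel

theorem S0_co {r j : ℕ} (hr : r < 19) (hj : j < 9) : co S0 r j = if 9 * r + j = 17 then 1 else 0 := by
  unfold co; rw [S0_dg _ (by omega)]; split_ifs <;> push_cast <;> ring

theorem S0_ok (n : ℕ) (hn : 0 < n) : Sm S0 2 8 (fun a => if a = cN then n else 0) := by
  refine ⟨fun _ => n, 1, ⟨S0_lt, ?_, ?_, ?_⟩, fun _ => by exact_mod_cast hn, one_pos, ?_⟩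
  · intro r hr j hj; rw [S0_co hr hj]; split_ifs <;> norm_num
  · intro r hr h2 j hj; rw [S0_co hr hj, if_neg (by omega)]
  · intro r hr j hj h8; rw [S0_co hr hj, if_neg (by omega)]
  · intro r h2 hr
    have : ∀ j ∈ range 9, co S0 r j * (n : ℤ) = (if 9 * r + j = 17 then 1 else 0) * (n : ℤ) := fun j hj => by rw [S0_co hr (mem_range.1 hj)]
    unfold ev; rw [sum_congr rfl this]
    have : r = 0 ∨ r = 1 := by omega
    rcases this with rfl | rfl
    · simp [sum_range_succ, cN]
    · simp [sum_range_succ, cN]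

theorem main_snd (hrun : ∀ i < 12, run i = true) {n : ℕ} {D : Finset (ℕ × ℕ × ℕ)} (hn : 0 < n) (hD : Dis n D)
    (hg : D.gcd (fun q => q.2.2) = 1) (hc : D.card = 10) : Concl n D := by
  have r0 : Rg 2 c64 := ⟨0, by norm_num, by norm_num, rfl⟩
  have r1 : Rg 2 cN := ⟨1, by norm_num, by norm_num, rfl⟩
  refine G8_ok S0 (fun a => if a = cN then n else 0) n D ∅ (fun _ => 0) SL.nil (LL.cons cN c64 LL.nil) c64 c64 cN cN RL.nil 9 9
    hD hg (S0_ok n hn) ⟨⟨by simp, by simp, by simp, by simp⟩, by simpa using hc, trivial, rfl, List.nodup_nil, if_pos rfl, le_rfl⟩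
    ⟨r0, r0, ?_, le_rfl, ?_, Or.inr rfl, r1, r0, if_pos rfl, rfl⟩
    ⟨r0, r0, ?_, ?_, fun _ _ _ => rfl, r1, r1, if_pos rfl, (if_pos rfl).le, ?_⟩ rfl rfl ?_
  · simpa [c64, cN] using hn
  · intro c h1 h2; exact absurd h2 (by omega)
  · simpa [c64, cN] using hn
  · simpa [c64, cN] using hn
  · intro c h1 h2; have h1 : (if cN = cN then n else 0) ≤ c := h1
    rw [if_pos rfl] at h1; omega
  · intro i hi
    have := hrun i hi
    unfold run at this; rw [frc_eq] at this; exact this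
end PD

namespace PD
open Finset

def codes : ℕ → ℕ → List ℕ
  | 0, _ => []
  | n + 1, c => c % 1000 :: codes n (c / 1000)

theorem keyC_eq (n : ℕ) : ∀ c, keyC n c = ((codes n c).map (2 ^ ·)).sum := by
  induction n with
  | zero => intro c; rfl
  | succ n ih =>
    intro c
    rw [codes, List.map_cons, List.sum_cons, ← ih, ← Nat.one_shiftLeft]; rfl

theorem codes_len (n : ℕ) : ∀ c, (codes n c).length = n := by
  induction n with
  | zero => intro c; rfl
  | succ n ih => intro c; rw [codes, List.length_cons, ih]

theorem isT_mem {k : ℕ} (h : isT k = true) : ∃ t ∈ tbl, k = keyC 10 t := by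
  unfold isT at h
  generalize tbl = l at h
  induction l with
  | nil => exact absurd h (by simp)
  | cons t l ih =>
    have h : ift (Nat.beq k (keyC 10 t)) true (List.rec false (fun t _ ih => ift (Nat.beq k (keyC (nat_lit 10) t)) true ih) l) = true := h
    rw [ift_eq] at h
    split_ifs at h with hc
    · exact ⟨t, List.mem_cons_self, (beq_iff _ _).1 hc⟩
    · obtain ⟨t', h1, h2⟩ := ih h
      exact ⟨t', List.mem_cons_of_mem _ h1, h2⟩

def sqOf (k : ℕ) : ℕ × ℕ × ℕ := (k / 100, k / 10 % 10, k % 10)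
theorem ky_sqOf (k : ℕ) : ky (sqOf k) = k := by simp only [ky, sqOf]; omega
theorem sqOf_ky {q : ℕ × ℕ × ℕ} (h1 : q.2.1 < 10) (h2 : q.2.2 < 10) : sqOf (ky q) = q := by
  obtain ⟨x, y, s⟩ := q
  simp only [ky, sqOf, Prod.mk.injEq] at *; omega

def dj (a b : ℕ × ℕ × ℕ) : Bool :=
  Nat.ble (a.1 + a.2.2) b.1 || (Nat.ble (b.1 + b.2.2) a.1 || (Nat.ble (a.2.1 + a.2.2) b.2.1 || Nat.ble (b.2.1 + b.2.2) a.2.1))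
def djs : List (ℕ × ℕ × ℕ) → Bool
  | [] => true
  | q :: t => t.all (dj q) && djs t
def nOf (l : List (ℕ × ℕ × ℕ)) : ℕ := l.foldr (fun q m => max (q.1 + q.2.2) m) 0
def chkL (l : List (ℕ × ℕ × ℕ)) (n : ℕ) : Bool :=
  (l.all fun q => Nat.ble 1 q.2.2 && (Nat.ble (q.1 + q.2.2) n && Nat.ble (q.2.1 + q.2.2) n)) &&
    (djs l && (Nat.beq ((l.map fun q => q.2.2 * q.2.2).sum) (n * n) && Nat.beq (gcdL l) 1))

theorem dj_ok {a b : ℕ × ℕ × ℕ} (h : dj a b = true) (c y : ℕ) : ¬ (Cell a c y ∧ Cell b c y) := by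
  unfold dj at h
  simp only [Bool.or_eq_true, ble_iff] at h
  unfold Cell; omega

theorem djs_pw : ∀ {l : List (ℕ × ℕ × ℕ)}, djs l = true → l.Pairwise fun a b => dj a b = true
  | [], _ => List.Pairwise.nil
  | q :: t, h => by
    rw [djs, Bool.and_eq_true, List.all_eq_true] at h
    exact List.Pairwise.cons h.1 (djs_pw h.2)

theorem chk_ok {l : List (ℕ × ℕ × ℕ)} {n : ℕ} (h : chkL l n = true) :
    Dis n l.toFinset ∧ l.toFinset.gcd (fun q => q.2.2) = 1 ∧ l.Nodup := by
  unfold chkL at h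
  simp only [Bool.and_eq_true, List.all_eq_true, ble_iff, beq_iff] at h
  obtain ⟨h1, h2, h3, h4⟩ := h
  have pw := djs_pw h2
  have self : ∀ q ∈ l, Cell q q.1 q.2.1 := fun q hq => by have := (h1 q hq).1; unfold Cell; omega
  have nd : l.Nodup := by
    refine List.Pairwise.imp_of_mem ?_ pw
    rintro a b ha hb hd rfl
    exact dj_ok hd _ _ ⟨self a ha, self a ha⟩
  have uni : ∀ q ∈ l, ∀ q' ∈ l, ∀ c y, Cell q c y → Cell q' c y → q = q' := by
    have : Std.Symm fun q q' : ℕ × ℕ × ℕ => ∀ c y, Cell q c y → Cell q' c y → q = q' := ⟨fun a b hab c y h1 h2 => (hab c y h2 h1).symm⟩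
    have := List.Pairwise.forall_of_forall (l := l) (R := fun q q' => ∀ c y, Cell q c y → Cell q' c y → q = q')
      (fun _ _ _ _ _ _ => rfl)
      (pw.imp fun hd c y h1 h2 => absurd ⟨h1, h2⟩ (dj_ok hd c y))
    intro q hq q' hq'; exact this hq hq'
  refine ⟨⟨?_, ?_, ?_, ?_⟩, by rw [← gcdL_eq, h4], nd⟩
  · intro q hq; exact (h1 q (List.mem_toFinset.1 hq)).1
  · intro q hq; exact (h1 q (List.mem_toFinset.1 hq)).2
  · have hmem : ∀ (q : ℕ × ℕ × ℕ) (z : ℕ × ℕ), z ∈ Ico q.1 (q.1 + q.2.2) ×ˢ Ico q.2.1 (q.2.1 + q.2.2) ↔ Cell q z.1 z.2 := by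
      intro q z; simp only [mem_product, mem_Ico, Cell]; tauto
    have e : (l.toFinset.biUnion fun q => Ico q.1 (q.1 + q.2.2) ×ˢ Ico q.2.1 (q.2.1 + q.2.2)) = range n ×ˢ range n := by
      apply eq_of_subset_of_card_le
      · intro z hz
        obtain ⟨q, hq, hz⟩ := mem_biUnion.1 hz
        rw [hmem] at hz
        have := h1 q (List.mem_toFinset.1 hq)
        rw [mem_product, mem_range, mem_range]; unfold Cell at hz; omega
      · rw [card_biUnion]
        · simp only [card_product, Nat.card_Ico, card_range, Nat.add_sub_cancel_left]
          rw [List.sum_toFinset _ nd, h3]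
        · intro q hq q' hq' hne
          refine Finset.disjoint_left.2 ?_
          intro z hz hz'
          rw [hmem] at hz hz'
          exact hne (uni q (List.mem_toFinset.1 hq) q' (List.mem_toFinset.1 hq') _ _ hz hz')
    intro c hc y hy
    have : (c, y) ∈ range n ×ˢ range n := by rw [mem_product, mem_range, mem_range]; exact ⟨hc, hy⟩
    rw [← e] at this
    obtain ⟨q, hq, hz⟩ := mem_biUnion.1 this
    exact ⟨q, hq, (hmem q _).1 hz⟩
  · intro q hq q' hq'; exact uni q (List.mem_toFinset.1 hq) q' (List.mem_toFinset.1 hq')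

def lst (t : ℕ) : List (ℕ × ℕ × ℕ) := (codes 10 t).map sqOf
def ent (t : ℕ) : ℕ × Finset (ℕ × ℕ × ℕ) := (nOf (lst t), (lst t).toFinset)

noncomputable def srt : ℕ → List ℕ → Bool
  | _, [] => true
  | k, t :: l => frc (keyC 10 t) fun k' => an (Nat.ble (k + 1) k') (srt k' l)

theorem tbl_chk : (tbl.all fun t => chkL (lst t) (nOf (lst t))) = true := by decide +kernel
theorem tbl_srt : srt 0 tbl = true := by decide +kernel
theorem tbl_len : tbl.length = 384 := by decide +kernel

theorem srt_ok : ∀ {l : List ℕ} {k : ℕ}, srt k l = true → (∀ t ∈ l, k < keyC 10 t) ∧ l.Pairwise fun a b => keyC 10 a < keyC 10 b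
  | [], _, _ => ⟨by simp, List.Pairwise.nil⟩
  | t :: l, k, h => by
    rw [srt, frc_eq, an_eq, Bool.and_eq_true, ble_iff] at h
    obtain ⟨h1, h2⟩ := srt_ok h.2
    refine ⟨?_, List.Pairwise.cons h1 h2⟩
    intro t' ht'
    rcases List.mem_cons.1 ht' with rfl | ht'
    · exact h.1
    · exact lt_trans h.1 (h1 t' ht')

theorem ent_ok {t : ℕ} (ht : t ∈ tbl) : Dis (ent t).1 (ent t).2 ∧ (ent t).2.gcd (fun q => q.2.2) = 1 ∧ (ent t).2.card = 10 ∧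
    (ent t).2.image ky = (codes 10 t).toFinset ∧ (codes 10 t).Nodup := by
  obtain ⟨h1, h2, h3⟩ := chk_ok (List.all_eq_true.1 tbl_chk t ht)
  refine ⟨h1, h2, ?_, ?_, List.Nodup.of_map _ h3⟩
  · show (lst t).toFinset.card = 10
    rw [List.toFinset_card_of_nodup h3, lst, List.length_map, codes_len]
  · ext k
    simp only [ent, lst, mem_image, List.mem_toFinset, List.mem_map]
    constructor
    · rintro ⟨_, ⟨k', hk, rfl⟩, rfl⟩; rwa [ky_sqOf]
    · intro hk; exact ⟨_, ⟨k, hk, rfl⟩, ky_sqOf k⟩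

theorem key_sum {t : ℕ} (ht : t ∈ tbl) : keyC 10 t = ∑ k ∈ (codes 10 t).toFinset, 2 ^ k := by
  rw [keyC_eq, List.sum_toFinset _ (ent_ok ht).2.2.2.2]

theorem ent_inj : ∀ t ∈ tbl, ∀ t' ∈ tbl, ent t = ent t' → t = t' := by
  intro t ht t' ht' he
  have : keyC 10 t = keyC 10 t' := by
    rw [key_sum ht, key_sum ht', ← (ent_ok ht).2.2.2.1, ← (ent_ok ht').2.2.2.1, he]
  by_contra hne
  have hsym : Std.Symm fun a b => keyC 10 a = keyC 10 b → a = b := ⟨fun a b hab e => (hab e.symm).symm⟩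
  have h2 := List.Pairwise.forall_of_forall (l := tbl) (R := fun a b => keyC 10 a = keyC 10 b → a = b)
      (fun _ _ _ => rfl) ((srt_ok tbl_srt).2.imp fun hd e => absurd e hd.ne)
  exact hne (h2 ht ht' this)

theorem tbl_nodup : tbl.Nodup := (srt_ok tbl_srt).2.imp fun hd e => by subst e; exact lt_irrefl _ hd

theorem Dis.n_le {n n' : ℕ} {D : Finset (ℕ × ℕ × ℕ)} (h : Dis n D) (h' : Dis n' D) : n ≤ n' := by
  by_contra hc
  obtain ⟨q, hq, a, b, c, d⟩ := h.cov (n - 1) (by omega) (n - 1) (by omega)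
  have := h'.ins q hq
  omega

theorem concl_ent {n : ℕ} {D : Finset (ℕ × ℕ × ℕ)} (hD : Dis n D) (hc : Concl n D) : ∃ t ∈ tbl, ent t = (n, D) := by
  obtain ⟨hn, h⟩ := hc
  obtain ⟨t, ht, hk⟩ := isT_mem h
  have hdig : ∀ q ∈ D, sqOf (ky q) = q := fun q hq => by
    have := hD.ins q hq; have := hD.pos q hq; exact sqOf_ky (by omega) (by omega)
  have hinj : ∀ q ∈ D, ∀ q' ∈ D, ky q = ky q' → q = q' := fun q hq q' hq' e => by
    rw [← hdig q hq, e, hdig q' hq']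
  rw [← sum_image (f := fun k => 2 ^ k) (g := ky) hinj, key_sum ht] at hk
  have e := Finset.geomSum_injective (n := 2) le_rfl hk
  have e2 : (ent t).2 = D := by
    have : (ent t).2 = (codes 10 t).toFinset.image sqOf := by
      ext q; simp only [ent, lst, mem_image, List.mem_toFinset, List.mem_map]
    rw [this, ← e]
    ext q; simp only [mem_image]
    constructor
    · rintro ⟨_, ⟨q', hq', rfl⟩, rfl⟩; rwa [hdig q' hq']
    · intro hq; exact ⟨_, ⟨q, hq, rfl⟩, hdig q hq⟩
  have h1 := (ent_ok ht).1
  rw [e2] at h1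
  exact ⟨t, ht, Prod.ext (le_antisymm (h1.n_le hD) (hD.n_le h1)) e2⟩
end PD

namespace PD
open Finset

theorem Dis.of {n : ℕ} {D : Finset (ℕ × ℕ × ℕ)} (h : IsDissection n D) : Dis n D := by
  obtain ⟨h1, h2, h3⟩ := h
  refine ⟨h1, ?_, ?_, ?_⟩
  · intro q hq
    have : (((q.1 : ℝ) + q.2.2, (q.2.1 : ℝ) + q.2.2) : ℝ × ℝ) ∈ ⋃ q ∈ D, closedSq q := by
      refine Set.mem_iUnion₂.2 ⟨q, hq, ⟨⟨?_, le_rfl⟩, ⟨?_, le_rfl⟩⟩⟩ <;> simp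
    rw [h2] at this
    obtain ⟨⟨-, a⟩, ⟨-, b⟩⟩ := this
    simp only at a b
    exact ⟨by exact_mod_cast a, by exact_mod_cast b⟩
  · intro c hc y hy
    have hc' : (c : ℝ) + 1 ≤ n := by exact_mod_cast hc
    have hy' : (y : ℝ) + 1 ≤ n := by exact_mod_cast hy
    have c0 : (0 : ℝ) ≤ c := Nat.cast_nonneg c
    have y0 : (0 : ℝ) ≤ y := Nat.cast_nonneg y
    have : (((c : ℝ) + 1 / 2, (y : ℝ) + 1 / 2) : ℝ × ℝ) ∈ ⋃ q ∈ D, closedSq q := by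
      rw [h2]; refine ⟨⟨?_, ?_⟩, ⟨?_, ?_⟩⟩ <;> simp only <;> linarith
    obtain ⟨q, hq, ⟨⟨a1, a2⟩, ⟨a3, a4⟩⟩⟩ := Set.mem_iUnion₂.1 this
    simp only at a1 a2 a3 a4
    refine ⟨q, hq, ?_, ?_, ?_, ?_⟩
    · have : (q.1 : ℝ) < (c : ℝ) + 1 := by linarith
      exact Nat.lt_succ_iff.1 (by exact_mod_cast this)
    · have : (c : ℝ) < q.1 + q.2.2 := by linarith
      exact_mod_cast this
    · have : (q.2.1 : ℝ) < (y : ℝ) + 1 := by linarith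
      exact Nat.lt_succ_iff.1 (by exact_mod_cast this)
    · have : (y : ℝ) < q.2.1 + q.2.2 := by linarith
      exact_mod_cast this
  · intro q hq q' hq' c y hc hc'
    by_contra hne
    have key : ∀ q : ℕ × ℕ × ℕ, Cell q c y → (((c : ℝ) + 1 / 2, (y : ℝ) + 1 / 2) : ℝ × ℝ) ∈ openSq q := by
      rintro q ⟨a1, a2, a3, a4⟩
      have b1 : (q.1 : ℝ) ≤ c := by exact_mod_cast a1
      have b2 : (c : ℝ) + 1 ≤ q.1 + q.2.2 := by exact_mod_cast a2
      have b3 : (q.2.1 : ℝ) ≤ y := by exact_mod_cast a3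
      have b4 : (y : ℝ) + 1 ≤ q.2.1 + q.2.2 := by exact_mod_cast a4
      refine ⟨⟨?_, ?_⟩, ⟨?_, ?_⟩⟩ <;> simp only <;> linarith
    have := h3 q hq q' hq' hne
    exact (Set.eq_empty_iff_forall_notMem.1 this) _ ⟨key q hc, key q' hc'⟩

theorem fl {n : ℕ} (hn : 0 < n) {a : ℝ} (h0 : 0 ≤ a) (h1 : a ≤ n) : ∃ c < n, (c : ℝ) ≤ a ∧ a ≤ c + 1 := by
  by_cases h : a < n
  · exact ⟨⌊a⌋₊, (Nat.floor_lt h0).2 h, Nat.floor_le h0, (Nat.lt_floor_add_one a).le⟩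
  · have e : ((n - 1 : ℕ) : ℝ) + 1 = n := by exact_mod_cast Nat.sub_add_cancel hn
    exact ⟨n - 1, by omega, by linarith, by linarith⟩

theorem Dis.to {n : ℕ} {D : Finset (ℕ × ℕ × ℕ)} (hn : 0 < n) (h : Dis n D) : IsDissection n D := by
  refine ⟨h.pos, ?_, ?_⟩
  · ext ⟨a, b⟩
    constructor
    · intro hm
      obtain ⟨q, hq, ⟨⟨a1, a2⟩, ⟨a3, a4⟩⟩⟩ := Set.mem_iUnion₂.1 hm
      simp only at a1 a2 a3 a4
      obtain ⟨i1, i2⟩ := h.ins q hq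
      have j1 : (q.1 : ℝ) + q.2.2 ≤ n := by exact_mod_cast i1
      have j2 : (q.2.1 : ℝ) + q.2.2 ≤ n := by exact_mod_cast i2
      have c0 : (0 : ℝ) ≤ q.1 := Nat.cast_nonneg _
      have y0 : (0 : ℝ) ≤ q.2.1 := Nat.cast_nonneg _
      refine ⟨⟨?_, ?_⟩, ⟨?_, ?_⟩⟩ <;> simp only <;> linarith
    · rintro ⟨⟨a1, a2⟩, ⟨a3, a4⟩⟩
      obtain ⟨c, hc, c1, c2⟩ := fl hn a1 a2
      obtain ⟨y, hy, y1, y2⟩ := fl hn a3 a4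
      simp only at c1 c2 y1 y2
      obtain ⟨q, hq, d1, d2, d3, d4⟩ := h.cov c hc y hy
      have b1 : (q.1 : ℝ) ≤ c := by exact_mod_cast d1
      have b2 : (c : ℝ) + 1 ≤ q.1 + q.2.2 := by exact_mod_cast d2
      have b3 : (q.2.1 : ℝ) ≤ y := by exact_mod_cast d3
      have b4 : (y : ℝ) + 1 ≤ q.2.1 + q.2.2 := by exact_mod_cast d4
      refine Set.mem_iUnion₂.2 ⟨q, hq, ⟨⟨?_, ?_⟩, ⟨?_, ?_⟩⟩⟩ <;> simp only <;> linarith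
  · intro q hq q' hq' hne
    rw [Set.eq_empty_iff_forall_notMem]
    rintro ⟨a, b⟩ ⟨⟨⟨a1, a2⟩, ⟨a3, a4⟩⟩, ⟨⟨b1, b2⟩, ⟨b3, b4⟩⟩⟩
    simp only at a1 a2 a3 a4 b1 b2 b3 b4
    have key : ∀ {x s : ℕ} {a : ℝ}, (x : ℝ) < a → a < x + s → x ≤ ⌊a⌋₊ ∧ ⌊a⌋₊ < x + s := by
      intro x s a h1 h2
      have h0 : 0 ≤ a := le_trans (Nat.cast_nonneg x) h1.le
      exact ⟨Nat.le_floor h1.le, (Nat.floor_lt h0).2 (by push_cast; exact h2)⟩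
    exact hne (h.uni q hq q' hq' ⌊a⌋₊ ⌊b⌋₊ ⟨(key a1 a2).1, (key a1 a2).2, key a3 a4⟩ ⟨(key b1 b2).1, (key b1 b2).2, key b3 b4⟩)

theorem Dis.n_pos {n : ℕ} {D : Finset (ℕ × ℕ × ℕ)} (h : Dis n D) (hc : D.card = 10) : 0 < n := by
  obtain ⟨q, hq⟩ := card_pos.1 (by omega : 0 < D.card)
  have := h.pos q hq; have := h.ins q hq; omega

theorem fin_count (hrun : ∀ i < 12, run i = true) :
    (∀ (n : ℕ) (D : Finset (ℕ × ℕ × ℕ)), IsPrimeDissection n D → D.card = 10 → n ≤ 13) ∧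
    {p : ℕ × Finset (ℕ × ℕ × ℕ) | IsPrimeDissection p.1 p.2 ∧ p.2.card = 10}.ncard = 384 := by
  have key : ∀ (n : ℕ) (D : Finset (ℕ × ℕ × ℕ)), IsPrimeDissection n D → D.card = 10 → Concl n D := by
    intro n D h hc
    have hD := Dis.of h.1
    exact main_snd hrun (hD.n_pos hc) hD h.2 hc
  refine ⟨fun n D h hc => (key n D h hc).1.trans (by norm_num), ?_⟩
  have e : {p : ℕ × Finset (ℕ × ℕ × ℕ) | IsPrimeDissection p.1 p.2 ∧ p.2.card = 10} = ((tbl.toFinset.image ent : Finset _) : Set _) := by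
    ext ⟨n, D⟩
    simp only [Set.mem_setOf_eq, mem_coe, mem_image, List.mem_toFinset]
    constructor
    · rintro ⟨h, hc⟩; exact concl_ent (Dis.of h.1) (key n D h hc)
    · rintro ⟨t, ht, he⟩
      obtain ⟨h1, h2, h3, -⟩ := ent_ok ht
      rw [he] at h1 h2 h3
      exact ⟨⟨h1.to (h1.n_pos h3), h2⟩, h3⟩
  rw [e, Set.ncard_coe_finset, card_image_of_injOn, List.toFinset_card_of_nodup tbl_nodup, tbl_len]
  intro t ht t' ht' h
  exact ent_inj t (List.mem_toFinset.1 ht) t' (List.mem_toFinset.1 ht') h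
end PD

namespace PD
theorem run0 : run 0 = true := by decide +kernel
theorem run1 : run 1 = true := by decide +kernel
theorem run2 : run 2 = true := by decide +kernel
theorem run3 : run 3 = true := by decide +kernel
theorem run4 : run 4 = true := by decide +kernel
theorem run5 : run 5 = true := by decide +kernel
theorem run6 : run 6 = true := by decide +kernel
theorem run7 : run 7 = true := by decide +kernel
theorem run8 : run 8 = true := by decide +kernel
theorem run9 : run 9 = true := by decide +kernel
theorem run10 : run 10 = true := by decide +kernel
theorem run11 : run 11 = true := by decide +kernel
theorem run_all : ∀ i < 12, run i = true := by
  intro i hi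
  interval_cases i
  exacts [run0, run1, run2, run3, run4, run5, run6, run7, run8, run9, run10, run11]
end PD

theorem count_prime_dissections_order_ten :
    (∀ (n : ℕ) (D : Finset (ℕ × ℕ × ℕ)), IsPrimeDissection n D → D.card = 10 → n ≤ 13) ∧
    {p : ℕ × Finset (ℕ × ℕ × ℕ) | IsPrimeDissection p.1 p.2 ∧ p.2.card = 10}.ncard = 384 := by
  exact PD.fin_count PD.run_all
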